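/- arXiv:1410.2198 — 3 statements merged into one kernel-verified Lean document; each statement's English description precedes it below -/
import Mathlib

section
/- Let D be a digraph on n vertices, c, ε > 0 constants, 0 < p < 1, U ⊆ V(D), and let s_1,...,s_k be positive integers with s_i ≥ (log n)^{1.1}/p for each i and s_1 + ... + s_k ≤ |U|. Then for n sufficiently large there exist pairwise disjoint subsets S_1,...,S_k ⊆ U with |S_i| = s_i such that for every vertex v ∈ V(D): if both the out-degree and in-degree of v into U are at least c·p·|U|, then the out-degree and in-degree of v into each S_i are at least (1−ε)·c·p·s_i. -/
open Filter

def outDeg {n : ℕ} (D : Fin n → Fin n → Bool) (v : Fin n) (S : Finset (Fin n)) : ℕ :=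
  (S.filter fun w => D v w = true).card

def inDeg {n : ℕ} (D : Fin n → Fin n → Bool) (v : Fin n) (S : Finset (Fin n)) : ℕ :=
  (S.filter fun w => D w v = true).card

def arcsIn {n : ℕ} (D : Fin n → Fin n → Bool) (X : Finset (Fin n)) : ℕ :=
  ((X ×ˢ X).filter fun e => D e.1 e.2 = true).card

def arcsBetween {n : ℕ} (D : Fin n → Fin n → Bool) (X Y : Finset (Fin n)) : ℕ :=
  ((X ×ˢ Y).filter fun e => D e.1 e.2 = true).card

/-- An `(n, α, p)`-pseudorandom digraph, as in Definition 3.1 of the paper. -/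
def IsPseudorandom (n : ℕ) (α p : ℝ) (D : Fin n → Fin n → Bool) : Prop :=
  (∀ v : Fin n, (1/2 + 2*α) * n * p ≤ (outDeg D v Finset.univ : ℝ) ∧
    (1/2 + 2*α) * n * p ≤ (inDeg D v Finset.univ : ℝ)) ∧
  (∀ X : Finset (Fin n), (X.card : ℝ) ≤ (Real.log n)^2 / p →
    (arcsIn D X : ℝ) ≤ (X.card : ℝ) * (Real.log n) ^ (2.1 : ℝ)) ∧
  (∀ X Y : Finset (Fin n), Disjoint X Y →
    (Real.log n) ^ (1.1 : ℝ) / p ≤ (X.card : ℝ) →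
    (Real.log n) ^ (1.1 : ℝ) / p ≤ (Y.card : ℝ) →
    (arcsBetween D X Y : ℝ) ≤ (1 + α/2) * X.card * Y.card * p)

theorem perm_step {α : Type*} [Fintype α] [DecidableEq α] (g : α → ℝ) (hg : ∀ y, 0 ≤ g y)
    (a : α) (T : Finset α) (ha : a ∉ T) :
    (Fintype.card α : ℝ) * ∑ σ : Equiv.Perm α, ∏ t ∈ insert a T, g (σ t) ≤
      (∑ y, g y) * ∑ σ : Equiv.Perm α, ∏ t ∈ T, g (σ t) := by
  classical
  set F : α → ℝ := fun y => ∑ σ : Equiv.Perm α with σ a = y, ∏ t ∈ T, g (σ t) with hF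
  have h1 : ∑ σ : Equiv.Perm α, ∏ t ∈ T, g (σ t) = ∑ y, F y := by
    rw [hF]
    exact (Finset.sum_fiberwise _ _ _).symm
  have h2 : ∑ σ : Equiv.Perm α, ∏ t ∈ insert a T, g (σ t) = ∑ y, g y * F y := by
    rw [← Finset.sum_fiberwise Finset.univ (fun σ : Equiv.Perm α => σ a)]
    refine Finset.sum_congr rfl fun y _ => ?_
    rw [hF, Finset.mul_sum]
    refine Finset.sum_congr rfl fun σ hσ => ?_
    rw [Finset.prod_insert ha]
    simp only [Finset.mem_filter] at hσ
    rw [hσ.2]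
  have h3 : Antivary g F := by
    intro y y' hlt
    by_contra hcon
    push Not at hcon
    refine absurd hlt (not_lt.2 ?_)
    simp only [hF]
    have hbij : ∑ σ : Equiv.Perm α with σ a = y', ∏ t ∈ T, g ((Equiv.swap y y' * σ) t) =
        ∑ σ : Equiv.Perm α with σ a = y, ∏ t ∈ T, g (σ t) := by
      refine Finset.sum_bijective (fun σ => Equiv.swap y y' * σ)
        (Group.mulLeft_bijective _) ?_ (fun _ _ => rfl)
      intro σ
      simp only [Finset.mem_filter, Finset.mem_univ, true_and, Equiv.Perm.mul_apply]
      rw [Equiv.swap_apply_eq_iff, Equiv.swap_apply_left]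
    rw [← hbij]
    · refine Finset.sum_le_sum fun σ hσ => ?_
      simp only [Finset.mem_filter, Finset.mem_univ, true_and] at hσ
      refine Finset.prod_le_prod (fun _ _ => hg _) fun t ht => ?_
      have hta : t ≠ a := fun h => ha (h ▸ ht)
      have hne : σ t ≠ y' := fun h => hta (σ.injective (h.trans hσ.symm))
      rw [Equiv.Perm.mul_apply]
      by_cases hy : σ t = y
      · rw [hy, Equiv.swap_apply_left]; exact hcon.le
      · rw [Equiv.swap_apply_of_ne_of_ne hy hne]
  rw [h1, h2]
  exact h3.card_mul_sum_le_sum_mul_sum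

theorem perm_prod {α : Type*} [Fintype α] [DecidableEq α] (g : α → ℝ) (hg : ∀ y, 0 ≤ g y)
    (T : Finset α) :
    (Fintype.card α : ℝ) ^ T.card * ∑ σ : Equiv.Perm α, ∏ t ∈ T, g (σ t) ≤
      (∑ y, g y) ^ T.card * (Fintype.card α).factorial := by
  induction T using Finset.induction_on with
  | empty => simp [Fintype.card_perm]
  | insert a T ha ih =>
    rw [Finset.card_insert_of_notMem ha, pow_succ, mul_assoc]
    calc _ ≤ (Fintype.card α : ℝ) ^ T.card *
          ((∑ y, g y) * ∑ σ : Equiv.Perm α, ∏ t ∈ T, g (σ t)) := by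
          exact mul_le_mul_of_nonneg_left (perm_step g hg a T ha) (by positivity)
      _ = (∑ y, g y) * ((Fintype.card α : ℝ) ^ T.card *
          ∑ σ : Equiv.Perm α, ∏ t ∈ T, g (σ t)) := by ring
      _ ≤ (∑ y, g y) * ((∑ y, g y) ^ T.card * (Fintype.card α).factorial) := by
          have : 0 ≤ ∑ y, g y := Finset.sum_nonneg fun y _ => hg y
          gcongr
      _ = _ := by ring

theorem perm_tail {α : Type*} [Fintype α] [DecidableEq α] [Nonempty α]
    (A : α → Prop) [DecidablePred A]
    (T : Finset α) (ε q μ : ℝ) (h0 : 0 < ε) (h1 : ε < 1)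
    (hμ : μ = q * T.card)
    (hd : q * Fintype.card α ≤ ((Finset.univ.filter A).card : ℝ)) :
    (((Finset.univ : Finset (Equiv.Perm α)).filter
      (fun σ => ((T.filter (fun t => A (σ t))).card : ℝ) < (1 - ε) * μ)).card : ℝ) ≤
      Real.exp (-(ε + (1 - ε) * Real.log (1 - ε)) * μ) * (Fintype.card α).factorial := by
  classical
  set m : ℝ := (Fintype.card α : ℝ) with hm
  have hmpos : 0 < m := by rw [hm]; exact_mod_cast Fintype.card_pos
  have hx : 0 < 1 - ε := by linarith
  set g : α → ℝ := fun y => if A y then 1 - ε else 1 with hgdef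
  have hg : ∀ y, 0 ≤ g y := by
    intro y; simp only [hgdef]; split_ifs <;> linarith
  have hsum : ∑ y, g y ≤ m * Real.exp (-ε * q) := by
    have e1 : ∑ y, g y = m - ε * ((Finset.univ.filter A).card : ℝ) := by
      have : ∀ y, g y = 1 - ε * (if A y then 1 else 0) := by
        intro y; simp only [hgdef]; split_ifs <;> ring
      simp only [this, Finset.sum_sub_distrib, ← Finset.mul_sum, Finset.sum_boole]
      simp [hm]
    have e2 := Real.add_one_le_exp (-ε * q)
    have e3 := mul_le_mul_of_nonneg_left e2 hmpos.le
    have e4 := mul_le_mul_of_nonneg_left hd h0.le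
    rw [e1]; nlinarith
  have hprod := perm_prod g hg T
  have hP : ∀ σ : Equiv.Perm α, ∏ t ∈ T, g (σ t) =
      (1 - ε) ^ (T.filter (fun t => A (σ t))).card := by
    intro σ
    simp only [hgdef]
    rw [Finset.prod_ite]; simp
  have hs0 : 0 ≤ ∑ y, g y := Finset.sum_nonneg fun y _ => hg y
  have hmain : ∑ σ : Equiv.Perm α, ∏ t ∈ T, g (σ t) ≤
      Real.exp (-ε * μ) * (Fintype.card α).factorial := by
    have e5 : (∑ y, g y) ^ T.card ≤ m ^ T.card * Real.exp (-ε * μ) := by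
      calc _ ≤ (m * Real.exp (-ε * q)) ^ T.card := by gcongr
        _ = _ := by
          rw [mul_pow, ← Real.exp_nat_mul, hμ]; congr 2; ring
    have hmp : 0 < m ^ T.card := by positivity
    refine le_of_mul_le_mul_left ?_ hmp
    refine hprod.trans ?_
    rw [← mul_assoc]
    gcongr
  set B := (Finset.univ : Finset (Equiv.Perm α)).filter
      (fun σ => ((T.filter (fun t => A (σ t))).card : ℝ) < (1 - ε) * μ) with hB
  have hlog : Real.log (1 - ε) < 0 := Real.log_neg hx (by linarith)
  have hlow : (B.card : ℝ) * Real.exp ((1 - ε) * μ * Real.log (1 - ε)) ≤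
      ∑ σ : Equiv.Perm α, ∏ t ∈ T, g (σ t) := by
    rw [← nsmul_eq_mul]
    refine (Finset.card_nsmul_le_sum B (fun σ => ∏ t ∈ T, g (σ t)) _ ?_).trans ?_
    · intro σ hσ
      simp only [hB, Finset.mem_filter, Finset.mem_univ, true_and] at hσ
      rw [hP, ← Real.rpow_natCast, Real.rpow_def_of_pos hx]
      apply Real.exp_le_exp.2
      nlinarith
    · exact Finset.sum_le_sum_of_subset_of_nonneg (Finset.subset_univ _)
        fun σ _ _ => Finset.prod_nonneg fun t _ => hg _
  have hfin := hlow.trans hmain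
  have hE := Real.exp_pos ((1 - ε) * μ * Real.log (1 - ε))
  refine le_of_mul_le_mul_right (hfin.trans (le_of_eq ?_)) hE
  rw [mul_right_comm, ← Real.exp_add]
  congr 2; ring

theorem ev_small (b : ℝ) (hb : 0 < b) :
    ∀ᶠ n : ℕ in atTop, (2 * (n : ℝ) * n) *
      Real.exp (-(b * (Real.log n) ^ (1.1 : ℝ))) < 1 := by
  have hL : Tendsto (fun n : ℕ => Real.log n) atTop atTop :=
    Real.tendsto_log_atTop.comp tendsto_natCast_atTop_atTop
  have hL2 : Tendsto (fun n : ℕ => (Real.log n) ^ (0.1 : ℝ)) atTop atTop :=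
    (tendsto_rpow_atTop (by norm_num)).comp hL
  filter_upwards [hL.eventually_gt_atTop 1, hL2.eventually_ge_atTop (3 / b),
    eventually_gt_atTop 0] with n h1 h2 h3
  have hn : (0 : ℝ) < n := by exact_mod_cast h3
  have e1 : (Real.log n) ^ (1.1 : ℝ) = Real.log n * (Real.log n) ^ (0.1 : ℝ) := by
    rw [show (1.1 : ℝ) = 1 + 0.1 by norm_num, Real.rpow_add (by linarith), Real.rpow_one]
  have e2 : 3 * Real.log n ≤ b * (Real.log n) ^ (1.1 : ℝ) := by
    rw [e1]
    rw [div_le_iff₀ hb] at h2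
    nlinarith
  have e3 : (2 * (n : ℝ) * n) = Real.exp (Real.log 2 + Real.log n + Real.log n) := by
    rw [Real.exp_add, Real.exp_add, Real.exp_log hn, Real.exp_log (by norm_num)]
  rw [e3, ← Real.exp_add, Real.exp_lt_one_iff]
  have := Real.log_two_lt_d9
  linarith

/-- Lemma 2.3 of the paper: a digraph can be partitioned into prescribed-size
subsets of `U`, proportionally inheriting in/out-degree lower bounds into `U`. -/
theorem stmt_3 (c ε : ℝ) (hc : 0 < c) (hε : 0 < ε) :
    ∀ᶠ n : ℕ in atTop, ∀ p : ℝ, 0 < p → p < 1 →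
      ∀ D : Fin n → Fin n → Bool, ∀ U : Finset (Fin n), ∀ k : ℕ, ∀ s : Fin k → ℕ,
        (∀ i, 0 < s i) →
        (∀ i, (Real.log n) ^ (1.1 : ℝ) / p ≤ (s i : ℝ)) →
        (∑ i, s i) ≤ U.card →
        ∃ S : Fin k → Finset (Fin n),
          (∀ i, S i ⊆ U) ∧
          (∀ i j, i ≠ j → Disjoint (S i) (S j)) ∧
          (∀ i, (S i).card = s i) ∧
          (∀ v : Fin n, c * p * U.card ≤ (outDeg D v U : ℝ) →
            c * p * U.card ≤ (inDeg D v U : ℝ) →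
            ∀ i, (1 - ε) * c * p * (s i : ℝ) ≤ (outDeg D v (S i) : ℝ) ∧
              (1 - ε) * c * p * (s i : ℝ) ≤ (inDeg D v (S i) : ℝ)) := by
  classical
  by_cases hε1 : 1 ≤ ε
  · -- trivial degree bound: reuse any family of disjoint sets
    refine Eventually.of_forall fun n p hp hp1 D U k s hs hs' hsum => ?_
    obtain ⟨e⟩ : Nonempty ((Σ i, Fin (s i)) ↪ U) := by
      apply Function.Embedding.nonempty_of_card_le
      simpa using hsum
    refine ⟨fun i => (Finset.univ : Finset (Fin (s i))).map
      ((Function.Embedding.sigmaMk i).trans (e.trans (Function.Embedding.subtype _))),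
      ?_, ?_, ?_, ?_⟩
    · intro i w hw
      simp only [Finset.mem_map] at hw
      obtain ⟨t, -, rfl⟩ := hw
      exact (e _).2
    · intro i j hij
      rw [Finset.disjoint_left]
      intro w hw hw'
      simp only [Finset.mem_map] at hw hw'
      obtain ⟨t, -, rfl⟩ := hw
      obtain ⟨t', -, h⟩ := hw'
      have := e.injective (Subtype.ext h)
      exact hij (congrArg Sigma.fst this).symm
    · intro i; simp
    · intro v _ _ i
      have : (1 - ε) * c * p * (s i : ℝ) ≤ 0 := by
        have : 0 ≤ (ε - 1) * (c * p * (s i : ℝ)) :=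
          mul_nonneg (by linarith) (by positivity)
        nlinarith
      exact ⟨this.trans (Nat.cast_nonneg _), this.trans (Nat.cast_nonneg _)⟩
  push Not at hε1
  have hx : 0 < 1 - ε := by linarith
  obtain ⟨δ, hδ⟩ : ∃ δ, δ = ε + (1 - ε) * Real.log (1 - ε) := ⟨_, rfl⟩
  have hδ0 : 0 < δ := by
    have h := Real.log_lt_sub_one_of_pos (inv_pos.2 hx) (by
      intro h
      rw [inv_eq_one] at h
      linarith)
    rw [Real.log_inv] at h
    have h' := mul_lt_mul_of_pos_left h hx
    rw [mul_sub, mul_inv_cancel₀ hx.ne'] at h'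
    rw [hδ]; linarith
  filter_upwards [ev_small (δ * c) (by positivity)] with n hn p hp hp1 D U k s hs hs' hsum
  obtain ⟨e⟩ : Nonempty ((Σ i, Fin (s i)) ↪ U) := by
    apply Function.Embedding.nonempty_of_card_le
    simpa using hsum
  obtain ⟨T, hT⟩ : ∃ T : Fin k → Finset U, T = fun i => (Finset.univ : Finset (Fin (s i))).map
      ((Function.Embedding.sigmaMk i).trans e) := ⟨_, rfl⟩
  have hTcard : ∀ i, (T i).card = s i := by intro i; simp [hT]
  have hTdisj : ∀ i j, i ≠ j → Disjoint (T i) (T j) := by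
    intro i j hij
    rw [Finset.disjoint_left]
    intro w hw hw'
    simp only [hT, Finset.mem_map] at hw hw'
    obtain ⟨t, -, rfl⟩ := hw
    obtain ⟨t', -, h⟩ := hw'
    exact hij (congrArg Sigma.fst (e.injective h)).symm
  have hk : k ≤ n := by
    calc k = ∑ i : Fin k, 1 := by simp
      _ ≤ ∑ i, s i := Finset.sum_le_sum fun i _ => hs i
      _ ≤ U.card := hsum
      _ ≤ n := by simpa using U.card_le_univ
  obtain ⟨A, hA⟩ : ∃ A : Bool → Fin n → Fin n → Bool,
      A = fun b v w => if b then D v w else D w v := ⟨_, rfl⟩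
  obtain ⟨bad, hbad⟩ : ∃ bad : Bool × Fin n × Fin k → Finset (Equiv.Perm U),
      bad = fun x => if c * p * U.card ≤
          ((Finset.univ.filter fun w : U => A x.1 x.2.1 w = true).card : ℝ) then
        Finset.univ.filter fun σ => (((T x.2.2).filter
          fun t => A x.1 x.2.1 (σ t) = true).card : ℝ) < (1 - ε) * (c * p * (s x.2.2 : ℝ))
        else ∅ := ⟨_, rfl⟩
  obtain ⟨η, hη⟩ : ∃ η, η = Real.exp (-(δ * c * (Real.log n) ^ (1.1 : ℝ))) := ⟨_, rfl⟩
  have hη0 : 0 < η := by rw [hη]; exact Real.exp_pos _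
  have hbadcard : ∀ x, ((bad x).card : ℝ) ≤ η * (Fintype.card U).factorial := by
    intro x
    simp only [hbad]
    split_ifs with hdeg
    · have : Nonempty U := ⟨e ⟨x.2.2, ⟨0, hs _⟩⟩⟩
      have h := perm_tail (fun w : U => A x.1 x.2.1 w = true) (T x.2.2) ε (c * p)
        (c * p * (s x.2.2 : ℝ)) hε hε1 (by rw [hTcard]) (by simpa using hdeg)
      refine h.trans ?_
      gcongr
      rw [hη, ← hδ]
      apply Real.exp_le_exp.2
      have h1 := hs' x.2.2
      rw [div_le_iff₀ hp] at h1
      have h2 := mul_le_mul_of_nonneg_left h1 (mul_pos hδ0 hc).le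
      linarith
    · simp only [Finset.card_empty, Nat.cast_zero]; positivity
  obtain ⟨σ, hσ⟩ : ∃ σ : Equiv.Perm U, ∀ x, σ ∉ bad x := by
    by_contra hcon
    push Not at hcon
    have hcov : (Finset.univ : Finset (Equiv.Perm U)) ⊆ Finset.univ.biUnion bad := by
      intro σ _
      obtain ⟨x, hx⟩ := hcon σ
      exact Finset.mem_biUnion.2 ⟨x, Finset.mem_univ _, hx⟩
    have h1 := (Finset.card_le_card hcov).trans Finset.card_biUnion_le
    rw [Finset.card_univ, Fintype.card_perm] at h1
    have h2 : ((Fintype.card U).factorial : ℝ) ≤ ∑ x, ((bad x).card : ℝ) := by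
      exact_mod_cast h1
    have h3 : ∑ x, ((bad x).card : ℝ) ≤
        (2 * (n : ℝ) * k) * (η * (Fintype.card U).factorial) := by
      refine (Finset.sum_le_sum fun x _ => hbadcard x).trans (le_of_eq ?_)
      simp [mul_assoc]
    have hf : (0 : ℝ) < (Fintype.card U).factorial := by exact_mod_cast Nat.factorial_pos _
    have h4 : (2 * (n : ℝ) * k) * (η * (Fintype.card U).factorial) ≤
        (2 * (n : ℝ) * n) * (η * (Fintype.card U).factorial) := by
      have : (k : ℝ) ≤ n := by exact_mod_cast hk
      gcongr
    rw [← hη] at hn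
    have h5 := mul_lt_mul_of_pos_right hn hf
    linarith
  have key : ∀ b v i, c * p * U.card ≤ ((U.filter fun w => A b v w = true).card : ℝ) →
      (1 - ε) * c * p * (s i : ℝ) ≤ (((((T i).map σ.toEmbedding).map
        (Function.Embedding.subtype _)).filter fun w => A b v w = true).card : ℝ) := by
    intro b v i hdeg
    have hno := hσ (b, v, i)
    have e1 : (Finset.univ.filter fun w : U => A b v w = true).card =
        (U.filter fun w => A b v w = true).card := by
      rw [← Finset.card_map (Function.Embedding.subtype _)]
      congr 1
      ext w
      simp
      tauto
    rw [← e1] at hdeg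
    simp only [hbad, if_pos hdeg, Finset.mem_filter, Finset.mem_univ, true_and, not_lt] at hno
    rw [Finset.filter_map, Finset.card_map, Finset.filter_map, Finset.card_map]
    refine le_trans (le_of_eq (by ring)) hno
  refine ⟨fun i => ((T i).map σ.toEmbedding).map (Function.Embedding.subtype _), ?_, ?_, ?_, ?_⟩
  · intro i w hw
    simp only [Finset.mem_map] at hw
    obtain ⟨t, -, rfl⟩ := hw
    exact t.2
  · intro i j hij
    rw [Finset.disjoint_map, Finset.disjoint_map]
    exact hTdisj i j hij
  · intro i
    rw [Finset.card_map, Finset.card_map, hTcard]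
  · intro v ho hi i
    have k1 := key true v i
    have k2 := key false v i
    simp only [hA] at k1 k2
    exact ⟨k1 ho, k2 hi⟩
end

section
/- Let D be an (n,α,p)-pseudorandom digraph with p = ω((log n)^8 / n). Then for n sufficiently large, D contains a directed Hamilton cycle. -/
open Filter

/-- A directed Hamilton cycle: a cyclic ordering of all vertices with
consecutive arcs. -/
def IsHamiltonian {n : ℕ} (D : Fin n → Fin n → Bool) : Prop :=
  ∃ e : Equiv.Perm (Fin n), ∀ i : Fin n, D (e i) (e (finRotate n i)) = true



namespace HamPf

/-- degree of `v` into `S` along the relation `R` -/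
def dg {V : Type} (R : V → V → Bool) (v : V) (S : Finset V) : ℕ :=
  (S.filter fun w => R v w = true).card

/-- the relation `D` or its reverse -/
def dr {V : Type} (D : V → V → Bool) (b : Bool) : V → V → Bool :=
  fun v w => if b then D v w else D w v

/-- the expansion property extracted from pseudorandomness -/
def ExpP {V : Type} (R : V → V → Bool) (g q : ℝ) : Prop :=
  ∀ B Y : Finset V, Disjoint B Y → ∀ d : ℝ, g ≤ d → (∀ v ∈ B, d ≤ (dg R v Y : ℝ)) →
    (B.card : ℝ) * d ≤ g * Y.card ∨ d ≤ q * Y.card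

variable {V : Type} [DecidableEq V]

/-- neighbourhood of `A` inside `W` -/
def nb (R : V → V → Bool) (A W : Finset V) : Finset V :=
  W.filter fun w => ∃ v ∈ A, R v w = true

lemma dg_mono (R : V → V → Bool) (v : V) {S T : Finset V} (h : S ⊆ T) : dg R v S ≤ dg R v T :=
  Finset.card_le_card (Finset.filter_subset_filter _ h)

lemma dg_sdiff (R : V → V → Bool) (v : V) (S T : Finset V) :
    dg R v S ≤ dg R v (S \ T) + dg R v T := by
  unfold dg
  rw [← Finset.card_union_add_card_inter]
  refine le_trans (Finset.card_le_card ?_) (Nat.le_add_right _ _)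
  intro x hx
  simp only [Finset.mem_filter, Finset.mem_union, Finset.mem_sdiff] at *
  tauto

lemma expand_step {R : V → V → Bool} {g q d1 d2 : ℝ} {s M : ℕ} (hE : ExpP R g q) (hg : 0 < g)
    (hq : 0 < q) {W W' A : Finset V} (hW' : W' ⊆ W) (hAW : Disjoint A W)
    (hdeg : ∀ v ∈ A, d1 ≤ (dg R v W : ℝ)) (hs : W'.card ≤ s) (hsA : s ≤ 2 * A.card)
    (h4 : 4 * g ≤ d2) (h2 : 2 * d2 ≤ d1) (hqs : q * s < d2) (hqM : q * M / 2 < d1 - d2) :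
    2 * A.card ≤ (nb R A (W \ W')).card ∨ M < 2 * (nb R A (W \ W')).card := by
  set bad := A.filter fun v => d2 ≤ (dg R v W' : ℝ) with hbad
  set good := A.filter fun v => ¬ d2 ≤ (dg R v W' : ℝ) with hgood
  have hcard : bad.card + good.card = A.card := Finset.card_filter_add_card_filter_not _
  have hsR : (W'.card : ℝ) ≤ s := by exact_mod_cast hs
  have hb : (bad.card : ℝ) * d2 ≤ g * W'.card := by
    rcases hE bad W' (Finset.disjoint_of_subset_left (Finset.filter_subset _ _)
      (Finset.disjoint_of_subset_right hW' hAW)) d2 (by linarith)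
      (fun v hv => (Finset.mem_filter.1 hv).2) with h | h
    · exact h
    · nlinarith
  have hb2 : 4 * (bad.card : ℝ) ≤ s := by
    have : (bad.card : ℝ) * (4 * g) ≤ g * W'.card :=
      le_trans (mul_le_mul_of_nonneg_left h4 (Nat.cast_nonneg _)) hb
    have : g * (4 * (bad.card : ℝ)) ≤ g * W'.card := by linarith
    have := le_of_mul_le_mul_left this hg
    linarith
  have hb3 : 4 * bad.card ≤ s := by exact_mod_cast hb2
  have hdis : Disjoint good (nb R A (W \ W')) := by
    refine Finset.disjoint_of_subset_left (Finset.filter_subset _ _)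
      (Finset.disjoint_of_subset_right ?_ hAW)
    exact (Finset.filter_subset _ _).trans Finset.sdiff_subset
  have hgd : ∀ v ∈ good, d1 - d2 ≤ (dg R v (nb R A (W \ W')) : ℝ) := by
    intro v hv
    obtain ⟨hvA, hv2⟩ := Finset.mem_filter.1 hv
    have h1 := hdeg v hvA
    have h3 : (dg R v W : ℝ) ≤ dg R v (W \ W') + dg R v W' := by exact_mod_cast dg_sdiff R v W W'
    have h5 : dg R v (W \ W') ≤ dg R v (nb R A (W \ W')) := by
      refine Finset.card_le_card ?_
      intro x hx
      simp only [Finset.mem_filter, nb] at *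
      exact ⟨⟨hx.1, v, hvA, hx.2⟩, hx.2⟩
    have h6 : (dg R v (W \ W') : ℝ) ≤ dg R v (nb R A (W \ W')) := by exact_mod_cast h5
    linarith
  rcases hE good _ hdis (d1 - d2) (by linarith) hgd with h | h
  · left
    have h7 : (good.card : ℝ) * (4 * g) ≤ g * (nb R A (W \ W')).card :=
      le_trans (mul_le_mul_of_nonneg_left (by linarith) (Nat.cast_nonneg _)) h
    have h8 : g * (4 * (good.card : ℝ)) ≤ g * (nb R A (W \ W')).card := by linarith
    have h9 := le_of_mul_le_mul_left h8 hg
    have h10 : 4 * good.card ≤ (nb R A (W \ W')).card := by exact_mod_cast h9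
    omega
  · right
    have : q * M < q * (2 * (nb R A (W \ W')).card) := by linarith
    have := lt_of_mul_lt_mul_left this hq.le
    exact_mod_cast this

/-- reachable sets along layers -/
def rch (Rel : ℕ → V → V → Bool) (W W' : ℕ → Finset V) : ℕ → Finset V → Finset V
  | 0, A => A
  | j + 1, A => nb (Rel j) (rch Rel W W' j A) (W j \ W' j)

lemma nb_union (R : V → V → Bool) (A B W : Finset V) : nb R (A ∪ B) W = nb R A W ∪ nb R B W := by
  ext x
  simp only [nb, Finset.mem_filter, Finset.mem_union]
  constructor
  · rintro ⟨h, v, hv | hv, h2⟩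
    · exact Or.inl ⟨h, v, hv, h2⟩
    · exact Or.inr ⟨h, v, hv, h2⟩
  · rintro (⟨h, v, hv, h2⟩ | ⟨h, v, hv, h2⟩)
    · exact ⟨h, v, Or.inl hv, h2⟩
    · exact ⟨h, v, Or.inr hv, h2⟩

lemma rch_union (Rel : ℕ → V → V → Bool) (W W' : ℕ → Finset V) (j : ℕ) (A B : Finset V) :
    rch Rel W W' j (A ∪ B) = rch Rel W W' j A ∪ rch Rel W W' j B := by
  induction j with
  | zero => rfl
  | succ j ih => simp only [rch, ih, nb_union]

lemma rch_empty (Rel : ℕ → V → V → Bool) (W W' : ℕ → Finset V) (j : ℕ) :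
    rch Rel W W' j ∅ = ∅ := by
  induction j with
  | zero => rfl
  | succ j ih => simp [rch, ih, nb]

lemma rch_subset (Rel : ℕ → V → V → Bool) (W W' : ℕ → Finset V) (j : ℕ) (A : Finset V) :
    rch Rel W W' (j + 1) A ⊆ W j :=
  (Finset.filter_subset _ _).trans Finset.sdiff_subset

lemma rch_path (Rel : ℕ → V → V → Bool) (W W' : ℕ → Finset V) (j : ℕ) (a w : V)
    (h : w ∈ rch Rel W W' j {a}) : ∃ x : ℕ → V, x 0 = a ∧ x j = w ∧
      ∀ i < j, x (i + 1) ∈ W i \ W' i ∧ Rel i (x i) (x (i + 1)) = true := by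
  induction j generalizing w with
  | zero =>
    refine ⟨fun _ => a, rfl, ?_, by simp⟩
    simpa [rch, eq_comm] using h
  | succ j ih =>
    simp only [rch, nb, Finset.mem_filter] at h
    obtain ⟨hw, v, hv, hr⟩ := h
    obtain ⟨x, h0, hj, hx⟩ := ih v hv
    refine ⟨fun i => if i ≤ j then x i else w, by simp [h0], by simp, ?_⟩
    intro i hi
    rcases Nat.lt_or_eq_of_le (Nat.lt_succ_iff.1 hi) with h1 | h1
    · have h2 : i + 1 ≤ j := h1
      have h3 : i ≤ j := h1.le
      simp only [h2, h3, if_true]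
      exact hx i h1
    · subst h1
      simp only [le_refl, if_true, Nat.not_succ_le_self, if_false, hj]
      exact ⟨hw, hr⟩

/-- exists a start vertex reaching more than half of the layer `H` -/
lemma reach_half [Fintype V] {Rel : ℕ → V → V → Bool} {W W' : ℕ → Finset V} {g q d1 d2 : ℝ}
    {s M H h : ℕ}
    (hE : ∀ j, ExpP (Rel j) g q) (hg : 0 < g) (hq : 0 < q)
    (hdeg : ∀ j < H, ∀ v, d1 ≤ (dg (Rel j) v (W j) : ℝ))
    (hW' : ∀ j < H, W' j ⊆ W j) (hs : ∀ j < H, (W' j).card ≤ s)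
    {A : Finset V} (hA : A.Nonempty) (hsA : s ≤ 2 * A.card) (hsM : 2 * s ≤ M)
    (hAW : Disjoint A (W 0)) (hWW : ∀ j, j + 1 < H → Disjoint (W j) (W (j + 1)))
    (h4 : 4 * g ≤ d2) (h2 : 2 * d2 ≤ d1) (hqs : q * s < d2) (hqM : q * M / 2 < d1 - d2)
    (hh : Fintype.card V < 2 ^ h) (hH : 2 * h ≤ H) :
    ∃ a ∈ A, M < 2 * (rch Rel W W' H {a}).card := by
  have step : ∀ j < H, ∀ B ⊆ A, s ≤ 2 * (rch Rel W W' j B).card →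
      2 * (rch Rel W W' j B).card ≤ (rch Rel W W' (j + 1) B).card ∨
        M < 2 * (rch Rel W W' (j + 1) B).card := by
    intro j hj B hB hsB
    refine expand_step (hE j) hg hq (hW' j hj) ?_ (fun v _ => hdeg j hj v) (hs j hj) hsB h4 h2 hqs hqM
    cases j with
    | zero => exact Finset.disjoint_of_subset_left hB hAW
    | succ j => exact Finset.disjoint_of_subset_left (rch_subset _ _ _ _ _) (hWW j hj)
  have ph1 : ∀ j ≤ H, 2 ^ j * A.card ≤ (rch Rel W W' j A).card ∨
      M < 2 * (rch Rel W W' j A).card := by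
    intro j hj
    induction j with
    | zero => left; simp [rch]
    | succ j ih =>
      have h1 : s ≤ 2 * (rch Rel W W' j A).card := by
        rcases ih (by omega) with h | h
        · have : 1 * A.card ≤ 2 ^ j * A.card := Nat.mul_le_mul_right _ Nat.one_le_two_pow
          omega
        · omega
      rcases step j hj A subset_rfl h1 with h3 | h3
      · rcases ih (by omega) with h | h
        · left; rw [pow_succ]; nlinarith
        · right; omega
      · exact Or.inr h3
  have ph2 : ∀ i j, j + i ≤ H → ∀ B ⊆ A, B.card ≤ 2 ^ i → M < 2 * (rch Rel W W' j B).card →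
      ∃ a ∈ B, M < 2 * (rch Rel W W' (j + i) {a}).card := by
    intro i
    induction i with
    | zero =>
      intro j hj B hB hc hM
      have hne : B.Nonempty := by
        rw [Finset.nonempty_iff_ne_empty]
        rintro rfl
        simp [rch_empty] at hM
      have h1 : B.card = 1 := by
        have := hne.card_pos
        simp at hc; omega
      obtain ⟨a, rfl⟩ := Finset.card_eq_one.1 h1
      exact ⟨a, by simp, by simpa using hM⟩
    | succ i ih =>
      intro j hj B hB hc hM
      obtain ⟨B1, hB1, hc1⟩ := Finset.exists_subset_card_eq (s := B) (n := min B.card (2 ^ i))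
        (min_le_left _ _)
      have key : ∀ C ⊆ B, C.card ≤ 2 ^ i → M < 4 * (rch Rel W W' j C).card →
          ∃ a ∈ B, M < 2 * (rch Rel W W' (j + (i + 1)) {a}).card := by
        intro C hC hcC hMC
        have h3 : M < 2 * (rch Rel W W' (j + 1) C).card := by
          rcases step j (by omega) C (hC.trans hB) (by omega) with h | h
          · omega
          · exact h
        obtain ⟨a, ha, h⟩ := ih (j + 1) (by omega) C (hC.trans hB) hcC h3
        refine ⟨a, hC ha, ?_⟩
        rwa [show j + (i + 1) = j + 1 + i by ring]
      have hun : B1 ∪ (B \ B1) = B := Finset.union_sdiff_of_subset hB1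
      have h5 : (rch Rel W W' j B).card ≤
          (rch Rel W W' j B1).card + (rch Rel W W' j (B \ B1)).card := by
        conv_lhs => rw [← hun, rch_union]
        exact Finset.card_union_le _ _
      have h6 : (B \ B1).card = B.card - B1.card := Finset.card_sdiff_of_subset hB1
      by_cases hlt : M < 4 * (rch Rel W W' j B1).card
      · exact key B1 hB1 (by omega) hlt
      · refine key (B \ B1) Finset.sdiff_subset ?_ (by omega)
        rw [pow_succ] at hc
        omega
  have hAc : A.card < 2 ^ h := lt_of_le_of_lt (Finset.card_le_univ A) hh
  have h0 : M < 2 * (rch Rel W W' (H - h) A).card := by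
    rcases ph1 (H - h) (by omega) with h1 | h1
    · exfalso
      have h3 : (rch Rel W W' (H - h) A).card ≤ Fintype.card V := Finset.card_le_univ _
      have h5 : 2 ^ h ≤ 2 ^ (H - h) := Nat.pow_le_pow_right (by norm_num) (by omega)
      have h6 : 1 ≤ A.card := hA.card_pos
      nlinarith
    · exact h1
  obtain ⟨a, ha, h7⟩ := ph2 h (H - h) (by omega) A subset_rfl hAc.le h0
  exact ⟨a, ha, by rwa [Nat.sub_add_cancel (by omega)] at h7⟩

end HamPf

namespace HamPf
variable {V : Type} [DecidableEq V]

/-- `z` lists the inner vertices of a (mixed direction) path from `a` to `b` through the layers -/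
def Conn (D : V → V → Bool) (σ : ℕ → Bool) (N : ℕ) (W : ℕ → Finset V) (a b : V) (z : ℕ → V) :
    Prop :=
  (∀ j < N, z j ∈ W j) ∧ dr D (σ 0) a (z 0) = true ∧
    (∀ j, j + 1 < N → dr D (σ (j + 1)) (z j) (z (j + 1)) = true) ∧
    dr D (σ N) (z (N - 1)) b = true

/-- numerical conditions for connecting -/
structure Par [Fintype V] (D : V → V → Bool) (g q d1 d2 : ℝ) (M s h : ℕ) : Prop where
  hE : ∀ b, ExpP (dr D b) g q
  hg : 0 < g
  hq : 0 < q
  hsM : 2 * s ≤ M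
  h4 : 4 * g ≤ d2
  h2 : 2 * d2 ≤ d1
  hqs : q * s < d2
  hqM : q * M / 2 < d1 - d2
  hh : Fintype.card V < 2 ^ h

lemma dr_not (D : V → V → Bool) (b : Bool) (v w : V) : dr D (!b) v w = dr D b w v := by
  cases b <;> simp [dr]

/-- conditions on the layers -/
structure Lay (D : V → V → Bool) (d1 : ℝ) (N : ℕ) (W : ℕ → Finset V) : Prop where
  hdeg : ∀ b, ∀ j < N, ∀ v, d1 ≤ (dg (dr D b) v (W j) : ℝ)
  hdis : ∀ i < N, ∀ j < N, i ≠ j → Disjoint (W i) (W j)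

lemma single_conn [Fintype V] {D : V → V → Bool} {g q d1 d2 : ℝ} {M s h N : ℕ}
    (P : Par D g q d1 d2 M s h) {W W' : ℕ → Finset V} (L : Lay D d1 N W)
    (hcard : ∀ j < N, (W j).card = M) (σ : ℕ → Bool)
    (hN : 4 * h ≤ N) {ι : Type} [DecidableEq ι] (S : Finset ι) (hS : S.Nonempty) (hSs : S.card ≤ s)
    (a b : ι → V) (ha : Set.InjOn a S) (hb : Set.InjOn b S)
    (haW : ∀ i ∈ S, ∀ j < N, a i ∉ W j) (hbW : ∀ i ∈ S, ∀ j < N, b i ∉ W j)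
    (hW' : ∀ j < N, W' j ⊆ W j) (hW's : ∀ j < N, (W' j).card ≤ S.card) :
    ∃ i ∈ S, ∃ z, Conn D σ N (fun j => W j \ W' j) (a i) (b i) z := by
  have hh1 : 1 ≤ h := by
    by_contra hlt
    have h0 : h = 0 := by omega
    have h1 := P.hh
    obtain ⟨i, _⟩ := hS
    have : 0 < Fintype.card V := Fintype.card_pos_iff.2 ⟨a i⟩
    rw [h0] at h1
    omega
  have hqs : q * (S.card : ℝ) < d2 := by
    have h1 : (S.card : ℝ) ≤ s := by exact_mod_cast hSs
    have := P.hqs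
    have := P.hq
    nlinarith
  have hsM : 2 * S.card ≤ M := by have := P.hsM; omega
  set Ra := fun i : ι => rch (fun j => dr D (σ j)) W W' (2 * h) {a i} with hRa
  set Rb := fun i : ι => rch (fun j => dr D (!σ (N - j))) (fun j => W (N - 1 - j))
    (fun j => W' (N - 1 - j)) (N - 2 * h + 1) {b i} with hRb
  have hFa : 2 * (S.filter fun i => ¬ M < 2 * (Ra i).card).card < S.card := by
    by_contra hcon
    set F := S.filter fun i => ¬ M < 2 * (Ra i).card with hF
    have hFS : F ⊆ S := Finset.filter_subset _ _
    have hcF : (F.image a).card = F.card := Finset.card_image_of_injOn (ha.mono (by exact_mod_cast hFS))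
    have hSp := hS.card_pos
    obtain ⟨v, hv, hM⟩ := reach_half (Rel := fun j => dr D (σ j)) (W := W) (W' := W') (H := 2 * h)
      (s := S.card) (A := F.image a)
      (fun j => P.hE _) P.hg P.hq (fun j hj v => L.hdeg _ j (by omega) v)
      (fun j hj => hW' j (by omega)) (fun j hj => hW's j (by omega))
      (Finset.card_pos.1 (by omega)) (by omega) hsM
      (by
        rw [Finset.disjoint_left]
        intro x hx
        obtain ⟨i, hi, rfl⟩ := Finset.mem_image.1 hx
        exact haW i (hFS hi) 0 (by omega))
      (fun j hj => L.hdis _ (by omega) _ (by omega) (by omega)) P.h4 P.h2 hqs P.hqM P.hh le_rfl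
    obtain ⟨i, hi, rfl⟩ := Finset.mem_image.1 hv
    exact (Finset.mem_filter.1 hi).2 hM
  have hFb : 2 * (S.filter fun i => ¬ M < 2 * (Rb i).card).card < S.card := by
    by_contra hcon
    set F := S.filter fun i => ¬ M < 2 * (Rb i).card with hF
    have hFS : F ⊆ S := Finset.filter_subset _ _
    have hcF : (F.image b).card = F.card := Finset.card_image_of_injOn (hb.mono (by exact_mod_cast hFS))
    have hSp := hS.card_pos
    obtain ⟨v, hv, hM⟩ := reach_half (Rel := fun j => dr D (!σ (N - j)))
      (W := fun j => W (N - 1 - j)) (W' := fun j => W' (N - 1 - j)) (H := N - 2 * h + 1)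
      (s := S.card) (A := F.image b)
      (fun j => P.hE _) P.hg P.hq (fun j hj v => L.hdeg _ _ (by omega) v)
      (fun j hj => hW' _ (by omega)) (fun j hj => hW's _ (by omega))
      (Finset.card_pos.1 (by omega)) (by omega) hsM
      (by
        rw [Finset.disjoint_left]
        intro x hx
        obtain ⟨i, hi, rfl⟩ := Finset.mem_image.1 hx
        exact hbW i (hFS hi) _ (by omega))
      (fun j hj => L.hdis _ (by omega) _ (by omega) (by omega)) P.h4 P.h2 hqs P.hqM P.hh (by omega)
    obtain ⟨i, hi, rfl⟩ := Finset.mem_image.1 hv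
    exact (Finset.mem_filter.1 hi).2 hM
  obtain ⟨i, hi, hia, hib⟩ : ∃ i ∈ S, M < 2 * (Ra i).card ∧ M < 2 * (Rb i).card := by
    by_contra hcon
    push Not at hcon
    have hsub : S ⊆ (S.filter fun i => ¬ M < 2 * (Ra i).card) ∪
        (S.filter fun i => ¬ M < 2 * (Rb i).card) := by
      intro i hi
      simp only [Finset.mem_union, Finset.mem_filter]
      by_cases h1 : M < 2 * (Ra i).card
      · right; exact ⟨hi, by have := hcon i hi h1; omega⟩
      · left; exact ⟨hi, h1⟩
    have h1 := Finset.card_le_card hsub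
    have h2 := Finset.card_union_le (S.filter fun i => ¬ M < 2 * (Ra i).card)
      (S.filter fun i => ¬ M < 2 * (Rb i).card)
    omega
  refine ⟨i, hi, ?_⟩
  have hRaW : Ra i ⊆ W (2 * h - 1) := by
    have := rch_subset (fun j => dr D (σ j)) W W' (2 * h - 1) {a i}
    rwa [Nat.sub_add_cancel (by omega)] at this
  have hRbW : Rb i ⊆ W (2 * h - 1) := by
    have := rch_subset (fun j => dr D (!σ (N - j))) (fun j => W (N - 1 - j))
      (fun j => W' (N - 1 - j)) (N - 2 * h) {b i}
    rwa [show N - 1 - (N - 2 * h) = 2 * h - 1 by omega] at this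
  obtain ⟨w, hw⟩ : (Ra i ∩ Rb i).Nonempty := by
    rw [← Finset.card_pos]
    have h1 := Finset.card_union_add_card_inter (Ra i) (Rb i)
    have h2 := Finset.card_le_card (Finset.union_subset hRaW hRbW)
    rw [hcard _ (by omega)] at h2
    omega
  rw [Finset.mem_inter] at hw
  obtain ⟨x, hx0, hxH, hx⟩ := rch_path _ _ _ _ _ _ hw.1
  obtain ⟨y, hy0, hyH, hy⟩ := rch_path _ _ _ _ _ _ hw.2
  refine ⟨fun j => if j < 2 * h then x (j + 1) else y (N - j), ?_, ?_, ?_, ?_⟩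
  · intro j hj
    by_cases h1 : j < 2 * h
    · simp only [h1, if_true]
      exact (hx j h1).1
    · simp only [h1, if_false]
      have := (hy (N - 1 - j) (by omega)).1
      rw [show N - 1 - j + 1 = N - j by omega, show N - 1 - (N - 1 - j) = j by omega] at this
      exact this
  · have := (hx 0 (by omega)).2
    simpa [show 0 < h by omega, hx0] using this
  · intro j hj
    by_cases h1 : j + 1 < 2 * h
    · have h2 : j < 2 * h := by omega
      simp only [h1, h2, if_true]
      exact (hx (j + 1) h1).2
    · have h3 := (hy (N - (j + 1)) (by omega)).2
      rw [dr_not, show N - (N - (j + 1)) = j + 1 by omega, show N - (j + 1) + 1 = N - j by omega] at h3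
      by_cases h2 : j < 2 * h
      · simp only [h1, h2, if_true, if_false]
        have h4 : j + 1 = 2 * h := by omega
        rw [show N - j = N - 2 * h + 1 by omega, hyH, ← hxH, ← h4] at h3
        rw [← h4] at hxH
        exact h3
      · simp only [h1, h2, if_false]
        exact h3
  · have h1 : ¬ (N - 1 < 2 * h) := by omega
    simp only [h1, if_false]
    have h3 := (hy 0 (by omega)).2
    rw [dr_not, hy0] at h3
    rw [show N - (N - 1) = 0 + 1 by omega]
    exact h3

lemma round_conn [Fintype V] {D : V → V → Bool} {g q d1 d2 : ℝ} {M s h N : ℕ}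
    (P : Par D g q d1 d2 M s h) {W : ℕ → Finset V} (L : Lay D d1 N W)
    (hcard : ∀ j < N, (W j).card = M) (σ : ℕ → Bool)
    (hN : 4 * h ≤ N) {ι : Type} [DecidableEq ι] (S : Finset ι) (hSs : S.card ≤ s)
    (a b : ι → V) (ha : Set.InjOn a S) (hb : Set.InjOn b S)
    (haW : ∀ i ∈ S, ∀ j < N, a i ∉ W j) (hbW : ∀ i ∈ S, ∀ j < N, b i ∉ W j) :
    ∃ T ⊆ S, ∃ z : ι → ℕ → V, (∀ i ∈ T, Conn D σ N W (a i) (b i) (z i)) ∧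
      (∀ i ∈ T, ∀ i' ∈ T, i ≠ i' → ∀ j < N, z i j ≠ z i' j) ∧
      (S \ T = ∅ ∨ 2 * (S \ T).card < S.card) := by
  classical
  let Q : Finset ι → Prop := fun T => ∃ z : ι → ℕ → V, (∀ i ∈ T, Conn D σ N W (a i) (b i) (z i)) ∧
      (∀ i ∈ T, ∀ i' ∈ T, i ≠ i' → ∀ j < N, z i j ≠ z i' j)
  have hne : (S.powerset.filter Q).Nonempty := by
    rcases S.eq_empty_or_nonempty with rfl | ⟨i, hi⟩
    · refine ⟨∅, ?_⟩
      simp only [Finset.mem_filter, Finset.mem_powerset, subset_rfl, true_and]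
      rcases isEmpty_or_nonempty V with hV | ⟨⟨v⟩⟩
      · refine ⟨fun i => (hV.false (a i)).elim, by simp, by simp⟩
      · exact ⟨fun _ _ => v, by simp, by simp⟩
    · refine ⟨∅, ?_⟩
      simp only [Finset.mem_filter, Finset.mem_powerset, Finset.empty_subset, true_and]
      exact ⟨fun _ _ => a i, by simp, by simp⟩
  obtain ⟨T, hT, hmax⟩ := Finset.exists_max_image _ Finset.card hne
  simp only [Finset.mem_filter, Finset.mem_powerset] at hT hmax
  obtain ⟨hTS, z, hz1, hz2⟩ := hT
  refine ⟨T, hTS, z, hz1, hz2, ?_⟩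
  by_contra hcon
  push Not at hcon
  obtain ⟨hne', hle⟩ := hcon
  have hcs := Finset.card_sdiff_add_card_eq_card hTS
  have hsub : S \ T ⊆ S := Finset.sdiff_subset
  obtain ⟨i, hi, z', hz'⟩ := single_conn P (W' := fun j => if j < N then T.image (fun i => z i j) else ∅)
    L hcard σ hN (S \ T) hne' (by omega) a b
    (ha.mono (by exact_mod_cast hsub)) (hb.mono (by exact_mod_cast hsub))
    (fun i hi => haW i (hsub hi)) (fun i hi => hbW i (hsub hi))
    (by
      intro j hj x hx
      simp only [hj, if_true] at hx
      obtain ⟨i, hi, rfl⟩ := Finset.mem_image.1 hx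
      exact (hz1 i hi).1 j hj)
    (by
      intro j hj
      simp only [hj, if_true]
      have : (T.image (fun i => z i j)).card ≤ T.card := Finset.card_image_le
      omega)
  have hiT : i ∉ T := (Finset.mem_sdiff.1 hi).2
  have hz'2 : ∀ j < N, ∀ k ∈ T, z' j ≠ z k j := by
    intro j hj k hk heq
    have := hz'.1 j hj
    simp only [hj, if_true, Finset.mem_sdiff] at this
    exact this.2 (Finset.mem_image.2 ⟨k, hk, heq.symm⟩)
  have hnew : Q (insert i T) := by
    refine ⟨Function.update z i z', ?_, ?_⟩
    · intro k hk
      rcases Finset.mem_insert.1 hk with rfl | hk1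
      · rw [Function.update_self]
        exact ⟨fun j hj => (Finset.mem_sdiff.1 (hz'.1 j hj)).1, hz'.2⟩
      · rw [Function.update_of_ne (by rintro rfl; exact hiT hk1)]
        exact hz1 k hk1
    · intro k hk k' hk' hkk j hj
      rcases Finset.mem_insert.1 hk with rfl | hk1
      · rcases Finset.mem_insert.1 hk' with rfl | hk1'
        · exact absurd rfl hkk
        · rw [Function.update_self, Function.update_of_ne hkk.symm]
          exact hz'2 j hj _ hk1'
      · rcases Finset.mem_insert.1 hk' with rfl | hk1'
        · rw [Function.update_self, Function.update_of_ne hkk]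
          exact (hz'2 j hj _ hk1).symm
        · rw [Function.update_of_ne (by rintro rfl; exact hiT hk1),
            Function.update_of_ne (by rintro rfl; exact hiT hk1')]
          exact hz2 k hk1 k' hk1' hkk j hj
  have := hmax (insert i T) ⟨Finset.insert_subset (hsub hi) hTS, hnew⟩
  rw [Finset.card_insert_of_notMem hiT] at this
  omega

lemma rounds_conn [Fintype V] {D : V → V → Bool} {g q d1 d2 : ℝ} {M s h N : ℕ}
    (P : Par D g q d1 d2 M s h) (σ : ℕ → Bool) (hN : 4 * h ≤ N) {ι : Type} [DecidableEq ι]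
    (a b : ι → V) (ha : Function.Injective a) (hb : Function.Injective b) (r : ℕ) :
    ∀ (W : ℕ → ℕ → Finset V) (_ : ∀ k < r, Lay D d1 N (W k))
    (_ : ∀ k < r, ∀ j < N, (W k j).card = M)
    (_ : ∀ i, ∀ k < r, ∀ j < N, a i ∉ W k j) (_ : ∀ i, ∀ k < r, ∀ j < N, b i ∉ W k j)
    (S : Finset ι) (_ : S.card ≤ s) (_ : S.card < 2 ^ r),
    ∃ ρ : ι → ℕ, ∃ z : ι → ℕ → V, (∀ i ∈ S, ρ i < r ∧ Conn D σ N (W (ρ i)) (a i) (b i) (z i)) ∧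
      (∀ i ∈ S, ∀ i' ∈ S, i ≠ i' → ρ i = ρ i' → ∀ j < N, z i j ≠ z i' j) := by
  induction r with
  | zero =>
    intro W _ _ _ _ S _ hS
    have : S = ∅ := by simpa using hS
    subst this
    exact ⟨fun _ => 0, fun i _ => a i, by simp, by simp⟩
  | succ r ih =>
    intro W hL hc haW hbW S hSs hS
    obtain ⟨T, hTS, z, hz1, hz2, hz3⟩ := round_conn P (hL r (by omega)) (hc r (by omega)) σ hN S hSs
      a b ha.injOn hb.injOn (fun i _ => haW i r (by omega)) (fun i _ => hbW i r (by omega))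
    have hlt : (S \ T).card < 2 ^ r := by
      rcases hz3 with h | h
      · rw [h]; simp
      · rw [pow_succ] at hS; omega
    have hle : (S \ T).card ≤ s := le_trans (Finset.card_le_card Finset.sdiff_subset) hSs
    obtain ⟨ρ, z', h1, h2⟩ := ih W (fun k hk => hL k (by omega)) (fun k hk => hc k (by omega))
      (fun i k hk => haW i k (by omega)) (fun i k hk => hbW i k (by omega)) (S \ T) hle hlt
    refine ⟨fun i => if i ∈ T then r else ρ i, fun i => if i ∈ T then z i else z' i, ?_, ?_⟩
    · intro i hi
      by_cases hiT : i ∈ T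
      · simp only [hiT, if_true]
        exact ⟨by omega, hz1 i hiT⟩
      · simp only [hiT, if_false]
        have := h1 i (Finset.mem_sdiff.2 ⟨hi, hiT⟩)
        exact ⟨by omega, this.2⟩
    · intro i hi i' hi' hne
      by_cases hiT : i ∈ T <;> by_cases hiT' : i' ∈ T
      · simp only [hiT, hiT', if_true]
        exact fun _ => hz2 i hiT i' hiT' hne
      · simp only [hiT, hiT', if_true, if_false]
        intro h
        have := (h1 i' (Finset.mem_sdiff.2 ⟨hi', hiT'⟩)).1
        omega
      · simp only [hiT, hiT', if_true, if_false]
        intro h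
        have := (h1 i (Finset.mem_sdiff.2 ⟨hi, hiT⟩)).1
        omega
      · simp only [hiT, hiT', if_false]
        exact h2 i (Finset.mem_sdiff.2 ⟨hi, hiT⟩) i' (Finset.mem_sdiff.2 ⟨hi', hiT'⟩) hne

/-- The connecting lemma. The layers are indexed by `Fin h × Fin N`. -/
lemma connect [Fintype V] {D : V → V → Bool} {g q d1 d2 : ℝ} {M h N : ℕ}
    {ι : Type} [Fintype ι]
    (P : Par D g q d1 d2 M (Fintype.card ι) h) (σ : ℕ → Bool) (hN : 4 * h ≤ N)
    (W : Fin h × Fin N → Finset V)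
    (hdeg : ∀ c k v, d1 ≤ (dg (dr D c) v (W k) : ℝ))
    (hcard : ∀ k, (W k).card = M)
    (hdis : ∀ k k', k ≠ k' → Disjoint (W k) (W k'))
    (a b : ι → V) (ha : Function.Injective a) (hb : Function.Injective b)
    (haW : ∀ i k, a i ∉ W k) (hbW : ∀ i k, b i ∉ W k) :
    ∃ z : ι → ℕ → V,
      (∀ i, (∀ j < N, ∃ k, z i j ∈ W k) ∧ dr D (σ 0) (a i) (z i 0) = true ∧
        (∀ j, j + 1 < N → dr D (σ (j + 1)) (z i j) (z i (j + 1)) = true) ∧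
        dr D (σ N) (z i (N - 1)) (b i) = true) ∧
      (∀ i i' j j', j < N → j' < N → z i j = z i' j' → i = i' ∧ j = j') := by
  classical
  let W2 : ℕ → ℕ → Finset V := fun k j => if hk : k < h ∧ j < N then W (⟨k, hk.1⟩, ⟨j, hk.2⟩) else ∅
  have hW2 : ∀ k (hk : k < h) j (hj : j < N), W2 k j = W (⟨k, hk⟩, ⟨j, hj⟩) := by
    intro k hk j hj
    simp [W2, hk, hj]
  have hιV : Fintype.card ι < 2 ^ h :=
    lt_of_le_of_lt (Fintype.card_le_of_injective a ha) P.hh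
  obtain ⟨ρ, z, h1, h2⟩ := rounds_conn P σ hN a b ha hb h W2
    (fun k hk => ⟨fun c j hj v => by rw [hW2 k hk j hj]; exact hdeg _ _ _,
      fun i hi j hj hij => by
        rw [hW2 k hk j hj, hW2 k hk i hi]
        apply hdis
        simp [hij]⟩)
    (fun k hk j hj => by rw [hW2 k hk j hj]; exact hcard _)
    (fun i k hk j hj => by rw [hW2 k hk j hj]; exact haW _ _)
    (fun i k hk j hj => by rw [hW2 k hk j hj]; exact hbW _ _)
    Finset.univ (by simp) (by simpa using hιV)
  refine ⟨z, ?_, ?_⟩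
  · intro i
    obtain ⟨hr, hc⟩ := h1 i (Finset.mem_univ _)
    refine ⟨fun j hj => ?_, hc.2⟩
    have := hc.1 j hj
    rw [hW2 _ hr j hj] at this
    exact ⟨_, this⟩
  · intro i i' j j' hj hj' heq
    obtain ⟨hr, hc⟩ := h1 i (Finset.mem_univ _)
    obtain ⟨hr', hc'⟩ := h1 i' (Finset.mem_univ _)
    have m1 := hc.1 j hj
    have m2 := hc'.1 j' hj'
    rw [hW2 _ hr j hj] at m1
    rw [hW2 _ hr' j' hj', ← heq] at m2
    have hk : ((⟨ρ i, hr⟩, ⟨j, hj⟩) : Fin h × Fin N) = (⟨ρ i', hr'⟩, ⟨j', hj'⟩) := by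
      by_contra hne
      exact Finset.disjoint_left.1 (hdis _ _ hne) m1 m2
    simp only [Prod.mk.injEq, Fin.mk.injEq] at hk
    refine ⟨?_, hk.2⟩
    by_contra hne
    have h3 := h2 i (Finset.mem_univ _) i' (Finset.mem_univ _) hne hk.1 j hj
    rw [← hk.2] at heq
    exact h3 heq

end HamPf

namespace HamPf
variable {V : Type} [DecidableEq V]

/-- there is a directed path from `s` to `e` with vertex set exactly `Z` -/
def Pth (D : V → V → Bool) (s e : V) (Z : Finset V) : Prop :=
  ∃ (k : ℕ) (f : ℕ → V), f 0 = s ∧ f k = e ∧ (∀ i ≤ k, ∀ j ≤ k, f i = f j → i = j) ∧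
    (∀ i < k, D (f i) (f (i + 1)) = true) ∧ (Finset.range (k + 1)).image f = Z

lemma Pth.single (D : V → V → Bool) (s : V) : Pth D s s {s} :=
  ⟨0, fun _ => s, rfl, rfl, by intro i hi j hj _; omega, by simp, by simp⟩

lemma Pth.append {D : V → V → Bool} {s e s' e' : V} {Z Z' : Finset V} (h : Pth D s e Z)
    (h' : Pth D s' e' Z') (ha : D e s' = true) (hd : Disjoint Z Z') : Pth D s e' (Z ∪ Z') := by
  obtain ⟨k, f, f0, fk, finj, farc, rfl⟩ := h
  obtain ⟨k', f', f0', fk', finj', farc', rfl⟩ := h'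
  have hne : ∀ i ≤ k, ∀ j ≤ k', f i ≠ f' j := by
    intro i hi j hj heq
    refine Finset.disjoint_left.1 hd (Finset.mem_image_of_mem f (Finset.mem_range.2 (Nat.lt_succ_of_le hi))) ?_
    rw [heq]
    exact Finset.mem_image_of_mem f' (Finset.mem_range.2 (Nat.lt_succ_of_le hj))
  refine ⟨k + k' + 1, fun i => if i ≤ k then f i else f' (i - k - 1), by simp [f0], ?_, ?_, ?_, ?_⟩
  · have h1 : ¬ (k + k' + 1 ≤ k) := by omega
    simp only [h1, if_false]
    rw [show k + k' + 1 - k - 1 = k' by omega, fk']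
  · intro i hi j hj heq
    by_cases h1 : i ≤ k <;> by_cases h2 : j ≤ k
    · simp only [h1, h2, if_true] at heq
      exact finj i h1 j h2 heq
    · simp only [h1, h2, if_true, if_false] at heq
      exact absurd heq (hne i h1 _ (by omega))
    · simp only [h1, h2, if_true, if_false] at heq
      exact absurd heq.symm (hne j h2 _ (by omega))
    · simp only [h1, h2, if_false] at heq
      have := finj' _ (by omega) _ (by omega) heq
      omega
  · intro i hi
    by_cases h1 : i + 1 ≤ k
    · have h2 : i ≤ k := by omega
      simp only [h1, h2, if_true]
      exact farc i h1
    · by_cases h2 : i ≤ k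
      · have : i = k := by omega
        subst this
        simp [fk, f0', ha]
      · simp only [h1, h2, if_false]
        rw [show i + 1 - k - 1 = i - k - 1 + 1 by omega]
        exact farc' _ (by omega)
  · ext v
    simp only [Finset.mem_image, Finset.mem_range, Finset.mem_union]
    constructor
    · rintro ⟨i, hi, rfl⟩
      by_cases h1 : i ≤ k
      · left; exact ⟨i, by omega, by simp [h1]⟩
      · right; exact ⟨i - k - 1, by omega, by simp [h1]⟩
    · rintro (⟨i, hi, rfl⟩ | ⟨i, hi, rfl⟩)
      · exact ⟨i, by omega, by simp [show i ≤ k by omega]⟩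
      · refine ⟨k + 1 + i, by omega, ?_⟩
        have h1 : ¬ (k + 1 + i ≤ k) := by omega
        simp only [h1, if_false]
        congr 1
        omega

lemma Pth.chain {D : V → V → Bool} (s e : ℕ → V) (Z : ℕ → Finset V) (k : ℕ)
    (h : ∀ i ≤ k, Pth D (s i) (e i) (Z i)) (ha : ∀ i < k, D (e i) (s (i + 1)) = true)
    (hd : ∀ i ≤ k, ∀ j ≤ k, i ≠ j → Disjoint (Z i) (Z j)) :
    Pth D (s 0) (e k) ((Finset.range (k + 1)).biUnion Z) := by
  induction k with
  | zero => simpa using h 0 le_rfl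
  | succ k ih =>
    rw [Finset.range_add_one, Finset.biUnion_insert, Finset.union_comm]
    refine Pth.append (ih (fun i hi => h i (by omega)) (fun i hi => ha i (by omega))
      (fun i hi j hj => hd i (by omega) j (by omega))) (h (k + 1) le_rfl) (ha k (by omega)) ?_
    rw [Finset.disjoint_biUnion_left]
    intro i hi
    rw [Finset.mem_range] at hi
    exact hd i (by omega) (k + 1) le_rfl (by omega)

lemma Pth.ofSeq {D : V → V → Bool} (z : ℕ → V) (N : ℕ) (hN : 1 ≤ N)
    (ha : ∀ j, j + 1 < N → D (z j) (z (j + 1)) = true)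
    (hi : ∀ i < N, ∀ j < N, z i = z j → i = j) :
    Pth D (z 0) (z (N - 1)) ((Finset.range N).image z) :=
  ⟨N - 1, z, rfl, rfl, fun i hi' j hj' => hi i (by omega) j (by omega),
    fun i hi' => ha i (by omega), by rw [Nat.sub_add_cancel hN]⟩

/-- cyclic enumeration of a finite nonempty type -/
lemma cyc_enum (ι : Type) [Fintype ι] [Nonempty ι] : ∃ (f : ℕ → ι) (nx : ι → ι),
    Function.Injective nx ∧ (∀ i, nx (f i) = f (i + 1)) ∧ f (Fintype.card ι) = f 0 ∧
    (∀ i < Fintype.card ι, ∀ j < Fintype.card ι, f i = f j → i = j) ∧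
    ∀ x, ∃ i < Fintype.card ι, f i = x := by
  have hpos : 0 < Fintype.card ι := Fintype.card_pos
  haveI : NeZero (Fintype.card ι) := ⟨hpos.ne'⟩
  let E := Fintype.equivFin ι
  refine ⟨fun i => E.symm (Fin.ofNat _ i), fun x => E.symm (E x + 1), ?_, ?_, ?_, ?_, ?_⟩
  · intro x y hxy
    simpa using hxy
  · intro i
    simp only [Equiv.apply_symm_apply]
    congr 1
    ext
    simp [Fin.val_add, Fin.ofNat]
  · simp [Fin.ofNat]
  · intro i hi j hj hij
    have := E.symm.injective hij
    simpa [Fin.ofNat, Nat.mod_eq_of_lt hi, Nat.mod_eq_of_lt hj] using this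
  · intro x
    refine ⟨E x, (E x).2, ?_⟩
    simp

/-- a single absorber -/
lemma absorber {D : V → V → Bool} {h : ℕ} (hh : 1 ≤ h) (z : ℕ → V) (x : V) (u : ℕ → V)
    (T : ℕ → Finset V) (hu0 : u 0 = z (4 * h + 1)) (hu : ∀ j, 1 ≤ j → u j = z (2 * j - 1))
    (hT : ∀ j < 2 * h, Pth D (u j) (z (2 * j + 2)) (T j))
    (hTd : ∀ i < 2 * h, ∀ j < 2 * h, i ≠ j → Disjoint (T i) (T j))
    (hz0 : ∀ j < 2 * h, z 0 ∉ T j) (hze : ∀ j < 2 * h, z (4 * h - 1) ∉ T j)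
    (hxT : ∀ j < 2 * h, x ∉ T j) (hz0e : z 0 ≠ z (4 * h - 1)) (hx0 : x ≠ z 0)
    (hxe : x ≠ z (4 * h - 1))
    (a1 : D (z 0) x = true) (a2 : D x (z (4 * h + 1)) = true)
    (a3 : ∀ i ≤ 2 * h, D (z (2 * i)) (z (2 * i + 1)) = true)
    (a4 : ∀ i < 2 * h, D (z (2 * i + 2)) (z (2 * i + 1)) = true) :
    Pth D (z 0) (z (4 * h - 1)) ({z 0} ∪ (Finset.range (2 * h)).biUnion T ∪ {z (4 * h - 1)}) ∧
    Pth D (z 0) (z (4 * h - 1))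
      (insert x ({z 0} ∪ (Finset.range (2 * h)).biUnion T ∪ {z (4 * h - 1)})) := by
  have e1 : Pth D (u 0) (z (4 * h)) ((Finset.range (2 * h)).biUnion T) := by
    have := Pth.chain (D := D) u (fun j => z (2 * j + 2)) T (2 * h - 1)
      (fun i hi => hT i (by omega)) (fun i hi => by rw [hu (i + 1) (by omega)]; exact a4 i (by omega))
      (fun i hi j hj => hTd i (by omega) j (by omega))
    rw [show 2 * h - 1 + 1 = 2 * h by omega] at this
    rwa [show 2 * (2 * h - 1) + 2 = 4 * h by omega] at this
  let π : ℕ → ℕ := fun i => if i < h then 2 * i + 1 else 2 * (i - h)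
  have hπ : ∀ i < 2 * h, π i < 2 * h := by
    intro i hi
    simp only [π]
    split_ifs <;> omega
  have e2 : Pth D (u 1) (z (4 * h - 2)) ((Finset.range (2 * h)).biUnion T) := by
    have := Pth.chain (D := D) (fun i => u (π i)) (fun j => z (2 * π j + 2)) (fun i => T (π i)) (2 * h - 1)
      (fun i hi => hT _ (hπ i (by omega)))
      (fun i hi => by
        by_cases h1 : i + 1 < h
        · have h2 : i < h := by omega
          simp only [π, h1, h2, if_true]
          rw [hu _ (by omega)]
          have := a3 (2 * i + 2) (by omega)
          rw [show 2 * (2 * i + 1) + 2 = 2 * (2 * i + 2) by ring,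
            show 2 * (2 * (i + 1) + 1) - 1 = 2 * (2 * i + 2) + 1 by omega]
          exact this
        · by_cases h2 : i < h
          · simp only [π, h1, h2, if_true, if_false]
            rw [show i + 1 - h = 0 by omega, Nat.mul_zero, hu0]
            have := a3 (2 * h) (by omega)
            rw [show 2 * (2 * i + 1) + 2 = 2 * (2 * h) by omega,
              show 4 * h + 1 = 2 * (2 * h) + 1 by ring]
            exact this
          · simp only [π, h1, h2, if_false]
            rw [hu _ (by omega)]
            have := a3 (2 * (i - h) + 1) (by omega)
            rw [show 2 * (2 * (i - h)) + 2 = 2 * (2 * (i - h) + 1) by ring,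
              show 2 * (2 * (i + 1 - h)) - 1 = 2 * (2 * (i - h) + 1) + 1 by omega]
            exact this)
      (fun i hi j hj hij => hTd _ (hπ i (by omega)) _ (hπ j (by omega)) (by
        simp only [π]
        split_ifs <;> omega))
    have hset : (Finset.range (2 * h - 1 + 1)).biUnion (fun i => T (π i)) =
        (Finset.range (2 * h)).biUnion T := by
      ext v
      simp only [Finset.mem_biUnion, Finset.mem_range]
      constructor
      · rintro ⟨i, hi, hv⟩
        exact ⟨π i, hπ i (by omega), hv⟩
      · rintro ⟨i, hi, hv⟩
        rcases Nat.even_or_odd' i with ⟨c, hc | hc⟩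
        · refine ⟨h + c, by omega, ?_⟩
          have : π (h + c) = i := by
            simp only [π]
            split_ifs <;> omega
          rwa [this]
        · refine ⟨c, by omega, ?_⟩
          have : π c = i := by
            simp only [π]
            split_ifs <;> omega
          rwa [this]
    rw [hset] at this
    have p0 : π 0 = 1 := by simp only [π]; split_ifs <;> omega
    have p1 : 2 * π (2 * h - 1) + 2 = 4 * h - 2 := by simp only [π]; split_ifs <;> omega
    simp only [p0, p1] at this
    exact this
  have d1 : Disjoint {z 0} ((Finset.range (2 * h)).biUnion T) := by
    simp only [Finset.disjoint_singleton_left, Finset.mem_biUnion, Finset.mem_range]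
    rintro ⟨j, hj, hv⟩
    exact hz0 j hj hv
  have d2 : Disjoint ({z 0} ∪ (Finset.range (2 * h)).biUnion T) {z (4 * h - 1)} := by
    simp only [Finset.disjoint_singleton_right, Finset.mem_union, Finset.mem_singleton,
      Finset.mem_biUnion, Finset.mem_range]
    rintro (hv | ⟨j, hj, hv⟩)
    · exact hz0e hv.symm
    · exact hze j hj hv
  have d3 : x ∉ (Finset.range (2 * h)).biUnion T := by
    simp only [Finset.mem_biUnion, Finset.mem_range]
    rintro ⟨j, hj, hv⟩
    exact hxT j hj hv
  constructor
  · refine Pth.append (Pth.append (Pth.single D _) e2 ?_ d1) (Pth.single D _) ?_ d2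
    · rw [hu 1 le_rfl]; exact a3 0 (by omega)
    · have := a3 (2 * h - 1) (by omega)
      rw [show 4 * h - 2 = 2 * (2 * h - 1) by omega, show 4 * h - 1 = 2 * (2 * h - 1) + 1 by omega]
      exact this
  · have := Pth.append (Pth.append (Pth.append (Pth.single D _) (Pth.single D x) a1 (by simp [hx0.symm])) e1 (by rw [hu0]; exact a2)
      (by rw [Finset.disjoint_union_left]; exact ⟨d1, by simpa using d3⟩)) (Pth.single D (z (4 * h - 1)))
      (by
        have := a4 (2 * h - 1) (by omega)
        rwa [show 2 * (2 * h - 1) + 2 = 4 * h by omega, show 2 * (2 * h - 1) + 1 = 4 * h - 1 by omega] at this)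
      (by
        rw [Finset.disjoint_union_left] at d2
        rw [Finset.disjoint_union_left, Finset.disjoint_union_left]
        exact ⟨⟨d2.1, by simp [hxe]⟩, d2.2⟩)
    convert this using 1
    ext v
    simp only [Finset.mem_insert, Finset.mem_union, Finset.mem_singleton]
    tauto

end HamPf

namespace HamPf
variable {V : Type} [DecidableEq V]

/-- start vertex of the `j`-th connection of the `i`-th absorber -/
def stA {ι : Type} (h : ℕ) (z : ι → ℕ → V) (i : ι) (j : ℕ) : V :=
  if j = 0 then z i (4 * h + 1) else z i (2 * j - 1)

/-- end vertex of the `j`-th connection of the `i`-th absorber -/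
def enA {ι : Type} (h : ℕ) (z : ι → ℕ → V) (nx : ι → ι) (i : ι) (j : ℕ) : V :=
  if j < 2 * h then z i (2 * j + 2) else z (nx i) 0

lemma absorbing {D : V → V → Bool} {h N : ℕ} (hh : 1 ≤ h) (hN : 1 ≤ N) {ι : Type} [Fintype ι]
    [Nonempty ι]
    (f : ℕ → ι) (nx : ι → ι) (hf1 : ∀ i, nx (f i) = f (i + 1))
    (hf2 : ∀ i < Fintype.card ι, ∀ j < Fintype.card ι, f i = f j → i = j)
    (hf3 : ∀ x, ∃ i < Fintype.card ι, f i = x)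
    (x : ι → V) (z : ι → ℕ → V) (y : ι → ℕ → ℕ → V) (hx : Function.Injective x)
    (hz : ∀ i i' j j', j < 4 * h + 2 → j' < 4 * h + 2 → z i j = z i' j' → i = i' ∧ j = j')
    (hy : ∀ i i' j j' k k', j < 2 * h + 1 → j' < 2 * h + 1 → k < N → k' < N →
      y i j k = y i' j' k' → i = i' ∧ j = j' ∧ k = k')
    (hzy : ∀ i i' j j' k, j < 4 * h + 2 → j' < 2 * h + 1 → k < N → z i j ≠ y i' j' k)
    (hxz : ∀ i i' j, j < 4 * h + 2 → x i ≠ z i' j)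
    (hxy : ∀ i i' j' k, j' < 2 * h + 1 → k < N → x i ≠ y i' j' k)
    (a1 : ∀ i, D (z i 0) (x i) = true) (a2 : ∀ i, D (x i) (z i (4 * h + 1)) = true)
    (a3 : ∀ i, ∀ j ≤ 2 * h, D (z i (2 * j)) (z i (2 * j + 1)) = true)
    (a4 : ∀ i, ∀ j < 2 * h, D (z i (2 * j + 2)) (z i (2 * j + 1)) = true)
    (b1 : ∀ i, ∀ j < 2 * h + 1, D (stA h z i j) (y i j 0) = true)
    (b2 : ∀ i, ∀ j < 2 * h + 1, ∀ k, k + 1 < N → D (y i j k) (y i j (k + 1)) = true)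
    (b3 : ∀ i, ∀ j < 2 * h + 1, D (y i j (N - 1)) (enA h z nx i j) = true) :
    ∃ (s e : V) (Z : Finset V),
      (∀ v ∈ Z, (∃ i, ∃ j < 4 * h + 2, v = z i j) ∨ ∃ i, ∃ j < 2 * h + 1, ∃ k < N, v = y i j k) ∧
      s ∈ Z ∧ e ∈ Z ∧
      ∀ I : Finset ι, Pth D s e (Z ∪ I.image x) := by
  classical
  -- the pieces
  let Q : ι → ℕ → Finset V := fun i j => (Finset.range N).image (y i j)
  have hQ : ∀ i, ∀ j < 2 * h + 1, Pth D (y i j 0) (y i j (N - 1)) (Q i j) := fun i j hj =>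
    Pth.ofSeq _ N hN (b2 i j hj) (fun k hk k' hk' heq => (hy i i j j k k' hj hj hk hk' heq).2.2)
  have hQm : ∀ i j v, v ∈ Q i j → ∃ k < N, v = y i j k := by
    intro i j v hv
    obtain ⟨k, hk, rfl⟩ := Finset.mem_image.1 hv
    exact ⟨k, Finset.mem_range.1 hk, rfl⟩
  have hst : ∀ i, ∀ j < 2 * h + 1, ∃ c < 4 * h + 2, stA h z i j = z i c ∧
      (c % 2 = 1) ∧ (j = 0 ∧ c = 4 * h + 1 ∨ 1 ≤ j ∧ c = 2 * j - 1) := by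
    intro i j hj
    by_cases h0 : j = 0
    · exact ⟨4 * h + 1, by omega, by simp [stA, h0], by omega, by omega⟩
    · exact ⟨2 * j - 1, by omega, by simp [stA, h0], by omega, by omega⟩
  let T : ι → ℕ → Finset V := fun i j => {stA h z i j} ∪ Q i j ∪ {z i (2 * j + 2)}
  have hTm : ∀ i, ∀ j < 2 * h, ∀ v ∈ T i j, (∃ k < N, v = y i j k) ∨
      ∃ c < 4 * h + 2, v = z i c ∧ (c = 2 * j + 2 ∨ (j = 0 ∧ c = 4 * h + 1 ∨ 1 ≤ j ∧ c = 2 * j - 1)) := by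
    intro i j hj v hv
    simp only [T, Finset.mem_union, Finset.mem_singleton] at hv
    rcases hv with (hv | hv) | hv
    · obtain ⟨c, hc, h1, h2, h3⟩ := hst i j (by omega)
      exact Or.inr ⟨c, hc, hv.trans h1, Or.inr h3⟩
    · exact Or.inl (hQm _ _ _ hv)
    · exact Or.inr ⟨_, by omega, hv, Or.inl rfl⟩
  have hT : ∀ i, ∀ j < 2 * h, Pth D (stA h z i j) (z i (2 * j + 2)) (T i j) := by
    intro i j hj
    obtain ⟨c, hc, h1, h2, h3⟩ := hst i j (by omega)
    refine Pth.append (Pth.append (Pth.single D _) (hQ i j (by omega)) (b1 i j (by omega)) ?_)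
      (Pth.single D _) ?_ ?_
    · rw [Finset.disjoint_singleton_left, h1]
      intro hv
      obtain ⟨k, hk, h5⟩ := hQm _ _ _ hv
      exact hzy _ _ _ _ _ hc (by omega) hk h5
    · have := b3 i j (by omega)
      simpa [enA, hj] using this
    · rw [Finset.disjoint_singleton_right, Finset.mem_union, Finset.mem_singleton, h1]
      rintro (hv | hv)
      · have := (hz _ _ _ _ (by omega) hc hv).2
        omega
      · obtain ⟨k, hk, h5⟩ := hQm _ _ _ hv
        exact hzy _ _ _ _ _ (by omega) (by omega) hk h5
  have hTz : ∀ i, ∀ j < 2 * h, ∀ c < 4 * h + 2, z i c ∈ T i j →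
      (c = 2 * j + 2 ∨ (j = 0 ∧ c = 4 * h + 1 ∨ 1 ≤ j ∧ c = 2 * j - 1)) := by
    intro i j hj c hc hv
    rcases hTm i j hj _ hv with ⟨k, hk, h5⟩ | ⟨c', hc', h1, h2⟩
    · exact absurd h5 (hzy _ _ _ _ _ hc (by omega) hk)
    · have := (hz _ _ _ _ hc hc' h1).2
      subst this
      exact h2
  let A0 : ι → Finset V := fun i =>
    {z i 0} ∪ (Finset.range (2 * h)).biUnion (T i) ∪ {z i (4 * h - 1)}
  have hA : ∀ i, Pth D (z i 0) (z i (4 * h - 1)) (A0 i) ∧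
      Pth D (z i 0) (z i (4 * h - 1)) (insert (x i) (A0 i)) := by
    intro i
    refine absorber hh (z i) (x i) (stA h z i) (T i) (by simp [stA])
      (fun j hj => by simp [stA, show j ≠ 0 by omega]) (hT i) ?_ ?_ ?_ ?_ ?_ ?_ ?_ (a1 i) (a2 i) (a3 i) (a4 i)
    · intro j hj j' hj' hne
      rw [Finset.disjoint_left]
      intro v hv hv'
      rcases hTm i j hj v hv with ⟨k, hk, h1⟩ | ⟨c, hc, h1, h2⟩
      · rcases hTm i j' hj' v hv' with ⟨k', hk', h1'⟩ | ⟨c', hc', h1', h2'⟩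
        · exact hne (hy i i j j' k k' (by omega) (by omega) hk hk' (h1.symm.trans h1')).2.1
        · exact hzy _ _ _ _ _ hc' (by omega) hk (h1'.symm.trans h1)
      · rw [h1] at hv'
        have := hTz i j' hj' c hc hv'
        omega
    · intro j hj hv
      have := hTz i j hj 0 (by omega) hv
      omega
    · intro j hj hv
      have := hTz i j hj _ (by omega) hv
      omega
    · intro j hj hv
      rcases hTm i j hj _ hv with ⟨k, hk, h1⟩ | ⟨c, hc, h1, h2⟩
      · exact hxy _ _ _ _ (by omega) hk h1
      · exact hxz _ _ _ hc h1
    · intro heq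
      have := (hz _ _ _ _ (by omega) (by omega) heq).2
      omega
    · exact hxz _ _ _ (by omega)
    · exact hxz _ _ _ (by omega)
  have hA0m : ∀ i, ∀ v ∈ A0 i, (∃ c < 4 * h + 2, v = z i c) ∨
      ∃ j < 2 * h, ∃ k < N, v = y i j k := by
    intro i v hv
    simp only [A0, Finset.mem_union, Finset.mem_singleton, Finset.mem_biUnion, Finset.mem_range] at hv
    rcases hv with (hv | ⟨j, hj, hv⟩) | hv
    · exact Or.inl ⟨0, by omega, hv⟩
    · rcases hTm i j hj v hv with ⟨k, hk, h1⟩ | ⟨c, hc, h1, h2⟩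
      · exact Or.inr ⟨j, hj, k, hk, h1⟩
      · exact Or.inl ⟨c, hc, h1⟩
    · exact Or.inl ⟨_, by omega, hv⟩
  let B : ι → Finset V := fun i => A0 i ∪ Q i (2 * h)
  have hBm : ∀ i, ∀ v ∈ B i, (∃ c < 4 * h + 2, v = z i c) ∨
      ∃ j < 2 * h + 1, ∃ k < N, v = y i j k := by
    intro i v hv
    rcases Finset.mem_union.1 hv with hv | hv
    · rcases hA0m i v hv with h1 | ⟨j, hj, h1⟩
      · exact Or.inl h1
      · exact Or.inr ⟨j, by omega, h1⟩
    · exact Or.inr ⟨2 * h, by omega, hQm _ _ _ hv⟩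
  have hxB : ∀ i i', x i ∉ B i' := by
    intro i i' hv
    rcases hBm i' _ hv with ⟨c, hc, h1⟩ | ⟨j, hj, k, hk, h1⟩
    · exact hxz _ _ _ hc h1
    · exact hxy _ _ _ _ hj hk h1
  have hBd : ∀ i i', i ≠ i' → Disjoint (B i) (B i') := by
    intro i i' hne
    rw [Finset.disjoint_left]
    intro v hv hv'
    rcases hBm i v hv with ⟨c, hc, h1⟩ | ⟨j, hj, k, hk, h1⟩ <;>
    rcases hBm i' v hv' with ⟨c', hc', h1'⟩ | ⟨j', hj', k', hk', h1'⟩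
    · exact hne (hz _ _ _ _ hc hc' (h1.symm.trans h1')).1
    · exact hzy _ _ _ _ _ hc hj' hk' (h1.symm.trans h1')
    · exact hzy _ _ _ _ _ hc' hj hk (h1'.symm.trans h1)
    · exact hne (hy _ _ _ _ _ _ hj hj' hk hk' (h1.symm.trans h1')).1
  let BI : Finset ι → ι → Finset V := fun I i => if i ∈ I then insert (x i) (B i) else B i
  have hstl : ∀ i, stA h z i (2 * h) = z i (4 * h - 1) := by
    intro i
    simp only [stA, show 2 * h ≠ 0 by omega, if_false]
    congr 1
    omega
  have hBP : ∀ I i, Pth D (z i 0) (y i (2 * h) (N - 1)) (BI I i) := by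
    intro I i
    have harc : D (z i (4 * h - 1)) (y i (2 * h) 0) = true := by
      rw [← hstl]; exact b1 i _ (by omega)
    have hd : Disjoint (A0 i) (Q i (2 * h)) := by
      rw [Finset.disjoint_left]
      intro v hv hv'
      obtain ⟨k', hk', h1'⟩ := hQm _ _ _ hv'
      rcases hA0m i v hv with ⟨c, hc, h1⟩ | ⟨j, hj, k, hk, h1⟩
      · exact hzy _ _ _ _ _ hc (by omega) hk' (h1.symm.trans h1')
      · have := (hy _ _ _ _ _ _ (by omega) (by omega) hk hk' (h1.symm.trans h1')).2.1
        omega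
    by_cases hi : i ∈ I
    · simp only [BI, hi, if_true]
      have h1 := Pth.append (hA i).2 (hQ i (2 * h) (by omega)) harc (by
        rw [Finset.disjoint_insert_left]
        exact ⟨fun hv => hxB i i (Finset.mem_union_right _ hv), hd⟩)
      rwa [Finset.insert_union] at h1
    · simp only [BI, hi, if_false]
      exact Pth.append (hA i).1 (hQ i (2 * h) (by omega)) harc hd
  have hBIm : ∀ I i v, v ∈ BI I i ↔ v ∈ B i ∨ (i ∈ I ∧ v = x i) := by
    intro I i v
    by_cases hi : i ∈ I
    · simp only [BI, hi, if_true, Finset.mem_insert, true_and]; tauto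
    · simp [BI, hi]
  have hBId : ∀ I i i', i ≠ i' → Disjoint (BI I i) (BI I i') := by
    intro I i i' hne
    rw [Finset.disjoint_left]
    intro v hv hv'
    rw [hBIm] at hv hv'
    rcases hv with hv | ⟨_, hv⟩ <;> rcases hv' with hv' | ⟨_, hv'⟩
    · exact Finset.disjoint_left.1 (hBd i i' hne) hv hv'
    · rw [hv'] at hv; exact hxB _ _ hv
    · rw [hv] at hv'; exact hxB _ _ hv'
    · exact hne (hx (hv.symm.trans hv'))
  have hcpos : 0 < Fintype.card ι := Fintype.card_pos
  set c := Fintype.card ι - 1 with hc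
  have hmemB : ∀ i, z i 0 ∈ B i := fun i => by simp [B, A0]
  have hmemB' : ∀ i, y i (2 * h) (N - 1) ∈ B i := fun i => by
    refine Finset.mem_union_right _ (Finset.mem_image_of_mem _ (Finset.mem_range.2 (by omega)))
  refine ⟨z (f 0) 0, y (f c) (2 * h) (N - 1), Finset.univ.biUnion B, ?_, ?_, ?_, ?_⟩
  · intro v hv
    obtain ⟨i, _, hv⟩ := Finset.mem_biUnion.1 hv
    rcases hBm i v hv with h1 | h1
    · exact Or.inl ⟨i, h1⟩
    · exact Or.inr ⟨i, h1⟩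
  · exact Finset.mem_biUnion.2 ⟨_, Finset.mem_univ _, hmemB _⟩
  · exact Finset.mem_biUnion.2 ⟨_, Finset.mem_univ _, hmemB' _⟩
  · intro I
    have := Pth.chain (D := D) (fun i => z (f i) 0) (fun i => y (f i) (2 * h) (N - 1))
      (fun i => BI I (f i)) c (fun i _ => hBP I (f i))
      (fun i hi => by
        have := b3 (f i) (2 * h) (by omega)
        simpa [enA, hf1] using this)
      (fun i hi j hj hij => hBId I _ _ (fun heq => hij (hf2 i (by omega) j (by omega) heq)))
    convert this using 1
    ext v
    simp only [Finset.mem_union, Finset.mem_biUnion, Finset.mem_univ, true_and, Finset.mem_image,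
      Finset.mem_range, hBIm]
    constructor
    · rintro (⟨i, hi⟩ | ⟨i, hi, rfl⟩)
      · obtain ⟨j, hj, rfl⟩ := hf3 i
        exact ⟨j, by omega, Or.inl hi⟩
      · obtain ⟨j, hj, rfl⟩ := hf3 i
        exact ⟨j, by omega, Or.inr ⟨hi, rfl⟩⟩
    · rintro ⟨j, hj, hv | ⟨hv, rfl⟩⟩
      · exact Or.inl ⟨_, hv⟩
      · exact Or.inr ⟨_, hv, rfl⟩

end HamPf

namespace HamPf
variable {V : Type} [DecidableEq V]

/-- number of arcs between two sets -/
def eb (R : V → V → Bool) (X Y : Finset V) : ℕ :=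
  ((X ×ˢ Y).filter fun e => R e.1 e.2 = true).card

lemma eb_eq (R : V → V → Bool) (X Y : Finset V) : eb R X Y = ∑ v ∈ X, dg R v Y := by
  unfold eb dg
  simp only [Finset.card_filter]
  rw [Finset.sum_product]

lemma eb_mono (R : V → V → Bool) {X X' Y Y' : Finset V} (h : X ⊆ X') (h' : Y ⊆ Y') :
    eb R X Y ≤ eb R X' Y' :=
  Finset.card_le_card (Finset.filter_subset_filter _ (Finset.product_subset_product h h'))

lemma eb_le_of_sdiff (R : V → V → Bool) (B Y C : Finset V) :
    eb R B Y ≤ eb R B C + eb R B (Y \ C) := by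
  rw [eb_eq, eb_eq, eb_eq, ← Finset.sum_add_distrib]
  refine Finset.sum_le_sum fun v _ => ?_
  have := dg_sdiff R v Y C
  omega

lemma eb_small {R : V → V → Bool} {a2 l s : ℝ} (hl : 0 ≤ l)
    (P2 : ∀ X : Finset V, (X.card : ℝ) ≤ a2 → (eb R X X : ℝ) ≤ X.card * l) (h2s : 2 * s ≤ a2)
    {B : Finset V} (hB : B.Nonempty) (hBs : (B.card : ℝ) < s) :
    ∀ (m : ℕ) (Y : Finset V), Y.card ≤ m → Disjoint B Y →
      (eb R B Y : ℝ) ≤ 2 * l * (Y.card + B.card) := by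
  have base : ∀ Y : Finset V, Y.card ≤ B.card → (eb R B Y : ℝ) ≤ l * (Y.card + B.card) := by
    intro Y hY
    have hc : ((B ∪ Y).card : ℝ) ≤ B.card + Y.card := by exact_mod_cast Finset.card_union_le _ _
    have hY' : (Y.card : ℝ) ≤ B.card := by exact_mod_cast hY
    have h1 := P2 (B ∪ Y) (by linarith)
    have h2 : (eb R B Y : ℝ) ≤ eb R (B ∪ Y) (B ∪ Y) := by
      exact_mod_cast eb_mono R Finset.subset_union_left Finset.subset_union_right
    have h3 : ((B ∪ Y).card : ℝ) * l ≤ (B.card + Y.card) * l :=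
      mul_le_mul_of_nonneg_right hc hl
    linarith
  intro m
  induction m with
  | zero =>
    intro Y hY _
    have := base Y (by omega)
    have h0 : (0:ℝ) ≤ l * (Y.card + B.card) := by positivity
    linarith
  | succ m ih =>
    intro Y hY hd
    have h0 : (0:ℝ) ≤ l * (Y.card + B.card) := by positivity
    by_cases hYB : Y.card ≤ B.card
    · have := base Y hYB
      linarith
    · obtain ⟨C, hCY, hC⟩ := Finset.exists_subset_card_eq (le_of_not_ge hYB)
      have h1 := base C hC.le
      have hpos := hB.card_pos
      have hsd : (Y \ C).card = Y.card - C.card := Finset.card_sdiff_of_subset hCY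
      have h2 := ih (Y \ C) (by omega) (Finset.disjoint_of_subset_right Finset.sdiff_subset hd)
      have h3 : (eb R B Y : ℝ) ≤ eb R B C + eb R B (Y \ C) := by
        exact_mod_cast eb_le_of_sdiff R B Y C
      have h4 : ((Y \ C).card : ℝ) + B.card = Y.card := by
        have : (Y \ C).card + B.card = Y.card := by omega
        exact_mod_cast this
      have h5 : (C.card : ℝ) = B.card := by exact_mod_cast hC
      rw [h4] at h2
      rw [h5] at h1
      linarith

lemma expP_of [Fintype V] {R : V → V → Bool} {a2 l s q : ℝ} (hl : 0 < l) (hq : 0 < q) (hs : 0 < s)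
    (P2 : ∀ X : Finset V, (X.card : ℝ) ≤ a2 → (eb R X X : ℝ) ≤ X.card * l)
    (P3 : ∀ X Y : Finset V, Disjoint X Y → s ≤ (X.card : ℝ) → s ≤ (Y.card : ℝ) →
      (eb R X Y : ℝ) ≤ q * X.card * Y.card)
    (h2s : 2 * s ≤ a2) (hn : 2 * ⌈s⌉₊ ≤ Fintype.card V) (hqs : q * ⌈s⌉₊ < 4 * l) :
    ExpP R (4 * l) q := by
  intro B Y hd d hgd hdeg
  have key : ∀ B' ⊆ B, ∀ Y', Y ⊆ Y' → (B'.card : ℝ) * d ≤ eb R B' Y' := by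
    intro B' hB' Y' hY'
    rw [eb_eq]
    push_cast
    rw [← nsmul_eq_mul]
    refine Finset.card_nsmul_le_sum _ _ _ fun v hv => ?_
    refine le_trans (hdeg v (hB' hv)) ?_
    exact_mod_cast dg_mono R v hY'
  by_cases hB : s ≤ (B.card : ℝ)
  · have hB0 : (0:ℝ) < B.card := lt_of_lt_of_le hs hB
    by_cases hY : s ≤ (Y.card : ℝ)
    · right
      have h1 := P3 B Y hd hB hY
      have h2 := key B (Finset.Subset.refl _) Y (Finset.Subset.refl _)
      have : (B.card : ℝ) * d ≤ B.card * (q * Y.card) := by linarith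
      exact le_of_mul_le_mul_left this hB0
    · exfalso
      obtain ⟨B', hB', hB'c⟩ := Finset.exists_subset_card_eq (Nat.ceil_le.2 hB)
      have hYc : Y.card ≤ ⌈s⌉₊ := by
        have h1 : (Y.card : ℝ) ≤ ⌈s⌉₊ := le_trans (le_of_not_ge hY) (Nat.le_ceil s)
        exact_mod_cast h1
      have hco : ⌈s⌉₊ ≤ (B'ᶜ).card := by rw [Finset.card_compl]; omega
      obtain ⟨Y', hYY', hY'B, hY'c⟩ := Finset.exists_subsuperset_card_eq
        (s := Y) (t := B'ᶜ) (n := ⌈s⌉₊) (by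
          intro y hy
          rw [Finset.mem_compl]
          exact fun h => Finset.disjoint_left.1 hd (hB' h) hy) hYc hco
      have hdis : Disjoint B' Y' :=
        Finset.disjoint_of_subset_right hY'B disjoint_compl_right
      have h1 := P3 B' Y' hdis (by rw [hB'c]; exact Nat.le_ceil s) (by rw [hY'c]; exact Nat.le_ceil s)
      have h2 := key B' hB' Y' hYY'
      rw [hB'c] at h1 h2
      rw [hY'c] at h1
      have hc : (0:ℝ) < (⌈s⌉₊ : ℝ) := lt_of_lt_of_le hs (Nat.le_ceil s)
      have h3 : (⌈s⌉₊ : ℝ) * d ≤ ⌈s⌉₊ * (q * ⌈s⌉₊) := by linarith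
      have h4 := le_of_mul_le_mul_left h3 hc
      linarith
  · left
    rcases B.eq_empty_or_nonempty with rfl | hBn
    · simp; positivity
    · have h1 := eb_small hl.le P2 h2s hBn (lt_of_not_ge hB) Y.card Y le_rfl hd
      have h2 := key B (Finset.Subset.refl _) Y (Finset.Subset.refl _)
      have h3 : (B.card : ℝ) * (4 * l) ≤ B.card * d :=
        mul_le_mul_of_nonneg_left hgd (Nat.cast_nonneg _)
      linarith

lemma eb_swap (D : V → V → Bool) (X Y : Finset V) : eb (dr D false) X Y = eb (dr D true) Y X := by
  unfold eb
  refine Finset.card_bij (fun e _ => (e.2, e.1)) ?_ ?_ ?_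
  · intro e he
    simp only [Finset.mem_filter, Finset.mem_product, dr] at *
    simpa [and_comm] using he
  · rintro ⟨a, b⟩ _ ⟨c, d⟩ _ h
    simp only [Prod.mk.injEq] at *
    tauto
  · rintro ⟨a, b⟩ h
    refine ⟨(b, a), ?_, rfl⟩
    simp only [Finset.mem_filter, Finset.mem_product, dr] at *
    simpa [and_comm] using h

/-- both orientations expand -/
lemma expP_both [Fintype V] {D : V → V → Bool} {a2 l s q : ℝ} (hl : 0 < l) (hq : 0 < q) (hs : 0 < s)
    (P2 : ∀ X : Finset V, (X.card : ℝ) ≤ a2 → (eb D X X : ℝ) ≤ X.card * l)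
    (P3 : ∀ X Y : Finset V, Disjoint X Y → s ≤ (X.card : ℝ) → s ≤ (Y.card : ℝ) →
      (eb D X Y : ℝ) ≤ q * X.card * Y.card)
    (h2s : 2 * s ≤ a2) (hn : 2 * ⌈s⌉₊ ≤ Fintype.card V) (hqs : q * ⌈s⌉₊ < 4 * l) (b : Bool) :
    ExpP (dr D b) (4 * l) q := by
  have hD : dr D true = D := by funext v w; simp [dr]
  cases b
  · refine expP_of hl hq hs ?_ ?_ h2s hn hqs
    · intro X hX
      rw [eb_swap, hD]
      exact P2 X hX
    · intro X Y hd hX hY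
      rw [eb_swap, hD]
      have := P3 Y X hd.symm hY hX
      linarith
  · rw [hD]
    exact expP_of hl hq hs P2 P3 h2s hn hqs
end HamPf

namespace HamPf
variable {V : Type} [DecidableEq V]

lemma one_sub_exp_neg_ge {x : ℝ} (hx : 0 ≤ x) : x - x ^ 2 / 2 ≤ 1 - Real.exp (-x) := by
  have h1 := Real.quadratic_le_exp_of_nonneg hx
  rw [Real.exp_neg]
  have h2 : (Real.exp x)⁻¹ ≤ (1 + x + x ^ 2 / 2)⁻¹ := inv_anti₀ (by positivity) h1
  have h3 : (1 + x + x ^ 2 / 2)⁻¹ ≤ 1 - x + x ^ 2 / 2 := by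
    rw [inv_le_iff_one_le_mul₀ (by positivity)]
    nlinarith [sq_nonneg (x ^ 2)]
  linarith

lemma chernoff {m K : ℕ} (hK : 1 ≤ K) {J : Type} [Fintype J] (T : J → Fin m → Finset (Fin K))
    {μ ε : ℝ} (hμ : 0 ≤ μ) (hε : 0 < ε) (hε1 : ε ≤ 1)
    (hT : ∀ j, μ * K ≤ ∑ g, ((T j g).card : ℝ))
    (hJ : (Fintype.card J : ℝ) * Real.exp (-(ε ^ 2 * μ / 2)) < 1) :
    ∃ f : Fin m → Fin K, ∀ j, (1 - ε) * μ ≤ ((Finset.univ.filter fun g => f g ∈ T j g).card : ℝ) := by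
  classical
  by_contra hcon
  push Not at hcon
  have hK0 : (0:ℝ) < K := by exact_mod_cast hK
  set a := 1 - Real.exp (-ε) with ha
  have ha1 : ε - ε ^ 2 / 2 ≤ a := one_sub_exp_neg_ge hε.le
  have ha0 : 0 ≤ a := by nlinarith
  -- moment generating function
  have mgf : ∀ j, ∑ f : Fin m → Fin K,
      Real.exp (-ε * ((Finset.univ.filter fun g => f g ∈ T j g).card : ℝ)) ≤
      (K:ℝ) ^ m * Real.exp (-(a * μ)) := by
    intro j
    have e1 : ∀ f : Fin m → Fin K,
        Real.exp (-ε * ((Finset.univ.filter fun g => f g ∈ T j g).card : ℝ)) =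
        ∏ g, (if f g ∈ T j g then Real.exp (-ε) else 1) := by
      intro f
      rw [Finset.prod_ite, Finset.prod_const, Finset.prod_const_one, mul_one, ← Real.exp_nat_mul]
      ring_nf
    simp_rw [e1]
    have e2 := (Finset.prod_univ_sum (fun _ : Fin m => (Finset.univ : Finset (Fin K)))
      (fun g k => if k ∈ T j g then Real.exp (-ε) else (1:ℝ))).symm
    rw [Fintype.piFinset_univ] at e2
    rw [e2]
    have e3 : ∀ g, ∑ k : Fin K, (if k ∈ T j g then Real.exp (-ε) else (1:ℝ)) ≤
        K * Real.exp (-(a * ((T j g).card / K))) := by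
      intro g
      have e4 : ∑ k : Fin K, (if k ∈ T j g then Real.exp (-ε) else (1:ℝ)) =
          K - a * (T j g).card := by
        have : ∀ k : Fin K, (if k ∈ T j g then Real.exp (-ε) else (1:ℝ)) =
            1 - (if k ∈ T j g then a else 0) := by
          intro k
          split_ifs <;> simp [ha]
        simp_rw [this]
        rw [Finset.sum_sub_distrib, ← Finset.sum_filter]
        simp [mul_comm]
      rw [e4]
      have e5 := Real.add_one_le_exp (-(a * ((T j g).card / K)))
      have e6 := mul_le_mul_of_nonneg_left e5 hK0.le
      have e7 : (K:ℝ) * (-(a * ((T j g).card / K)) + 1) = K - a * (T j g).card := by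
        field_simp
        ring
      linarith
    refine le_trans (Finset.prod_le_prod (fun g _ => Finset.sum_nonneg fun k _ => by
      split_ifs <;> positivity) (fun g _ => e3 g)) ?_
    rw [Finset.prod_mul_distrib, Finset.prod_const, Finset.card_univ, Fintype.card_fin,
      ← Real.exp_sum]
    refine mul_le_mul_of_nonneg_left (Real.exp_le_exp.2 ?_) (by positivity)
    rw [Finset.sum_neg_distrib, ← Finset.mul_sum, ← Finset.sum_div]
    refine neg_le_neg (mul_le_mul_of_nonneg_left ?_ ha0)
    rw [le_div_iff₀ hK0]
    exact hT j
  have h1 : ∀ f : Fin m → Fin K, (1:ℝ) ≤ ∑ j, Real.exp (ε * ((1 - ε) * μ)) *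
      Real.exp (-ε * ((Finset.univ.filter fun g => f g ∈ T j g).card : ℝ)) := by
    intro f
    obtain ⟨j, hj⟩ := hcon f
    refine le_trans ?_ (Finset.single_le_sum (f := fun j => Real.exp (ε * ((1 - ε) * μ)) *
      Real.exp (-ε * ((Finset.univ.filter fun g => f g ∈ T j g).card : ℝ)))
      (fun j _ => by positivity) (Finset.mem_univ j))
    rw [← Real.exp_add]
    refine Real.one_le_exp ?_
    nlinarith
  have h2 : ((K:ℝ) ^ m) ≤ ∑ f : Fin m → Fin K, ∑ j, Real.exp (ε * ((1 - ε) * μ)) *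
      Real.exp (-ε * ((Finset.univ.filter fun g => f g ∈ T j g).card : ℝ)) := by
    have := Finset.sum_le_sum (s := (Finset.univ : Finset (Fin m → Fin K))) (fun f _ => h1 f)
    simpa using this
  rw [Finset.sum_comm] at h2
  have h3 : ∀ j : J, ∑ f : Fin m → Fin K, Real.exp (ε * ((1 - ε) * μ)) *
      Real.exp (-ε * ((Finset.univ.filter fun g => f g ∈ T j g).card : ℝ)) ≤
      (K:ℝ) ^ m * Real.exp (-(ε ^ 2 * μ / 2)) := by
    intro j
    rw [← Finset.mul_sum]
    refine le_trans (mul_le_mul_of_nonneg_left (mgf j) (Real.exp_nonneg _)) ?_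
    rw [mul_left_comm, ← Real.exp_add]
    refine mul_le_mul_of_nonneg_left (Real.exp_le_exp.2 ?_) (by positivity)
    have := mul_le_mul_of_nonneg_right ha1 hμ
    nlinarith
  have h4 := le_trans h2 (Finset.sum_le_sum fun j _ => h3 j)
  rw [Finset.sum_const, Finset.card_univ, nsmul_eq_mul] at h4
  have hKm : (0:ℝ) < (K:ℝ) ^ m := by positivity
  nlinarith

/-- random equipartition -/
lemma partition [Fintype V] (D : V → V → Bool) (U : Finset V) {K : ℕ} (hK : 1 ≤ K) {d ε : ℝ}
    (hε : 0 < ε) (hε1 : ε ≤ 1) (hd : (K:ℝ) ≤ d)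
    (hdeg : ∀ b v, d ≤ (dg (dr D b) v U : ℝ))
    (hch : (2 * Fintype.card V * K : ℝ) * Real.exp (-(ε ^ 2 * ((d - K) / K) / 2)) < 1) :
    ∃ C : Fin K → Finset V, (∀ i, C i ⊆ U) ∧ (∀ i, (C i).card = U.card / K) ∧
      (∀ i j, i ≠ j → Disjoint (C i) (C j)) ∧
      ∀ b v i, (1 - ε) * ((d - K) / K) ≤ (dg (dr D b) v (C i) : ℝ) := by
  classical
  have hK0 : (0:ℝ) < K := by exact_mod_cast hK
  have : NeZero K := ⟨by omega⟩
  set m := U.card / K with hm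
  obtain ⟨U', hU', hU'c⟩ := Finset.exists_subset_card_eq (Nat.div_mul_le_self U.card K)
  rw [← hm] at hU'c
  let e : Fin m × Fin K ≃ U' := finProdFinEquiv.trans
    ((finCongr hU'c.symm).trans U'.equivFin.symm)
  -- targets
  let T : (V × Bool × Fin K) → Fin m → Finset (Fin K) := fun t g =>
    Finset.univ.filter fun k => dr D t.2.1 t.1 (e (g, t.2.2 + k)) = true
  have hT : ∀ t, (d - K) / K * K ≤ ∑ g, ((T t g).card : ℝ) := by
    rintro ⟨v, b, i⟩
    rw [div_mul_cancel₀ _ hK0.ne']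
    have e1 : ∑ g, (T (v, b, i) g).card = dg (dr D b) v U' := by
      have e2 : ∀ g, (T (v, b, i) g).card =
          (Finset.univ.filter fun k => dr D b v (e (g, k)) = true).card := by
        intro g
        refine Finset.card_bij (fun k _ => i + k) ?_ ?_ ?_
        · intro k hk
          simpa [T] using hk
        · intro k _ k' _ h
          exact add_left_cancel h
        · intro k hk
          refine ⟨k - i, ?_, by simp⟩
          simpa [T] using hk
      simp_rw [e2, Finset.card_filter]
      rw [← Fintype.sum_prod_type' (f := fun g k => if dr D b v (e (g, k)) = true then (1:ℕ) else 0)]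
      unfold dg
      rw [Finset.card_filter, ← Finset.sum_coe_sort U' (fun w => if dr D b v w = true then (1:ℕ) else 0)]
      exact Fintype.sum_equiv e _ _ (fun x => rfl)
    have e3 : (∑ g, ((T (v, b, i) g).card : ℝ)) = dg (dr D b) v U' := by exact_mod_cast e1
    rw [e3]
    have e4 := dg_sdiff (dr D b) v U U'
    have e5 : dg (dr D b) v (U \ U') ≤ K := by
      refine le_trans (Finset.card_filter_le _ _) ?_
      rw [Finset.card_sdiff_of_subset hU', hU'c, hm]
      have := Nat.div_add_mod U.card K
      have h2 := Nat.mod_lt U.card (show K > 0 by omega)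
      rw [mul_comm] at this
      omega
    have e6 : (dg (dr D b) v U : ℝ) ≤ K + dg (dr D b) v U' := by exact_mod_cast (by omega)
    have := hdeg b v
    linarith
  obtain ⟨f, hf⟩ := chernoff hK T (μ := (d - K) / K) (div_nonneg (by linarith) hK0.le) hε hε1 hT (by
    refine lt_of_le_of_lt (le_of_eq ?_) hch
    congr 1
    simp only [Fintype.card_prod, Fintype.card_fin, Fintype.card_bool]
    push_cast
    ring)
  have inj : ∀ i j g g', ((e (g, i + f g) : U') : V) = e (g', j + f g') → g = g' ∧ i = j := by
    intro i j g g' h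
    have h1 := e.injective (Subtype.ext h)
    simp only [Prod.mk.injEq] at h1
    obtain ⟨rfl, h2⟩ := h1
    exact ⟨rfl, add_right_cancel h2⟩
  refine ⟨fun i => Finset.univ.image fun g => ((e (g, i + f g) : U') : V), ?_, ?_, ?_, ?_⟩
  · intro i x hx
    simp only [Finset.mem_image, Finset.mem_univ, true_and] at hx
    obtain ⟨g, rfl⟩ := hx
    exact hU' (e (g, i + f g)).2
  · intro i
    rw [Finset.card_image_of_injective]
    · simp
    · intro g g' h
      exact (inj i i g g' h).1
  · intro i j hij
    rw [Finset.disjoint_left]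
    intro x hx hx'
    simp only [Finset.mem_image, Finset.mem_univ, true_and] at hx hx'
    obtain ⟨g, rfl⟩ := hx
    obtain ⟨g', h⟩ := hx'
    exact hij (inj j i g' g h).2.symm
  · intro b v i
    refine le_trans (hf (v, b, i)) ?_
    norm_cast
    unfold dg
    refine Finset.card_le_card_of_injOn (fun g => ((e (g, i + f g) : U') : V)) ?_ ?_
    · intro g hg
      simp only [T, Finset.coe_filter, Finset.mem_filter, Finset.mem_univ, true_and, Set.mem_ofPred_eq,
        Finset.mem_image] at hg ⊢
      exact ⟨⟨g, rfl⟩, hg⟩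
    · intro g _ g' _ h
      exact (inj i i g g' h).1
end HamPf

namespace HamPf
variable {V : Type} [DecidableEq V]

lemma dg_nb (R : V → V → Bool) (X W : Finset V) {v : V} (hv : v ∈ X) : dg R v W ≤ dg R v (nb R X W) := by
  refine Finset.card_le_card ?_
  intro w hw
  simp only [nb, Finset.mem_filter] at *
  exact ⟨⟨hw.1, v, hv, hw.2⟩, hw.2⟩

lemma matching {D : V → V → Bool} {g q d : ℝ} {m : ℕ} (hE : ∀ b, ExpP (dr D b) g q) (hg : 0 < g)
    (hq : 0 < q) (hgd : g ≤ d) (hqd : q * m / 2 < d) {A B : Finset V} (hAB : Disjoint A B)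
    (hA : A.card = m) (hB : B.card = m) (h1 : ∀ v ∈ A, d ≤ (dg (dr D true) v B : ℝ))
    (h2 : ∀ v ∈ B, d ≤ (dg (dr D false) v A : ℝ)) :
    ∃ φ : V → V, (∀ a ∈ A, φ a ∈ B ∧ D a (φ a) = true) ∧ ∀ a ∈ A, ∀ a' ∈ A, φ a = φ a' → a = a' := by
  classical
  have hd0 : 0 < d := lt_of_lt_of_le hg hgd
  have aux : ∀ x y : ℕ, (x : ℝ) * d ≤ g * y → x ≤ y := by
    intro x y h
    have : (x : ℝ) * d ≤ y * d := by
      have : g * (y:ℝ) ≤ d * y := mul_le_mul_of_nonneg_right hgd (Nat.cast_nonneg _)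
      linarith
    exact_mod_cast le_of_mul_le_mul_right this hd0
  have aux2 : ∀ y : ℕ, d ≤ q * y → m < 2 * y := by
    intro y h
    have h3 : q * (m:ℝ) < q * (2 * y) := by linarith
    have := lt_of_mul_lt_mul_left h3 hq.le
    exact_mod_cast this
  have hall : ∀ X ⊆ A, X.card ≤ (nb (dr D true) X B).card := by
    intro X hX
    by_contra hlt
    push Not at hlt
    set N := nb (dr D true) X B with hN
    have hNB : N ⊆ B := Finset.filter_subset _ _
    have hXm : X.card ≤ m := hA ▸ Finset.card_le_card hX
    rcases hE true X N (Finset.disjoint_of_subset_left hX (Finset.disjoint_of_subset_right hNB hAB)) d hgd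
      (fun v hv => le_trans (h1 v (hX hv)) (by exact_mod_cast dg_nb _ X B hv)) with h | h
    · have := aux _ _ h
      omega
    · have hc := aux2 _ h
      have hYc : (B \ N).card = m - N.card := by rw [Finset.card_sdiff_of_subset hNB, hB]
      have hAc : (A \ X).card = m - X.card := by rw [Finset.card_sdiff_of_subset hX, hA]
      rcases hE false (B \ N) (A \ X) (Finset.disjoint_of_subset_left Finset.sdiff_subset
        (Finset.disjoint_of_subset_right Finset.sdiff_subset hAB.symm)) d hgd (by
          intro v hv
          rw [Finset.mem_sdiff] at hv
          refine le_trans (h2 v hv.1) ?_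
          norm_cast
          refine Finset.card_le_card ?_
          intro w hw
          simp only [Finset.mem_filter, Finset.mem_sdiff] at *
          refine ⟨⟨hw.1, fun hwX => hv.2 ?_⟩, hw.2⟩
          rw [hN, nb, Finset.mem_filter]
          refine ⟨hv.1, w, hwX, ?_⟩
          simpa [dr] using hw.2) with h' | h'
      · have := aux _ _ h'
        omega
      · have := aux2 _ h'
        omega
  have hHall := (Finset.all_card_le_biUnion_card_iff_exists_injective
    (fun a : A => B.filter fun w => D a w = true)).1 (by
      intro S
      have := hall (S.image (fun a : A => (a : V))) (by
        intro x hx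
        simp only [Finset.mem_image] at hx
        obtain ⟨a, _, rfl⟩ := hx
        exact a.2)
      rw [Finset.card_image_of_injective _ Subtype.val_injective] at this
      refine le_trans this (Finset.card_le_card ?_)
      intro w hw
      simp only [nb, Finset.mem_filter, Finset.mem_image, Finset.mem_biUnion] at *
      obtain ⟨hwB, v, ⟨a, ha, rfl⟩, hvw⟩ := hw
      exact ⟨a, ha, hwB, by simpa [dr] using hvw⟩)
  obtain ⟨f, hf, hf2⟩ := hHall
  refine ⟨fun v => if h : v ∈ A then f ⟨v, h⟩ else v, ?_, ?_⟩
  · intro a ha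
    have := hf2 ⟨a, ha⟩
    simp only [Finset.mem_filter] at this
    simp only [ha, dif_pos]
    exact this
  · intro a ha a' ha' h
    simp only [ha, ha', dif_pos] at h
    exact congrArg Subtype.val (hf h)

lemma path_cover {D : V → V → Bool} {g q d : ℝ} {m K : ℕ} (hK : 1 ≤ K)
    (hE : ∀ b, ExpP (dr D b) g q) (hg : 0 < g)
    (hq : 0 < q) (hgd : g ≤ d) (hqd : q * m / 2 < d) (U : Finset V) (hU : U.card < K * m + K)
    (C : Fin K → Finset V) (hCU : ∀ i, C i ⊆ U) (hCc : ∀ i, (C i).card = m)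
    (hCd : ∀ i j, i ≠ j → Disjoint (C i) (C j)) (hdeg : ∀ b v i, d ≤ (dg (dr D b) v (C i) : ℝ)) :
    ∃ (ι : Type) (_ : Fintype ι) (s e : ι → V) (Z : ι → Finset V),
      (∀ i, Pth D (s i) (e i) (Z i)) ∧ (∀ i j, i ≠ j → Disjoint (Z i) (Z j)) ∧
      (∀ v, v ∈ U ↔ ∃ i, v ∈ Z i) ∧ Fintype.card ι ≤ m + K := by
  classical
  have hφ : ∀ i : ℕ, ∃ φ : V → V, ∀ hi : i + 1 < K,
      (∀ a ∈ C ⟨i, by omega⟩, φ a ∈ C ⟨i + 1, hi⟩ ∧ D a (φ a) = true) ∧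
      ∀ a ∈ C ⟨i, by omega⟩, ∀ a' ∈ C ⟨i, by omega⟩, φ a = φ a' → a = a' := by
    intro i
    by_cases hi : i + 1 < K
    · obtain ⟨φ, h1, h2⟩ := matching hE hg hq hgd hqd (A := C ⟨i, by omega⟩) (B := C ⟨i + 1, hi⟩)
        (hCd _ _ (by simp)) (hCc _) (hCc _) (fun v _ => hdeg _ _ _) (fun v _ => hdeg _ _ _)
      exact ⟨φ, fun _ => ⟨h1, h2⟩⟩
    · exact ⟨id, fun h => absurd h hi⟩
  choose φ hφ using hφ
  let C0 := C ⟨0, by omega⟩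
  let p : V → ℕ → V := fun v i => Nat.rec v (fun i x => φ i x) i
  have p0 : ∀ v, p v 0 = v := fun v => rfl
  have pS : ∀ v i, p v (i + 1) = φ i (p v i) := fun v i => rfl
  have pmem : ∀ v ∈ C0, ∀ i, ∀ hi : i < K, p v i ∈ C ⟨i, hi⟩ := by
    intro v hv i
    induction i with
    | zero => intro hi; exact hv
    | succ i ih =>
      intro hi
      rw [pS]
      exact ((hφ i hi).1 _ (ih (by omega))).1
  have pinj : ∀ v ∈ C0, ∀ v' ∈ C0, ∀ i < K, p v i = p v' i → v = v' := by
    intro v hv v' hv' i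
    induction i with
    | zero => intro _ h; exact h
    | succ i ih =>
      intro hi h
      rw [pS, pS] at h
      exact ih (by omega) ((hφ i hi).2 _ (pmem v hv i (by omega)) _ (pmem v' hv' i (by omega)) h)
  have pinj2 : ∀ v ∈ C0, ∀ v' ∈ C0, ∀ i < K, ∀ j < K, p v i = p v' j → v = v' ∧ i = j := by
    intro v hv v' hv' i hi j hj h
    have hij : i = j := by
      by_contra hne
      refine Finset.disjoint_left.1 (hCd ⟨i, hi⟩ ⟨j, hj⟩ (by simpa using hne)) (pmem v hv i hi) ?_
      rw [h]
      exact pmem v' hv' j hj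
    subst hij
    exact ⟨pinj v hv v' hv' i hi h, rfl⟩
  have psurj : ∀ i, ∀ hi : i < K, ∀ w ∈ C ⟨i, hi⟩, ∃ v ∈ C0, p v i = w := by
    intro i hi w hw
    have : C0.image (fun v => p v i) = C ⟨i, hi⟩ := by
      refine Finset.eq_of_subset_of_card_le ?_ ?_
      · intro x hx
        rw [Finset.mem_image] at hx
        obtain ⟨v, hv, rfl⟩ := hx
        exact pmem v hv i hi
      · rw [Finset.card_image_of_injOn (fun v hv v' hv' h => pinj v hv v' hv' i hi h), hCc, hCc]
    rw [← this, Finset.mem_image] at hw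
    exact hw
  let L := U \ Finset.univ.biUnion C
  have hL : L.card ≤ K := by
    have h1 : (Finset.univ.biUnion C).card = K * m := by
      rw [Finset.card_biUnion (fun i _ j _ h => hCd i j h)]
      simp [hCc]
    rw [Finset.card_sdiff_of_subset (by
      intro x hx
      simp only [Finset.mem_biUnion, Finset.mem_univ, true_and] at hx
      obtain ⟨i, hi⟩ := hx
      exact hCU i hi), h1]
    omega
  refine ⟨C0 ⊕ L, inferInstance, Sum.elim (fun v => v) (fun v => v),
    Sum.elim (fun v => p v (K - 1)) (fun v => v),
    Sum.elim (fun v => (Finset.range K).image (p v)) (fun v => {(v : V)}), ?_, ?_, ?_, ?_⟩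
  · rintro (v | v)
    · exact Pth.ofSeq (p v) K hK (fun j hj => by
        rw [pS]
        exact ((hφ j hj).1 _ (pmem v v.2 j (by omega))).2)
        (fun i hi j hj h => (pinj2 v v.2 v v.2 i hi j hj h).2)
    · exact Pth.single D v
  · have hLC : ∀ v ∈ C0, ∀ w ∈ L, ∀ i < K, p v i ≠ w := by
      intro v hv w hw i hi h
      have := (Finset.mem_sdiff.1 hw).2
      apply this
      rw [Finset.mem_biUnion]
      exact ⟨⟨i, hi⟩, Finset.mem_univ _, h ▸ pmem v hv i hi⟩
    rintro (v | v) (w | w) hne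
    · rw [Finset.disjoint_left]
      intro x hx hx'
      simp only [Sum.elim_inl, Finset.mem_image, Finset.mem_range] at hx hx'
      obtain ⟨i, hi, rfl⟩ := hx
      obtain ⟨j, hj, h⟩ := hx'
      have := (pinj2 w w.2 v v.2 j hj i hi h).1
      exact hne (congrArg Sum.inl (Subtype.ext this.symm))
    · simp only [Sum.elim_inl, Sum.elim_inr, Finset.disjoint_singleton_right, Finset.mem_image,
        Finset.mem_range, not_exists, not_and]
      exact fun i hi h => hLC v v.2 w w.2 i hi h
    · simp only [Sum.elim_inl, Sum.elim_inr, Finset.disjoint_singleton_left, Finset.mem_image,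
        Finset.mem_range, not_exists, not_and]
      exact fun i hi h => hLC w w.2 v v.2 i hi h
    · simp only [Sum.elim_inr, Finset.disjoint_singleton]
      intro h
      exact hne (congrArg Sum.inr (Subtype.ext h))
  · intro v
    constructor
    · intro hv
      by_cases hvC : v ∈ Finset.univ.biUnion C
      · rw [Finset.mem_biUnion] at hvC
        obtain ⟨i, _, hi⟩ := hvC
        obtain ⟨w, hw, h⟩ := psurj i i.2 v hi
        exact ⟨Sum.inl ⟨w, hw⟩, by
          simp only [Sum.elim_inl, Finset.mem_image, Finset.mem_range]
          exact ⟨i, i.2, h⟩⟩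
      · exact ⟨Sum.inr ⟨v, Finset.mem_sdiff.2 ⟨hv, hvC⟩⟩, by simp⟩
    · rintro ⟨w | w, hw⟩
      · simp only [Sum.elim_inl, Finset.mem_image, Finset.mem_range] at hw
        obtain ⟨i, hi, rfl⟩ := hw
        exact hCU _ (pmem w w.2 i hi)
      · simp only [Sum.elim_inr, Finset.mem_singleton] at hw
        rw [hw]
        exact (Finset.mem_sdiff.1 w.2).1
  · rw [Fintype.card_sum, Fintype.card_coe, Fintype.card_coe]
    have : C0.card = m := hCc _
    omega
end HamPf

namespace HamPf
variable {V : Type} [DecidableEq V]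

lemma Pth.mem_start {D : V → V → Bool} {s e : V} {Z : Finset V} (h : Pth D s e Z) : s ∈ Z := by
  obtain ⟨k, f, rfl, -, -, -, rfl⟩ := h
  exact Finset.mem_image_of_mem f (Finset.mem_range.2 (by omega))

lemma Pth.mem_end {D : V → V → Bool} {s e : V} {Z : Finset V} (h : Pth D s e Z) : e ∈ Z := by
  obtain ⟨k, f, -, rfl, -, -, rfl⟩ := h
  exact Finset.mem_image_of_mem f (Finset.mem_range.2 (by omega))

lemma dr_true (D : V → V → Bool) (v w : V) : dr D true v w = D v w := by simp [dr]
lemma dr_false (D : V → V → Bool) (v w : V) : dr D false v w = D w v := by simp [dr]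

lemma absorber_exists [Fintype V] {D : V → V → Bool} {g q d1 d2 d1' d2' : ℝ} {M M' h N : ℕ} (hh : 1 ≤ h)
    (hN : N = 4 * h + 2) (X : Finset V) (hX : X.Nonempty)
    (P : Par D g q d1 d2 M X.card h) (P' : Par D g q d1' d2' M' (X.card * (2 * h + 1)) h)
    (W W' : Fin h × Fin N → Finset V)
    (hdeg : ∀ c k v, d1 ≤ (dg (dr D c) v (W k) : ℝ)) (hcard : ∀ k, (W k).card = M)
    (hdis : ∀ k k', k ≠ k' → Disjoint (W k) (W k'))
    (hdeg' : ∀ c k v, d1' ≤ (dg (dr D c) v (W' k) : ℝ)) (hcard' : ∀ k, (W' k).card = M')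
    (hdis' : ∀ k k', k ≠ k' → Disjoint (W' k) (W' k'))
    (hWW : ∀ k k', Disjoint (W k) (W' k')) (hXW : ∀ k, Disjoint X (W k))
    (hXW' : ∀ k, Disjoint X (W' k)) :
    ∃ (s e : V) (Z : Finset V), (∀ v ∈ Z, (∃ k, v ∈ W k) ∨ ∃ k, v ∈ W' k) ∧
      ∀ I ⊆ X, Pth D s e (Z ∪ I) := by
  classical
  have : Nonempty X := hX.to_subtype
  obtain ⟨f, nx, hnx, hf1, -, hf2, hf3⟩ := cyc_enum X
  have hc1 : Fintype.card X = X.card := Fintype.card_coe X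
  obtain ⟨z, hz, hzinj⟩ := connect (ι := X) (hc1 ▸ P) (fun j => decide (j % 2 = 1)) (by omega) W
    hdeg hcard hdis (fun x => x) (fun x => x) Subtype.val_injective Subtype.val_injective
    (fun x k => Finset.disjoint_left.1 (hXW k) x.2) (fun x k => Finset.disjoint_left.1 (hXW k) x.2)
  have hst : ∀ i j, j < 2 * h + 1 → ∃ c < N, stA h z i j = z i c ∧
      (j = 0 ∧ c = 4 * h + 1 ∨ 1 ≤ j ∧ c = 2 * j - 1) := by
    intro i j hj
    by_cases h0 : j = 0
    · exact ⟨4 * h + 1, by omega, by simp [stA, h0], by omega⟩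
    · exact ⟨2 * j - 1, by omega, by simp [stA, h0], by omega⟩
  have hen : ∀ i j, j < 2 * h + 1 → ∃ i', ∃ c < N, enA h z nx i j = z i' c ∧
      (j < 2 * h ∧ c = 2 * j + 2 ∧ i' = i ∨ j = 2 * h ∧ c = 0 ∧ i' = nx i) := by
    intro i j hj
    by_cases h0 : j < 2 * h
    · exact ⟨i, 2 * j + 2, by omega, by simp [enA, h0], Or.inl ⟨h0, rfl, rfl⟩⟩
    · exact ⟨nx i, 0, by omega, by simp [enA, h0], Or.inr ⟨by omega, rfl, rfl⟩⟩
  have hc2 : Fintype.card (X × Fin (2 * h + 1)) = X.card * (2 * h + 1) := by simp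
  have hzW' : ∀ i c k, c < N → z i c ∉ W' k := by
    intro i c k hc hm
    obtain ⟨k', hk'⟩ := (hz i).1 c hc
    exact Finset.disjoint_left.1 (hWW k' k) hk' hm
  obtain ⟨y, hy, hyinj⟩ := connect (ι := X × Fin (2 * h + 1)) (hc2 ▸ P') (fun j => true) (by omega) W'
    hdeg' hcard' hdis' (fun t => stA h z t.1 t.2) (fun t => enA h z nx t.1 t.2) (by
      rintro ⟨i, j⟩ ⟨i', j'⟩ heq
      simp only at heq
      obtain ⟨c, hc, e1, h1⟩ := hst i j j.2
      obtain ⟨c', hc', e2, h2⟩ := hst i' j' j'.2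
      rw [e1, e2] at heq
      obtain ⟨rfl, h3⟩ := hzinj _ _ _ _ hc hc' heq
      have hj := j.2
      have hj' := j'.2
      have : j = j' := by ext; omega
      rw [this]) (by
      rintro ⟨i, j⟩ ⟨i', j'⟩ heq
      simp only at heq
      obtain ⟨i1, c, hc, e1, h1⟩ := hen i j j.2
      obtain ⟨i2, c', hc', e2, h2⟩ := hen i' j' j'.2
      rw [e1, e2] at heq
      obtain ⟨rfl, h3⟩ := hzinj _ _ _ _ hc hc' heq
      have hj : j = j' := by ext; omega
      subst hj
      rcases h1 with ⟨h1, -, h5⟩ | ⟨h1, -, h5⟩ <;> rcases h2 with ⟨h2, -, h6⟩ | ⟨h2, -, h6⟩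
      · rw [← h5, ← h6]
      · omega
      · omega
      · rw [hnx (h5.symm.trans h6)]) (by
      rintro ⟨i, j⟩ k
      obtain ⟨c, hc, e1, h1⟩ := hst i j j.2
      simp only [e1]
      exact hzW' _ _ _ hc) (by
      rintro ⟨i, j⟩ k
      obtain ⟨i', c, hc, e1, h1⟩ := hen i j j.2
      simp only [e1]
      exact hzW' _ _ _ hc)
  have hofN : ∀ j, j < 2 * h + 1 → ((Fin.ofNat (2 * h + 1) j : Fin (2 * h + 1)) : ℕ) = j := by
    intro j hj
    simp [Fin.ofNat, Nat.mod_eq_of_lt hj]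
  simp only [dr_true] at hy
  obtain ⟨s, e, Z, hZ, -, -, hP⟩ := absorbing (D := D) hh (show 1 ≤ N by omega) f nx hf1 hf2 hf3
    (fun x : X => (x : V)) z
    (fun i j k => y (i, Fin.ofNat _ j) k) Subtype.val_injective
    (fun i i' j j' hj hj' heq => hzinj i i' j j' (by omega) (by omega) heq)
    (by
      intro i i' j j' k k' hj hj' hk hk' heq
      obtain ⟨h1, h2⟩ := hyinj _ _ _ _ hk hk' heq
      simp only [Prod.mk.injEq] at h1
      have h3 := congrArg Fin.val h1.2
      rw [hofN j hj, hofN j' hj'] at h3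
      exact ⟨h1.1, h3, h2⟩)
    (by
      intro i i' j j' k hj hj' hk heq
      obtain ⟨k', hk'⟩ := (hy (i', Fin.ofNat _ j')).1 k hk
      exact hzW' i j k' (by omega) (heq ▸ hk'))
    (by
      intro i i' j hj heq
      obtain ⟨k', hk'⟩ := (hz i').1 j (by omega)
      exact Finset.disjoint_left.1 (hXW k') i.2 (heq ▸ hk'))
    (by
      intro i i' j k hj hk heq
      obtain ⟨k', hk'⟩ := (hy (i', Fin.ofNat _ j)).1 k hk
      exact Finset.disjoint_left.1 (hXW' k') i.2 (heq ▸ hk'))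
    (by
      intro i
      have := (hz i).2.1
      simpa [dr] using this)
    (by
      intro i
      have := (hz i).2.2.2
      rw [show N - 1 = 4 * h + 1 by omega, show decide (N % 2 = 1) = false by
        rw [decide_eq_false_iff_not]; omega, dr_false] at this
      exact this)
    (by
      intro i j hj
      have := (hz i).2.2.1 (2 * j) (by omega)
      rw [show decide ((2 * j + 1) % 2 = 1) = true by
        rw [decide_eq_true_iff]; omega, dr_true] at this
      exact this)
    (by
      intro i j hj
      have := (hz i).2.2.1 (2 * j + 1) (by omega)
      rw [show decide ((2 * j + 1 + 1) % 2 = 1) = false by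
        rw [decide_eq_false_iff_not]; omega, dr_false] at this
      exact this)
    (by
      intro i j hj
      have := (hy (i, Fin.ofNat _ j)).2.1
      simp only [hofN j hj] at this
      exact this)
    (by
      intro i j hj k hk
      exact (hy (i, Fin.ofNat _ j)).2.2.1 k hk)
    (by
      intro i j hj
      have := (hy (i, Fin.ofNat _ j)).2.2.2
      simp only [hofN j hj] at this
      exact this)
  refine ⟨s, e, Z, ?_, ?_⟩
  · intro v hv
    rcases hZ v hv with ⟨i, j, hj, rfl⟩ | ⟨i, j, hj, k, hk, rfl⟩
    · exact Or.inl ((hz i).1 j (by omega))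
    · exact Or.inr ((hy _).1 k hk)
  · intro I hI
    have := hP (I.subtype (· ∈ X))
    have h2 : (I.subtype (· ∈ X)).image (fun x : X => (x : V)) = I := by
      ext v
      simp only [Finset.mem_image, Finset.mem_subtype, Subtype.exists, exists_and_left, exists_prop]
      constructor
      · rintro ⟨w, hw, _, rfl⟩
        exact hw
      · intro hv
        exact ⟨v, hv, hI hv, rfl⟩
    rw [h2] at this
    exact this

lemma finish [Fintype V] {D : V → V → Bool} {g q d1 d2 : ℝ} {M h N : ℕ} (hh : 1 ≤ h)
    (hN : N = 4 * h + 2) {ι : Type} [Fintype ι]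
    (P : Par D g q d1 d2 M (Fintype.card ι + 1) h)
    (W : Fin h × Fin N → Finset V) (X : Finset V) (hXW : ∀ v, v ∈ X ↔ ∃ k, v ∈ W k)
    (hdeg : ∀ c k v, d1 ≤ (dg (dr D c) v (W k) : ℝ)) (hcard : ∀ k, (W k).card = M)
    (hdis : ∀ k k', k ≠ k' → Disjoint (W k) (W k'))
    (s0 e0 : V) (Z0 : Finset V) (hXZ0 : Disjoint X Z0) (habs : ∀ I ⊆ X, Pth D s0 e0 (Z0 ∪ I))
    (s e : ι → V) (Z : ι → Finset V) (hZ : ∀ i, Pth D (s i) (e i) (Z i))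
    (hZd : ∀ i j, i ≠ j → Disjoint (Z i) (Z j))
    (hcov : ∀ v, v ∈ Finset.univ \ (X ∪ Z0) ↔ ∃ i, v ∈ Z i) :
    ∃ s' e', Pth D s' e' (Finset.univ : Finset V) ∧ D e' s' = true := by
  classical
  let s1 : Option ι → V := fun o => o.elim s0 s
  let e1 : Option ι → V := fun o => o.elim e0 e
  let Z1 : Option ι → Finset V := fun o => o.elim Z0 Z
  have hZX : ∀ i v, v ∈ Z1 i → v ∉ X := by
    rintro (_ | i) v hv hvX
    · exact Finset.disjoint_left.1 hXZ0 hvX hv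
    · have := (hcov v).2 ⟨i, hv⟩
      simp only [Finset.mem_sdiff, Finset.mem_univ, Finset.mem_union, true_and, not_or] at this
      exact this.1 hvX
  have hZ1d : ∀ i j, i ≠ j → Disjoint (Z1 i) (Z1 j) := by
    have hn : ∀ i, Disjoint Z0 (Z i) := by
      intro i
      rw [Finset.disjoint_left]
      intro v hv hvi
      have := (hcov v).2 ⟨i, hvi⟩
      simp only [Finset.mem_sdiff, Finset.mem_univ, Finset.mem_union, true_and, not_or] at this
      exact this.2 hv
    rintro (_ | i) (_ | j) hne
    · exact absurd rfl hne
    · exact hn j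
    · exact (hn i).symm
    · exact hZd i j (fun h => hne (by rw [h]))
  have hP0 : Pth D s0 e0 Z0 := by simpa using habs ∅ (by simp)
  have hZ1 : ∀ i, Pth D (s1 i) (e1 i) (Z1 i) := by
    rintro (_ | i)
    · exact hP0
    · exact hZ i
  obtain ⟨f, nx, hnx, hf1, hfc, hf2, hf3⟩ := cyc_enum (Option ι)
  have hc1 : Fintype.card (Option ι) = Fintype.card ι + 1 := Fintype.card_option
  have s1inj : Function.Injective s1 := by
    intro i j h
    by_contra hne
    refine Finset.disjoint_left.1 (hZ1d i j hne) (hZ1 i).mem_start ?_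
    rw [h]
    exact (hZ1 j).mem_start
  have e1inj : Function.Injective e1 := by
    intro i j h
    by_contra hne
    refine Finset.disjoint_left.1 (hZ1d i j hne) (hZ1 i).mem_end ?_
    rw [h]
    exact (hZ1 j).mem_end
  obtain ⟨z, hz, hzinj⟩ := connect (ι := Option ι) (hc1 ▸ P) (fun j => true) (by omega) W
    hdeg hcard hdis e1 (fun i => s1 (nx i)) e1inj (s1inj.comp hnx)
    (fun i k hm => hZX i _ (hZ1 i).mem_end ((hXW _).2 ⟨k, hm⟩))
    (fun i k hm => hZX _ _ (hZ1 (nx i)).mem_start ((hXW _).2 ⟨k, hm⟩))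
  simp only [dr_true] at hz
  have hzX : ∀ i j, j < N → z i j ∈ X := fun i j hj => (hXW _).2 ((hz i).1 j hj)
  let Q : Option ι → Finset V := fun i => (Finset.range N).image (z i)
  have hQX : ∀ i v, v ∈ Q i → v ∈ X := by
    intro i v hv
    obtain ⟨j, hj, rfl⟩ := Finset.mem_image.1 hv
    exact hzX i j (Finset.mem_range.1 hj)
  let I : Finset V := X.filter fun v => ∀ i, v ∉ Q i
  let Z2 : Option ι → Finset V := fun o => o.elim (Z0 ∪ I) Z
  have hZ2 : ∀ i, Pth D (s1 i) (e1 i) (Z2 i) := by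
    rintro (_ | i)
    · exact habs I (Finset.filter_subset _ _)
    · exact hZ i
  have hZ2m : ∀ i v, v ∈ Z2 i → v ∈ Z1 i ∨ (i = none ∧ v ∈ I) := by
    rintro (_ | i) v hv
    · rcases Finset.mem_union.1 hv with h | h
      · exact Or.inl h
      · exact Or.inr ⟨rfl, h⟩
    · exact Or.inl hv
  have hQ : ∀ i, Pth D (z i 0) (z i (N - 1)) (Q i) := fun i =>
    Pth.ofSeq _ N (by omega) (hz i).2.2.1 (fun k hk k' hk' heq => (hzinj i i k k' hk hk' heq).2)
  have hZ2Q : ∀ i j, Disjoint (Z2 i) (Q j) := by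
    intro i j
    rw [Finset.disjoint_left]
    intro v hv hvQ
    rcases hZ2m i v hv with h | ⟨_, h⟩
    · exact hZX i v h (hQX j v hvQ)
    · exact (Finset.mem_filter.1 h).2 j hvQ
  have hZ2Z2 : ∀ i j, i ≠ j → Disjoint (Z2 i) (Z2 j) := by
    intro i j hij
    rw [Finset.disjoint_left]
    intro v hv hv'
    rcases hZ2m i v hv with h | ⟨h0, h⟩ <;> rcases hZ2m j v hv' with h' | ⟨h0', h'⟩
    · exact Finset.disjoint_left.1 (hZ1d i j hij) h h'
    · exact hZX i v h (Finset.mem_filter.1 h').1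
    · exact hZX j v h' (Finset.mem_filter.1 h).1
    · exact hij (h0.trans h0'.symm)
  have hQQ : ∀ i j, i ≠ j → Disjoint (Q i) (Q j) := by
    intro i j hij
    rw [Finset.disjoint_left]
    intro v hv hv'
    obtain ⟨k, hk, rfl⟩ := Finset.mem_image.1 hv
    obtain ⟨k', hk', h⟩ := Finset.mem_image.1 hv'
    exact hij (hzinj _ _ _ _ (Finset.mem_range.1 hk') (Finset.mem_range.1 hk) h).1.symm
  have hR : ∀ i, Pth D (s1 i) (z i (N - 1)) (Z2 i ∪ Q i) := fun i =>
    (hZ2 i).append (hQ i) (hz i).2.1 (hZ2Q i i)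
  set T := Fintype.card ι with hT
  have hch := Pth.chain (D := D) (fun t => s1 (f t)) (fun t => z (f t) (N - 1))
    (fun t => Z2 (f t) ∪ Q (f t)) T (fun t _ => hR (f t))
    (fun t _ => by
      have := (hz (f t)).2.2.2
      rw [hf1] at this
      exact this)
    (fun t ht t' ht' hne => by
      have : f t ≠ f t' := fun h => hne (hf2 t (by omega) t' (by omega) h)
      rw [Finset.disjoint_union_left, Finset.disjoint_union_right, Finset.disjoint_union_right]
      exact ⟨⟨hZ2Z2 _ _ this, hZ2Q _ _⟩, (hZ2Q _ _).symm, hQQ _ _ this⟩)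
  have huniv : (Finset.range (T + 1)).biUnion (fun t => Z2 (f t) ∪ Q (f t)) = Finset.univ := by
    rw [Finset.eq_univ_iff_forall]
    intro v
    rw [Finset.mem_biUnion]
    have : ∃ i, v ∈ Z2 i ∪ Q i := by
      by_cases hvX : v ∈ X
      · by_cases hvQ : ∃ i, v ∈ Q i
        · obtain ⟨i, hi⟩ := hvQ
          exact ⟨i, Finset.mem_union_right _ hi⟩
        · push Not at hvQ
          refine ⟨none, Finset.mem_union_left _ ?_⟩
          exact Finset.mem_union_right _ (Finset.mem_filter.2 ⟨hvX, hvQ⟩)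
      · by_cases hv0 : v ∈ Z0
        · exact ⟨none, Finset.mem_union_left _ (Finset.mem_union_left _ hv0)⟩
        · obtain ⟨i, hi⟩ := (hcov v).1 (by simp [hvX, hv0])
          exact ⟨some i, Finset.mem_union_left _ hi⟩
    obtain ⟨i, hi⟩ := this
    obtain ⟨t, ht, rfl⟩ := hf3 i
    exact ⟨t, Finset.mem_range.2 (by omega), hi⟩
  rw [huniv] at hch
  refine ⟨_, _, hch, ?_⟩
  have := (hz (f T)).2.2.2
  rw [hf1, ← hc1, hfc] at this
  exact this

lemma ham_of_pth {n : ℕ} {D : Fin n → Fin n → Bool} {s e : Fin n} (h : Pth D s e Finset.univ)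
    (hes : D e s = true) :
    ∃ e : Equiv.Perm (Fin n), ∀ i : Fin n, D (e i) (e (finRotate n i)) = true := by
  obtain ⟨k, f, rfl, rfl, finj, farc, fim⟩ := h
  have hk : n = k + 1 := by
    have h1 := congrArg Finset.card fim
    rw [Finset.card_image_of_injOn (by
      intro i hi j hj h
      simp only [Finset.coe_range, Set.mem_Iio] at hi hj
      exact finj i (by omega) j (by omega) h)] at h1
    simpa using h1.symm
  subst hk
  have hinj : Function.Injective (fun i : Fin (k + 1) => f i) := by
    intro i j h
    exact Fin.ext (finj i (by omega) j (by omega) h)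
  refine ⟨Equiv.ofBijective _ (Finite.injective_iff_bijective.1 hinj), ?_⟩
  intro i
  simp only [Equiv.ofBijective_apply]
  by_cases hi : (i : ℕ) < k
  · rw [finRotate_of_lt hi]
    exact farc i hi
  · have : i = Fin.last k := by ext; simp; omega
    rw [this, finRotate_last]
    simpa using hes
end HamPf

namespace HamPf
variable {V : Type} [DecidableEq V]

lemma dg_biUnion {γ : Type} [DecidableEq γ] (R : V → V → Bool) (v : V) (S : Finset γ) (C : γ → Finset V)
    (hC : ∀ i j, i ≠ j → Disjoint (C i) (C j)) {δ : ℝ} (hδ : ∀ i, δ ≤ (dg R v (C i) : ℝ)) :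
    S.card * δ ≤ (dg R v (S.biUnion C) : ℝ) := by
  have h1 : dg R v (S.biUnion C) = ∑ i ∈ S, dg R v (C i) := by
    unfold dg
    rw [Finset.filter_biUnion, Finset.card_biUnion]
    intro i _ j _ hij
    exact Finset.disjoint_of_subset_left (Finset.filter_subset _ _)
      (Finset.disjoint_of_subset_right (Finset.filter_subset _ _) (hC i j hij))
  rw [h1]
  push_cast
  rw [← nsmul_eq_mul]
  exact Finset.card_nsmul_le_sum _ _ _ fun i _ => hδ i

lemma layers {K c m : ℕ} {κ : Type} (D : V → V → Bool) (Cl : Fin K → Finset V)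
    (hcard : ∀ i, (Cl i).card = m) (hdis : ∀ i j, i ≠ j → Disjoint (Cl i) (Cl j)) {δ : ℝ}
    (hδ : ∀ b v i, δ ≤ (dg (dr D b) v (Cl i) : ℝ)) (φ : κ × Fin c → Fin K)
    (hφ : Function.Injective φ) :
    (∀ b k v, c * δ ≤ (dg (dr D b) v (Finset.univ.biUnion fun t : Fin c => Cl (φ (k, t))) : ℝ)) ∧
    (∀ k, (Finset.univ.biUnion fun t : Fin c => Cl (φ (k, t))).card = c * m) ∧
    (∀ k k', k ≠ k' → Disjoint (Finset.univ.biUnion fun t : Fin c => Cl (φ (k, t)))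
      (Finset.univ.biUnion fun t : Fin c => Cl (φ (k', t)))) := by
  have hd : ∀ k, ∀ i j : Fin c, i ≠ j → Disjoint (Cl (φ (k, i))) (Cl (φ (k, j))) := by
    intro k i j hij
    refine hdis _ _ fun h => hij ?_
    have := hφ h
    simpa using this
  refine ⟨?_, ?_, ?_⟩
  · intro b k v
    have := dg_biUnion (dr D b) v Finset.univ (fun t : Fin c => Cl (φ (k, t))) (hd k)
      (fun i => hδ b v _)
    simpa using this
  · intro k
    rw [Finset.card_biUnion (fun i _ j _ h => hd k i j h)]
    simp [hcard]
  · intro k k' hk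
    simp only [Finset.disjoint_biUnion_left, Finset.disjoint_biUnion_right]
    intro i _ j _
    refine hdis _ _ fun h => hk ?_
    have := hφ h
    simp only [Prod.mk.injEq] at this
    exact this.1

lemma mkPar [Fintype V] {D : V → V → Bool} {g α p : ℝ} {h m C s c0 : ℕ}
    (hE : ∀ b, ExpP (dr D b) g ((1 + α / 2) * p)) (hg : 0 < g) (hα : 0 < α) (hp : 0 < p)
    (hc0 : 2 ≤ c0) (hc0' : 1 + α / 2 < α / 2 * c0) (hm : 1 ≤ m) (hC : 1 ≤ C)
    (hs : c0 * s ≤ C * m) (h4 : 4 * g ≤ α / 2 * (m * p)) (hh : Fintype.card V < 2 ^ h) :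
    Par D g ((1 + α / 2) * p) (C * ((1 / 2 + α) * (m * p))) (C * (α / 2 * (m * p))) (C * m) s h := by
  have hm' : (1:ℝ) ≤ m := by exact_mod_cast hm
  have hC' : (1:ℝ) ≤ C := by exact_mod_cast hC
  have hs' : (c0:ℝ) * s ≤ C * m := by exact_mod_cast hs
  have hmp : 0 < m * p := by positivity
  have hMp : 0 < (C:ℝ) * (m * p) := by positivity
  refine ⟨hE, hg, by positivity, ?_, ?_, ?_, ?_, ?_, hh⟩
  · nlinarith
  · have : 1 * (α / 2 * (m * p)) ≤ C * (α / 2 * (m * p)) :=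
      mul_le_mul_of_nonneg_right hC' (by positivity)
    linarith
  · nlinarith
  · by_cases h0 : s = 0
    · subst h0
      simp only [Nat.cast_zero, mul_zero]
      positivity
    · have h1 : (0:ℝ) < s := by exact_mod_cast Nat.pos_of_ne_zero h0
      have h2 : (1 + α / 2) * (s * p) < α / 2 * c0 * (s * p) :=
        mul_lt_mul_of_pos_right hc0' (by positivity)
      have h3 : (α / 2 * p) * (c0 * s) ≤ (α / 2 * p) * (C * m) :=
        mul_le_mul_of_nonneg_left hs' (by positivity)
      linarith
  · push_cast
    nlinarith [mul_pos hα hMp]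

set_option maxHeartbeats 4000000 in
lemma main_det [Fintype V] {D : V → V → Bool} {g α p ε : ℝ} {n h N m c0 C1 C3 Kr Rs K : ℕ}
    (hnV : n = Fintype.card V)
    (hE : ∀ b, ExpP (dr D b) g ((1 + α / 2) * p)) (hg : 0 < g) (hα : 0 < α) (hp : 0 < p)
    (hdeg : ∀ b v, (1 / 2 + 2 * α) * (n * p) ≤ (dg (dr D b) v Finset.univ : ℝ))
    (hh1 : 1 ≤ h) (hh : n < 2 ^ h) (hN : N = 4 * h + 2)
    (hc0 : 2 ≤ c0) (hc0' : 1 + α / 2 < α / 2 * c0) (hC1 : C1 = 2 * c0)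
    (hC3 : C3 = c0 * (h * N * C1) * (2 * h + 1))
    (hRs : Rs = h * N * C1 + 2 * (h * N * C3)) (hKr : Rs * (2 + 6 * α) ≤ α * Kr)
    (hK : K = Rs + Kr) (hε : ε = α / (6 + 8 * α)) (hKε : (K:ℝ) ≤ ε * (n * p)) (hm : m = n / K)
    (hmK : K + 1 ≤ m) (h4 : 4 * g ≤ α / 2 * (m * p))
    (hch : (2 * n * K : ℝ) * Real.exp (-(ε ^ 2 * ((n * p / 4) / K) / 2)) < 1) :
    ∃ s' e', Pth D s' e' (Finset.univ : Finset V) ∧ D e' s' = true := by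
  classical
  have hN1 : 1 ≤ N := by omega
  have hC1' : 1 ≤ C1 := by omega
  have hK1 : 1 ≤ h * N * C1 := Nat.mul_pos (Nat.mul_pos hh1 hN1) hC1'
  have hC3' : 1 ≤ C3 := by
    rw [hC3]
    exact Nat.mul_pos (Nat.mul_pos (by omega) hK1) (by omega)
  have hKpos : 1 ≤ K := by omega
  have hm1 : 1 ≤ m := by omega
  have hK0 : (0:ℝ) < K := by exact_mod_cast hKpos
  have hn0 : (0:ℝ) < n := by
    have : 0 < n := by
      rcases Nat.eq_zero_or_pos n with h0 | h0
      · rw [h0, Nat.zero_div] at hm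
        omega
      · exact h0
    exact_mod_cast this
  have hnp : 0 < n * p := by positivity
  have hε0 : 0 < ε := by rw [hε]; positivity
  have hεeq : ε * (6 + 8 * α) = α := by rw [hε]; field_simp
  have hε8 : ε ≤ 1 / 8 := by
    rw [hε, div_le_iff₀ (by positivity)]
    linarith
  have hmn : (m:ℝ) * p ≤ n * p / K := by
    have h1 : (m:ℝ) ≤ n / K := by rw [hm]; exact Nat.cast_div_le
    have := mul_le_mul_of_nonneg_right h1 hp.le
    calc (m:ℝ) * p ≤ n / K * p := this
      _ = n * p / K := by ring
  set A := n * p / K with hA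
  have hA0 : 0 < A := by positivity
  have hAK : A * K = n * p := by rw [hA]; field_simp
  have hεA : 1 ≤ ε * A := by
    have : (K:ℝ) * 1 ≤ K * (ε * A) := by nlinarith
    exact le_of_mul_le_mul_left this hK0
  have hmp0 : 0 < (m:ℝ) * p := by
    have : (1:ℝ) ≤ m := by exact_mod_cast hm1
    positivity
  -- general computation for the two partitions
  have hpart : ∀ d : ℝ, 1 / 2 * (n * p) ≤ d → (K:ℝ) ≤ d ∧
      (2 * Fintype.card V * K : ℝ) * Real.exp (-(ε ^ 2 * ((d - K) / K) / 2)) < 1 := by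
    intro d hd
    have h1 : (K:ℝ) ≤ n * p / 4 := by nlinarith
    refine ⟨by linarith, lt_of_le_of_lt ?_ hch⟩
    rw [← hnV]
    refine mul_le_mul_of_nonneg_left (Real.exp_le_exp.2 ?_) (by positivity)
    have h2 : n * p / 4 / K ≤ (d - K) / K := div_le_div_of_nonneg_right (by linarith) hK0.le
    have h3 := mul_le_mul_of_nonneg_left h2 (sq_nonneg ε)
    linarith
  -- stage one
  obtain ⟨hp1, hp2⟩ := hpart ((1 / 2 + 2 * α) * (n * p)) (by nlinarith)
  obtain ⟨Cl, -, hClc, hCld, hCldeg⟩ := partition D Finset.univ hKpos hε0 (by linarith) hp1 hdeg hp2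
  rw [Finset.card_univ, ← hnV, ← hm] at hClc
  have hCl1 : ∀ b v i, (1 / 2 + 7 / 4 * α) * A ≤ (dg (dr D b) v (Cl i) : ℝ) := by
    intro b v i
    refine le_trans ?_ (hCldeg b v i)
    have h1 : ((1 / 2 + 2 * α) * (n * p) - K) / K = (1 / 2 + 2 * α) * A - 1 := by
      rw [hA]; field_simp
    rw [h1]
    nlinarith
  have hCl2 : ∀ b v i, (1 / 2 + α) * (m * p) ≤ (dg (dr D b) v (Cl i) : ℝ) := by
    intro b v i
    refine le_trans ?_ (hCl1 b v i)
    nlinarith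
  have huniq : ∀ i j v, v ∈ Cl i → v ∈ Cl j → i = j := by
    intro i j v h1 h2
    by_contra hne
    exact Finset.disjoint_left.1 (hCld i j hne) h1 h2
  -- index equivalence
  have hcardι : Fintype.card (((Fin h × Fin N) × Fin C1) ⊕ (((Fin h × Fin N) × Fin C3) ⊕
      (((Fin h × Fin N) × Fin C3) ⊕ Fin Kr))) = K := by
    simp only [Fintype.card_sum, Fintype.card_prod, Fintype.card_fin]
    rw [hK, hRs]
    ring
  let E := Fintype.equivFinOfCardEq hcardι
  let φ1 : (Fin h × Fin N) × Fin C1 → Fin K := fun t => E (Sum.inl t)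
  let φ2 : (Fin h × Fin N) × Fin C3 → Fin K := fun t => E (Sum.inr (Sum.inl t))
  let φ3 : (Fin h × Fin N) × Fin C3 → Fin K := fun t => E (Sum.inr (Sum.inr (Sum.inl t)))
  let φ4 : Fin Kr → Fin K := fun t => E (Sum.inr (Sum.inr (Sum.inr t)))
  have hφ1 : Function.Injective φ1 := by
    intro a b hab
    simpa [φ1] using hab
  have hφ2 : Function.Injective φ2 := by
    intro a b hab
    simpa [φ2] using hab
  have hφ3 : Function.Injective φ3 := by
    intro a b hab
    simpa [φ3] using hab
  have hφ4 : Function.Injective φ4 := by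
    intro a b hab
    simpa [φ4] using hab
  have h12 : ∀ a b, φ1 a ≠ φ2 b := by intro a b; simp [φ1, φ2]
  have h13 : ∀ a b, φ1 a ≠ φ3 b := by intro a b; simp [φ1, φ3]
  have h14 : ∀ a b, φ1 a ≠ φ4 b := by intro a b; simp [φ1, φ4]
  have h23 : ∀ a b, φ2 a ≠ φ3 b := by intro a b; simp [φ2, φ3]
  have h24 : ∀ a b, φ2 a ≠ φ4 b := by intro a b; simp [φ2, φ4]
  have h34 : ∀ a b, φ3 a ≠ φ4 b := by intro a b; simp [φ3, φ4]
  let W1 : Fin h × Fin N → Finset V := fun k => Finset.univ.biUnion fun t : Fin C1 => Cl (φ1 (k, t))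
  let W2 : Fin h × Fin N → Finset V := fun k => Finset.univ.biUnion fun t : Fin C3 => Cl (φ2 (k, t))
  let W3 : Fin h × Fin N → Finset V := fun k => Finset.univ.biUnion fun t : Fin C3 => Cl (φ3 (k, t))
  obtain ⟨W1a, W1b, W1c⟩ := layers D Cl hClc hCld hCl2 φ1 hφ1
  obtain ⟨W2a, W2b, W2c⟩ := layers D Cl hClc hCld hCl2 φ2 hφ2
  obtain ⟨W3a, W3b, W3c⟩ := layers D Cl hClc hCld hCl2 φ3 hφ3
  have W1m : ∀ k v, v ∈ W1 k → ∃ a, v ∈ Cl (φ1 a) := by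
    intro k v hv
    simp only [W1, Finset.mem_biUnion, Finset.mem_univ, true_and] at hv
    obtain ⟨t, ht⟩ := hv
    exact ⟨_, ht⟩
  have W2m : ∀ k v, v ∈ W2 k → ∃ a, v ∈ Cl (φ2 a) := by
    intro k v hv
    simp only [W2, Finset.mem_biUnion, Finset.mem_univ, true_and] at hv
    obtain ⟨t, ht⟩ := hv
    exact ⟨_, ht⟩
  have W3m : ∀ k v, v ∈ W3 k → ∃ a, v ∈ Cl (φ3 a) := by
    intro k v hv
    simp only [W3, Finset.mem_biUnion, Finset.mem_univ, true_and] at hv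
    obtain ⟨t, ht⟩ := hv
    exact ⟨_, ht⟩
  let X : Finset V := Finset.univ.biUnion W1
  have hXm : ∀ v, v ∈ X ↔ ∃ k, v ∈ W1 k := by
    intro v
    simp only [X, Finset.mem_biUnion, Finset.mem_univ, true_and]
  have hXc : X.card = h * N * C1 * m := by
    have : X.card = ∑ k, (W1 k).card := Finset.card_biUnion (fun i _ j _ hij => W1c i j hij)
    rw [this, Finset.sum_congr rfl (fun k _ => W1b k)]
    simp
    ring
  have hXn : X.Nonempty := by
    rw [← Finset.card_pos, hXc]
    exact Nat.mul_pos hK1 hm1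
  have hP2 : Par D g ((1 + α / 2) * p) (C3 * ((1 / 2 + α) * (m * p))) (C3 * (α / 2 * (m * p)))
      (C3 * m) X.card h := by
    refine mkPar hE hg hα hp hc0 hc0' hm1 hC3' ?_ h4 (hnV ▸ hh)
    rw [hXc, hC3]
    have : 1 ≤ 2 * h + 1 := by omega
    calc c0 * (h * N * C1 * m) = c0 * (h * N * C1) * 1 * m := by ring
      _ ≤ c0 * (h * N * C1) * (2 * h + 1) * m := by gcongr
  have hP3 : Par D g ((1 + α / 2) * p) (C3 * ((1 / 2 + α) * (m * p))) (C3 * (α / 2 * (m * p)))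
      (C3 * m) (X.card * (2 * h + 1)) h := by
    refine mkPar hE hg hα hp hc0 hc0' hm1 hC3' ?_ h4 (hnV ▸ hh)
    rw [hXc, hC3]
    apply le_of_eq
    ring
  obtain ⟨s0, e0, Z0, hZ0, habs⟩ := absorber_exists hh1 hN X hXn hP2 hP3 W2 W3
    (fun c k v => W2a c k v) W2b W2c (fun c k v => W3a c k v) W3b W3c
    (by
      intro k k'
      rw [Finset.disjoint_left]
      intro v hv hv'
      obtain ⟨a, ha⟩ := W2m k v hv
      obtain ⟨b, hb⟩ := W3m k' v hv'
      exact h23 a b (huniq _ _ v ha hb))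
    (by
      intro k'
      rw [Finset.disjoint_left]
      intro v hv hv'
      obtain ⟨k, hk⟩ := (hXm v).1 hv
      obtain ⟨a, ha⟩ := W1m k v hk
      obtain ⟨b, hb⟩ := W2m k' v hv'
      exact h12 a b (huniq _ _ v ha hb))
    (by
      intro k'
      rw [Finset.disjoint_left]
      intro v hv hv'
      obtain ⟨k, hk⟩ := (hXm v).1 hv
      obtain ⟨a, ha⟩ := W1m k v hk
      obtain ⟨b, hb⟩ := W3m k' v hv'
      exact h13 a b (huniq _ _ v ha hb))
  have hXZ : Disjoint X Z0 := by
    rw [Finset.disjoint_left]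
    intro v hv hv'
    obtain ⟨k, hk⟩ := (hXm v).1 hv
    obtain ⟨a, ha⟩ := W1m k v hk
    rcases hZ0 v hv' with ⟨k', hk'⟩ | ⟨k', hk'⟩
    · obtain ⟨b, hb⟩ := W2m k' v hk'
      exact h12 a b (huniq _ _ v ha hb)
    · obtain ⟨b, hb⟩ := W3m k' v hk'
      exact h13 a b (huniq _ _ v ha hb)
  -- the remainder
  set U := Finset.univ \ (X ∪ Z0) with hU
  have hsub : (Finset.univ.biUnion fun t : Fin Kr => Cl (φ4 t)) ⊆ U := by
    intro v hv
    simp only [Finset.mem_biUnion, Finset.mem_univ, true_and] at hv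
    obtain ⟨t, ht⟩ := hv
    simp only [hU, Finset.mem_sdiff, Finset.mem_univ, true_and, Finset.mem_union, not_or]
    constructor
    · intro hvX
      obtain ⟨k, hk⟩ := (hXm v).1 hvX
      obtain ⟨a, ha⟩ := W1m k v hk
      exact h14 a t (huniq _ _ v ha ht)
    · intro hvZ
      rcases hZ0 v hvZ with ⟨k', hk'⟩ | ⟨k', hk'⟩
      · obtain ⟨b, hb⟩ := W2m k' v hk'
        exact h24 b t (huniq _ _ v hb ht)
      · obtain ⟨b, hb⟩ := W3m k' v hk'
        exact h34 b t (huniq _ _ v hb ht)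
  have hUdeg : ∀ b v, (1 / 2 + 3 / 2 * α) * (n * p) ≤ (dg (dr D b) v U : ℝ) := by
    intro b v
    have h1 := dg_biUnion (dr D b) v Finset.univ (fun t : Fin Kr => Cl (φ4 t))
      (fun i j hij => hCld _ _ (fun hh => hij (hφ4 hh))) (fun i => hCl1 b v _)
    rw [Finset.card_univ, Fintype.card_fin] at h1
    have h2 : (dg (dr D b) v (Finset.univ.biUnion fun t : Fin Kr => Cl (φ4 t)) : ℝ) ≤
        dg (dr D b) v U := by exact_mod_cast dg_mono _ v hsub
    refine le_trans ?_ (le_trans h1 h2)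
    rw [← hAK, hK]
    push_cast
    have := mul_le_mul_of_nonneg_right hKr hA0.le
    nlinarith
  obtain ⟨hp3, hp4⟩ := hpart ((1 / 2 + 3 / 2 * α) * (n * p)) (by nlinarith)
  obtain ⟨Cm, hCmU, hCmc, hCmd, hCmdeg⟩ := partition D U hKpos hε0 (by linarith) hp3 hUdeg hp4
  have hmm : U.card / K ≤ m := by
    rw [hm, hnV]
    exact Nat.div_le_div_right (Finset.card_le_univ U)
  have hmm' : ((U.card / K : ℕ) : ℝ) ≤ m := by exact_mod_cast hmm
  have hCm2 : ∀ b v i, (1 / 2 + α) * (m * p) ≤ (dg (dr D b) v (Cm i) : ℝ) := by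
    intro b v i
    refine le_trans ?_ (hCmdeg b v i)
    have h1 : ((1 / 2 + 3 / 2 * α) * (n * p) - K) / K = (1 / 2 + 3 / 2 * α) * A - 1 := by
      rw [hA]; field_simp
    rw [h1]
    have h2 : (1 / 2 + α) * (m * p) ≤ (1 / 2 + α) * A := mul_le_mul_of_nonneg_left hmn (by positivity)
    nlinarith
  obtain ⟨ι, hι, s, e, Z, hZ, hZd, hZcov, hZcard⟩ := path_cover hKpos hE hg (by positivity)
    (d := (1 / 2 + α) * (m * p)) (m := U.card / K) (by nlinarith) (by
      have h1 : (1 + α / 2) * p * ((U.card / K : ℕ) : ℝ) ≤ (1 + α / 2) * p * m :=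
        mul_le_mul_of_nonneg_left hmm' (by positivity)
      nlinarith) U (by
      have h1 := Nat.div_add_mod U.card K
      have h2 := Nat.mod_lt U.card (show K > 0 by omega)
      omega) Cm hCmU hCmc hCmd hCm2
  have hP1 : Par D g ((1 + α / 2) * p) (C1 * ((1 / 2 + α) * (m * p))) (C1 * (α / 2 * (m * p)))
      (C1 * m) (Fintype.card ι + 1) h := by
    refine mkPar hE hg hα hp hc0 hc0' hm1 hC1' ?_ h4 (hnV ▸ hh)
    rw [hC1]
    have : Fintype.card ι + 1 ≤ 2 * m := by omega
    calc c0 * (Fintype.card ι + 1) ≤ c0 * (2 * m) := by gcongr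
      _ = 2 * c0 * m := by ring
  exact finish hh1 hN hP1 W1 X hXm (fun c k v => W1a c k v) W1b W1c s0 e0 Z0 hXZ habs s e Z hZ hZd hZcov
end HamPf

namespace HamPf

lemma size_bounds {h N c0 C1 C3 Rs : ℕ} (hh1 : 1 ≤ h) (hN : N = 4 * h + 2) (hC1 : C1 = 2 * c0)
    (hC3 : C3 = c0 * (h * N * C1) * (2 * h + 1))
    (hRs : Rs = h * N * C1 + 2 * (h * N * C3)) : Rs ≤ (12 * c0 + 432 * c0 ^ 2) * h ^ 5 := by
  have hN6 : N ≤ 6 * h := by omega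
  have h1 : h * N * C1 ≤ 12 * c0 * h ^ 2 := by
    calc h * N * C1 ≤ h * (6 * h) * C1 := by gcongr
      _ = 12 * c0 * h ^ 2 := by rw [hC1]; ring
  have h2 : C3 ≤ 36 * c0 ^ 2 * h ^ 3 := by
    rw [hC3]
    calc c0 * (h * N * C1) * (2 * h + 1) ≤ c0 * (12 * c0 * h ^ 2) * (3 * h) := by
          gcongr
          omega
      _ = 36 * c0 ^ 2 * h ^ 3 := by ring
  have h3 : h * N * C3 ≤ 216 * c0 ^ 2 * h ^ 5 := by
    calc h * N * C3 ≤ h * (6 * h) * (36 * c0 ^ 2 * h ^ 3) := by gcongr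
      _ = 216 * c0 ^ 2 * h ^ 5 := by ring
  have h4 : h ^ 2 ≤ h ^ 5 := Nat.pow_le_pow_right hh1 (by norm_num)
  have h5 : 12 * c0 * h ^ 2 ≤ 12 * c0 * h ^ 5 := by gcongr
  rw [hRs]
  linarith

set_option maxHeartbeats 4000000 in
lemma numeric_main {n : ℕ} {α p L ε : ℝ} {D : Fin n → Fin n → Bool} (hα : 0 < α) (hp : 0 < p)
    (hp1 : p < 1) (hD : IsPseudorandom n α p D) (hL : L = Real.log n)
    {c0 c2 c4 : ℕ} (hc0 : 2 ≤ c0) (hc0' : 1 + α / 2 < α / 2 * c0)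
    (hc2 : ((12 * c0 + 432 * c0 ^ 2 : ℕ) : ℝ) * (2 + 6 * α) ≤ α * c2)
    (hc4 : c4 = (12 * c0 + 432 * c0 ^ 2 + c2) * 243) (hε : ε = α / (6 + 8 * α))
    (hL3 : 3 ≤ L) (hLα : 1 + α / 2 < L) (hb : (c4 : ℝ) ≤ ε * L) (hc : 2 * (c4 : ℝ) ^ 2 ≤ L)
    (he : 24 * (c4 : ℝ) ≤ ε ^ 2 * L) (hd : 64 * (c4:ℝ) ≤ α * L ^ (0.9 : ℝ))
    (hd2 : 2 ≤ L ^ (0.9 : ℝ)) (hn12 : L ^ 12 ≤ n) (hnp8 : L ^ 8 ≤ n * p) :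
    IsHamiltonian D := by
  obtain ⟨P1, P2, P3⟩ := hD
  have hL0 : 0 < L := by linarith
  have hε0 : 0 < ε := by rw [hε]; positivity
  have hε1 : ε ≤ 1 := by
    rw [hε, div_le_iff₀ (by positivity)]
    linarith
  have r1 : L ^ (1.1 : ℝ) * L ^ (0.9 : ℝ) = L ^ 2 := by
    rw [← Real.rpow_add hL0, ← Real.rpow_natCast]; norm_num
  have r2 : L ^ (2.1 : ℝ) * L ^ (0.9 : ℝ) = L ^ 3 := by
    rw [← Real.rpow_add hL0, ← Real.rpow_natCast]; norm_num
  have r3 : L ^ (2.1 : ℝ) = L * L ^ (1.1 : ℝ) := by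
    rw [show (2.1 : ℝ) = 1 + 1.1 by norm_num, Real.rpow_add hL0, Real.rpow_one]
  have x1 : 1 ≤ L ^ (1.1 : ℝ) := Real.one_le_rpow (by linarith) (by norm_num)
  set x := L ^ (1.1 : ℝ) with hx
  set l := L ^ (2.1 : ℝ) with hl
  set y := L ^ (0.9 : ℝ) with hy
  have hl0 : 0 < l := by rw [r3]; positivity
  have hn1 : (1:ℝ) ≤ n := le_trans (one_le_pow₀ (by linarith)) hn12
  have hn0 : n ≠ 0 := by
    rintro rfl
    norm_num at hn1
  have hLpos3 : (27:ℝ) ≤ L ^ 3 := by nlinarith [sq_nonneg L]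
  -- expansion
  have hE : ∀ b, ExpP (dr D b) (4 * l) ((1 + α / 2) * p) := by
    intro b
    have hs : (⌈x / p⌉₊ : ℝ) ≤ x / p + 1 := (Nat.ceil_lt_add_one (by positivity)).le
    refine expP_both (a2 := L ^ 2 / p) (s := x / p) hl0 (by positivity) (by positivity) ?_ ?_ ?_ ?_ ?_ b
    · intro X hX
      rw [hL] at hX
      have := P2 X hX
      rw [← hL] at this
      exact this
    · intro X Y hd hX hY
      rw [hx, hL] at hX hY
      have := P3 X Y hd hX hY
      refine le_trans this (le_of_eq ?_)
      ring
    · rw [← mul_div_assoc]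
      refine div_le_div_of_nonneg_right ?_ hp.le
      linarith [mul_le_mul_of_nonneg_left hd2 (show 0 ≤ x by linarith)]
    · rw [Fintype.card_fin]
      have h1 : (2:ℝ) * (x / p + 1) ≤ n := by
        have h2 : 2 * (x + p) ≤ n * p := by
          have h3 : x ≤ L ^ 2 := by linarith [mul_le_mul_of_nonneg_left hd2 (show 0 ≤ x by linarith)]
          have h4 : L ^ 8 = L ^ 2 * (L ^ 3 * L ^ 3) := by ring
          have h5 : L ^ 2 * (27 * 27) ≤ L ^ 2 * (L ^ 3 * L ^ 3) :=
            mul_le_mul_of_nonneg_left (mul_le_mul hLpos3 hLpos3 (by norm_num) (by positivity)) (by positivity)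
          linarith
        have h3 : (2:ℝ) * (x / p + 1) = 2 * (x + p) / p := by field_simp
        rw [h3, div_le_iff₀ hp]
        exact h2
      have h2 : (2:ℝ) * ⌈x / p⌉₊ ≤ n := by linarith
      exact_mod_cast h2
    · have h1 : (1 + α / 2) * p * ⌈x / p⌉₊ ≤ (1 + α / 2) * p * (x / p + 1) :=
        mul_le_mul_of_nonneg_left hs (by positivity)
      have h2 : (1 + α / 2) * p * (x / p + 1) = (1 + α / 2) * (x + p) := by field_simp
      have h3 : (1 + α / 2) * (x + p) ≤ (1 + α / 2) * (2 * x) :=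
        mul_le_mul_of_nonneg_left (by linarith) (by positivity)
      have h4 : (1 + α / 2) * (2 * x) ≤ L * (2 * x) :=
        mul_le_mul_of_nonneg_right hLα.le (by positivity)
      rw [r3]
      have h5 : 0 < L * x := by positivity
      linarith
  -- parameters
  obtain ⟨h, hhdef⟩ : ∃ h, h = Nat.log 2 n + 1 := ⟨_, rfl⟩
  obtain ⟨N, hN⟩ : ∃ N, N = 4 * h + 2 := ⟨_, rfl⟩
  obtain ⟨C1, hC1⟩ : ∃ C1, C1 = 2 * c0 := ⟨_, rfl⟩
  obtain ⟨C3, hC3⟩ : ∃ C3, C3 = c0 * (h * N * C1) * (2 * h + 1) := ⟨_, rfl⟩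
  obtain ⟨Rs, hRs⟩ : ∃ Rs, Rs = h * N * C1 + 2 * (h * N * C3) := ⟨_, rfl⟩
  obtain ⟨Kr, hKr⟩ : ∃ Kr, Kr = c2 * h ^ 5 := ⟨_, rfl⟩
  obtain ⟨K, hK⟩ : ∃ K, K = Rs + Kr := ⟨_, rfl⟩
  obtain ⟨m, hm⟩ : ∃ m, m = n / K := ⟨_, rfl⟩
  have hh1 : 1 ≤ h := by omega
  have hh : n < 2 ^ h := by rw [hhdef]; exact Nat.lt_pow_succ_log_self (by norm_num) n
  have hRsb := size_bounds hh1 hN hC1 hC3 hRs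
  have hh3 : (h:ℝ) ≤ 3 * L := by
    have h1 : (2:ℝ) ^ (Nat.log 2 n) ≤ n := by exact_mod_cast Nat.pow_log_le_self 2 hn0
    have h2 := Real.log_le_log (by positivity) h1
    rw [Real.log_pow, ← hL] at h2
    have h3 := Real.log_two_gt_d9
    have h4 : (Nat.log 2 n : ℝ) * (1 / 2) ≤ Nat.log 2 n * Real.log 2 :=
      mul_le_mul_of_nonneg_left (by linarith) (Nat.cast_nonneg _)
    rw [hhdef]
    push_cast
    linarith
  have hKb : (K:ℝ) ≤ c4 * L ^ 5 := by
    have h1 : K ≤ (12 * c0 + 432 * c0 ^ 2 + c2) * h ^ 5 := by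
      rw [hK, hKr, add_mul]
      omega
    have h2 : (K:ℝ) ≤ ((12 * c0 + 432 * c0 ^ 2 + c2 : ℕ) : ℝ) * (h:ℝ) ^ 5 := by exact_mod_cast h1
    have h3 : (h:ℝ) ^ 5 ≤ (3 * L) ^ 5 := pow_le_pow_left₀ (Nat.cast_nonneg _) hh3 5
    have h4 := mul_le_mul_of_nonneg_left h3
      (Nat.cast_nonneg (α := ℝ) (12 * c0 + 432 * c0 ^ 2 + c2))
    refine le_trans (le_trans h2 h4) (le_of_eq ?_)
    rw [hc4]
    push_cast
    ring
  have hKpos : 1 ≤ K := by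
    have : 1 ≤ h * N * C1 := Nat.mul_pos (Nat.mul_pos hh1 (by omega)) (by omega)
    omega
  have hK0 : (1:ℝ) ≤ K := by exact_mod_cast hKpos
  have hL5 : 0 < L ^ 5 := by positivity
  have hKε : (K:ℝ) ≤ ε * (n * p) := by
    have h1 : (c4:ℝ) * L ^ 5 ≤ ε * L * L ^ 5 := mul_le_mul_of_nonneg_right hb hL5.le
    have h2 : ε * L * L ^ 5 ≤ ε * L ^ 8 := by
      have h3 : L ^ 8 = L ^ 6 * L ^ 2 := by ring
      have h4 : L ^ 6 * 1 ≤ L ^ 6 * L ^ 2 :=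
        mul_le_mul_of_nonneg_left (one_le_pow₀ (by linarith)) (by positivity)
      have h5 := mul_le_mul_of_nonneg_left h4 hε0.le
      rw [h3]
      linarith
    have h3 : ε * L ^ 8 ≤ ε * (n * p) := mul_le_mul_of_nonneg_left hnp8 hε0.le
    linarith
  have hKn : 2 * (K:ℝ) ^ 2 ≤ n := by
    have h1 : (K:ℝ) ^ 2 ≤ (c4 * L ^ 5) ^ 2 := pow_le_pow_left₀ (by linarith) hKb 2
    have h2 : 2 * (c4:ℝ) ^ 2 * L ^ 10 ≤ L * L ^ 10 := mul_le_mul_of_nonneg_right hc (by positivity)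
    have h3 : L * L ^ 10 * 1 ≤ L * L ^ 10 * L := mul_le_mul_of_nonneg_left (by linarith) (by positivity)
    linarith
  have hKn' : (K + 1) * K ≤ n := by
    have h1 : ((K:ℝ) + 1) * K ≤ n := by linarith [mul_le_mul_of_nonneg_left hK0 (show (0:ℝ) ≤ K by linarith)]
    exact_mod_cast h1
  have hmK : K + 1 ≤ m := by
    rw [hm, Nat.le_div_iff_mul_le (by omega)]
    exact hKn'
  have hnK : (n:ℝ) ≤ 2 * K * m := by
    have h1 := Nat.div_add_mod n K
    have h2 := Nat.mod_lt n (show K > 0 by omega)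
    rw [← hm] at h1
    have h3 : n ≤ 2 * K * m := by linarith [Nat.mul_le_mul_left K (show 1 ≤ m by omega)]
    exact_mod_cast h3
  have hK3 : (L ^ 3) * K ≤ c4 * (n * p) := by
    have h1 : L ^ 3 * K ≤ L ^ 3 * (c4 * L ^ 5) := mul_le_mul_of_nonneg_left hKb (by positivity)
    have h2 : (c4:ℝ) * L ^ 8 ≤ c4 * (n * p) := mul_le_mul_of_nonneg_left hnp8 (Nat.cast_nonneg _)
    linarith
  have hc4pos : (0:ℝ) < c4 := by
    have : 0 < c4 := by rw [hc4]; positivity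
    exact_mod_cast this
  have h4 : 4 * (4 * l) ≤ α / 2 * (m * p) := by
    -- 64 c4 l ≤ α L^3
    have h1 : 64 * (c4:ℝ) * l ≤ α * L ^ 3 := by
      have := mul_le_mul_of_nonneg_right hd hl0.le
      linarith [congrArg (fun t => α * t) r2]
    have h2 : (n:ℝ) * p ≤ 2 * K * (m * p) := by linarith [mul_le_mul_of_nonneg_right hnK hp.le]
    have h3 : c4 * (n * p) ≤ c4 * (2 * K * (m * p)) := mul_le_mul_of_nonneg_left h2 hc4pos.le
    have h5 : K * L ^ 3 ≤ K * (c4 * (2 * (m * p))) := by linarith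
    have h6 : L ^ 3 ≤ c4 * (2 * (m * p)) := le_of_mul_le_mul_left h5 (by linarith)
    have h7 : α * L ^ 3 ≤ α * (c4 * (2 * (m * p))) := mul_le_mul_of_nonneg_left h6 hα.le
    have h8 : c4 * (64 * l) ≤ c4 * (2 * α * (m * p)) := by linarith
    have h9 := le_of_mul_le_mul_left h8 hc4pos
    linarith
  have hch : (2 * n * K : ℝ) * Real.exp (-(ε ^ 2 * ((n * p / 4) / K) / 2)) < 1 := by
    have h1 : L ^ 3 / c4 ≤ n * p / K := by
      rw [div_le_div_iff₀ hc4pos (by linarith)]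
      linarith
    have h2 : 3 * L ≤ ε ^ 2 * ((n * p / 4) / K) / 2 := by
      have h3 : ε ^ 2 * ((n * p / 4) / K) / 2 = ε ^ 2 * (n * p / K) / 8 := by ring
      rw [h3]
      have h4 : ε ^ 2 * (L ^ 3 / c4) ≤ ε ^ 2 * (n * p / K) := mul_le_mul_of_nonneg_left h1 (sq_nonneg _)
      have h5 : 24 * L ≤ ε ^ 2 * (L ^ 3 / c4) := by
        rw [← mul_div_assoc, le_div_iff₀ hc4pos]
        have h6 := mul_le_mul_of_nonneg_right he (show 0 ≤ L ^ 2 by positivity)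
        have h7 : 24 * (c4:ℝ) * L * 1 ≤ 24 * c4 * L * L :=
          mul_le_mul_of_nonneg_left (by linarith) (by positivity)
        linarith
      linarith
    have h3 : Real.exp (-(ε ^ 2 * ((n * p / 4) / K) / 2)) ≤ ((n:ℝ) ^ 3)⁻¹ := by
      have e1 : Real.exp (-(3 * L)) = ((n:ℝ) ^ 3)⁻¹ := by
        rw [Real.exp_neg, hL, show (3 : ℝ) * Real.log n = ((3:ℕ) : ℝ) * Real.log n by norm_num,
          Real.exp_nat_mul, Real.exp_log (by linarith)]
      rw [← e1]
      exact Real.exp_le_exp.2 (by linarith)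
    have h5 : (2 * n * K : ℝ) * Real.exp (-(ε ^ 2 * ((n * p / 4) / K) / 2)) ≤
        (2 * n * K) * ((n:ℝ) ^ 3)⁻¹ := mul_le_mul_of_nonneg_left h3 (by positivity)
    refine lt_of_le_of_lt h5 ?_
    rw [← div_eq_mul_inv, div_lt_one (by positivity)]
    have h6 : 2 * (K:ℝ) ≤ n := by linarith [mul_le_mul_of_nonneg_left hK0 (show (0:ℝ) ≤ K by linarith)]
    have h7 : (1:ℝ) < n := by linarith
    have h8 : (n:ℝ) * (2 * K) ≤ n * n := mul_le_mul_of_nonneg_left h6 (by linarith)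
    have h9 : (n:ℝ) * n * 1 < n * n * n := mul_lt_mul_of_pos_left h7 (by positivity)
    linarith
  have hdeg : ∀ b v, (1 / 2 + 2 * α) * (n * p) ≤ (dg (dr D b) v Finset.univ : ℝ) := by
    intro b v
    rw [← mul_assoc]
    cases b
    · have := (P1 v).2
      simpa [dg, dr, inDeg] using this
    · have := (P1 v).1
      simpa [dg, dr, outDeg] using this
  have hKr' : (Rs:ℝ) * (2 + 6 * α) ≤ α * Kr := by
    have h1 : (Rs:ℝ) ≤ ((12 * c0 + 432 * c0 ^ 2 : ℕ) : ℝ) * (h:ℝ) ^ 5 := by exact_mod_cast hRsb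
    have h2 := mul_le_mul_of_nonneg_right h1 (show 0 ≤ 2 + 6 * α by positivity)
    have h3 := mul_le_mul_of_nonneg_right hc2 (show 0 ≤ (h:ℝ) ^ 5 by positivity)
    rw [hKr]
    push_cast at *
    linarith
  obtain ⟨s, e, hP, hes⟩ := main_det (D := D) (n := n) (by simp) hE (by positivity) hα hp hdeg hh1 hh hN
    hc0 hc0' hC1 hC3 hRs hKr' hK hε hKε hm hmK h4 hch
  exact ham_of_pth hP hes

end HamPf

/-- Theorem 3.2: with `p = ω(log^8 n / n)`, every `(n, α, p)`-pseudorandom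
digraph on sufficiently many vertices is Hamiltonian. -/
theorem stmt_4 (α : ℝ) (hα : 0 < α) (p : ℕ → ℝ) (hp : ∀ n, 0 < p n ∧ p n < 1)
    (hω : Tendsto (fun n : ℕ => p n * n / (Real.log n) ^ 8) atTop atTop)
    (D : (n : ℕ) → Fin n → Fin n → Bool)
    (hD : ∀ n, IsPseudorandom n α (p n) (D n)) :
    ∀ᶠ n in atTop, IsHamiltonian (D n) := by
  obtain ⟨c0', hc0'⟩ := exists_nat_gt ((1 + α / 2) / (α / 2))
  have hc0 : 1 + α / 2 < α / 2 * ((c0' + 2 : ℕ) : ℝ) := by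
    rw [div_lt_iff₀ (by positivity)] at hc0'
    push_cast
    linarith
  set c0 := c0' + 2
  obtain ⟨c2, hc2⟩ := exists_nat_ge (((12 * c0 + 432 * c0 ^ 2 : ℕ) : ℝ) * (2 + 6 * α) / α)
  rw [div_le_iff₀ hα] at hc2
  obtain ⟨c4, hc4⟩ : ∃ c4, c4 = (12 * c0 + 432 * c0 ^ 2 + c2) * 243 := ⟨_, rfl⟩
  obtain ⟨ε, hε⟩ : ∃ ε, ε = α / (6 + 8 * α) := ⟨_, rfl⟩
  have hε0 : 0 < ε := by rw [hε]; positivity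
  have tl : Tendsto (fun n : ℕ => Real.log n) atTop atTop :=
    Real.tendsto_log_atTop.comp tendsto_natCast_atTop_atTop
  have tl9 : Tendsto (fun n : ℕ => (Real.log n) ^ (0.9 : ℝ)) atTop atTop :=
    (tendsto_rpow_atTop (by norm_num)).comp tl
  have t12 : ∀ᶠ n : ℕ in atTop, (Real.log n) ^ 12 ≤ n := by
    have h1 := (Real.isLittleO_pow_log_id_atTop (n := 12)).bound (show (0:ℝ) < 1 by norm_num)
    have h2 := tendsto_natCast_atTop_atTop (R := ℝ) |>.eventually h1
    filter_upwards [h2] with n hn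
    simp only [id, one_mul, Real.norm_eq_abs] at hn
    rw [Nat.abs_cast] at hn
    exact le_trans (le_abs_self _) hn
  filter_upwards [hω.eventually_ge_atTop 1, tl.eventually_ge_atTop 3,
    tl.eventually_gt_atTop (1 + α / 2), tl.eventually_ge_atTop (c4 / ε),
    tl.eventually_ge_atTop (2 * (c4:ℝ) ^ 2), tl.eventually_ge_atTop (24 * c4 / ε ^ 2),
    tl9.eventually_ge_atTop (64 * c4 / α), tl9.eventually_ge_atTop 2, t12]
    with n h1 h2 h3 h4 h5 h6 h7 h8 h9
  refine HamPf.numeric_main hα (hp n).1 (hp n).2 (hD n) rfl (c0 := c0) (c2 := c2) (c4 := c4) (by omega) hc0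
    (by linarith) hc4 hε h2 h3 ?_ h5 ?_ ?_ h8 h9 ?_
  · rw [div_le_iff₀ hε0] at h4
    linarith
  · rw [div_le_iff₀ (by positivity)] at h6
    linarith
  · rw [div_le_iff₀ hα] at h7
    linarith
  · have h0 : 0 < Real.log n ^ 8 := by
      have : 0 < Real.log n := by linarith
      positivity
    rw [le_div_iff₀ h0] at h1
    linarith
end

section
/- Let D be an (n,α,p)-pseudorandom digraph with p = ω((log n)^8/n). Then for n large there is a partition V(D) = V_1 ∪ V_2 ∪ V_3 ∪ V_4 ∪ V_5 such that: every vertex v and every i ∈ {1,...,5} satisfy d^+(v,V_i), d^−(v,V_i) ≥ (1/2 + α)|V_i|p; |V_1| = (1+o(1))n/(log n)^3; and |V_2|, |V_3|, |V_4| each lie in the interval (αn/(5(1+2α)), αn/(4(1+2α))). -/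
open Filter

lemma aux_mgf {n : ℕ} (q : Fin 5 → ℝ) (hq : ∀ i, 0 ≤ q i) (hs : ∑ i, q i = 1)
    (S : Finset (Fin n)) (i : Fin 5) (t : ℝ) (ht : |t| ≤ 1) :
    ∑ f : Fin n → Fin 5, (∏ v, q (f v)) * Real.exp (t * ((S.filter fun v => f v = i).card : ℝ))
      ≤ Real.exp (S.card * q i * (t + t ^ 2)) := by
  have h1 : ∀ f : Fin n → Fin 5,
      (∏ v, q (f v)) * Real.exp (t * ((S.filter fun v => f v = i).card : ℝ))
      = ∏ v, (q (f v) * (if v ∈ S ∧ f v = i then Real.exp t else 1)) := by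
    intro f
    rw [Finset.prod_mul_distrib]
    congr 1
    rw [Finset.prod_ite]
    simp only [Finset.prod_const, one_pow, mul_one]
    rw [← Real.exp_nat_mul, mul_comm]
    have hS : (Finset.univ.filter fun v => v ∈ S ∧ f v = i) = S.filter fun v => f v = i := by
      ext v; simp
    rw [hS]
  have h2 : ∑ f : Fin n → Fin 5,
      (∏ v, q (f v)) * Real.exp (t * ((S.filter fun v => f v = i).card : ℝ))
      = ∏ v : Fin n, ∑ j : Fin 5, (q j * (if v ∈ S ∧ j = i then Real.exp t else 1)) := by
    rw [Finset.prod_univ_sum, Fintype.piFinset_univ]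
    exact Finset.sum_congr rfl fun f _ => h1 f
  rw [h2]
  have h3 : ∀ v : Fin n, ∑ j : Fin 5, (q j * (if v ∈ S ∧ j = i then Real.exp t else 1))
      = if v ∈ S then 1 + q i * (Real.exp t - 1) else 1 := by
    intro v
    by_cases hv : v ∈ S
    · simp only [hv, true_and, if_true]
      have : ∀ j : Fin 5, q j * (if j = i then Real.exp t else 1)
          = q j + (if j = i then q j * (Real.exp t - 1) else 0) := by
        intro j; split_ifs <;> ring
      rw [Finset.sum_congr rfl fun j _ => this j, Finset.sum_add_distrib, hs]
      simp
    · simp [hv, hs]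
  rw [Finset.prod_congr rfl fun v _ => h3 v]
  rw [Finset.prod_ite]
  simp only [Finset.prod_const, one_pow, mul_one]
  have hf : (Finset.univ.filter fun v => v ∈ S) = S := by ext; simp
  rw [hf]
  have hqi : q i ≤ 1 := by
    rw [← hs]; exact Finset.single_le_sum (fun j _ => hq j) (Finset.mem_univ i)
  have hb := (abs_le.1 (Real.abs_exp_sub_one_sub_id_le ht)).2
  have h0 : 0 ≤ 1 + q i * (Real.exp t - 1) := by
    nlinarith [Real.exp_pos t, hq i, mul_nonneg (hq i) (Real.exp_pos t).le]
  have h4 : 1 + q i * (Real.exp t - 1) ≤ Real.exp (q i * (t + t ^ 2)) := by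
    have := Real.add_one_le_exp (q i * (t + t ^ 2))
    have h5 : q i * (Real.exp t - 1) ≤ q i * (t + t ^ 2) :=
      mul_le_mul_of_nonneg_left (by linarith) (hq i)
    linarith
  calc _ ≤ (Real.exp (q i * (t + t ^ 2))) ^ S.card := pow_le_pow_left₀ h0 h4 _
    _ = _ := by rw [← Real.exp_nat_mul, mul_assoc]

lemma aux_tail {n : ℕ} (q : Fin 5 → ℝ) (hq : ∀ i, 0 ≤ q i) (hs : ∑ i, q i = 1)
    (S : Finset (Fin n)) (i : Fin 5) (t : ℝ) (ht : |t| ≤ 1) :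
    ∑ f : Fin n → Fin 5, (if 2 * t ^ 2 * (S.card * q i) ≤
        t * (((S.filter fun v => f v = i).card : ℝ) - S.card * q i) then (∏ v, q (f v)) else 0)
      ≤ Real.exp (- (t ^ 2 * (S.card * q i))) := by
  have key : ∀ f : Fin n → Fin 5, (if 2 * t ^ 2 * (S.card * q i) ≤
        t * (((S.filter fun v => f v = i).card : ℝ) - S.card * q i) then (∏ v, q (f v)) else 0)
      ≤ Real.exp (-((t + 2 * t ^ 2) * (S.card * q i))) *
        ((∏ v, q (f v)) * Real.exp (t * ((S.filter fun v => f v = i).card : ℝ))) := by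
    intro f
    have hw : 0 ≤ ∏ v, q (f v) := Finset.prod_nonneg fun v _ => hq _
    split_ifs with h
    · rw [mul_left_comm, ← Real.exp_add]
      apply le_mul_of_one_le_right hw
      apply Real.one_le_exp
      linarith
    · positivity
  calc _ ≤ _ := Finset.sum_le_sum fun f _ => key f
    _ ≤ Real.exp (-((t + 2 * t ^ 2) * (S.card * q i))) *
        Real.exp (S.card * q i * (t + t ^ 2)) := by
      rw [← Finset.mul_sum]
      exact mul_le_mul_of_nonneg_left (aux_mgf q hq hs S i t ht) (Real.exp_pos _).le
    _ = _ := by rw [← Real.exp_add]; congr 1; ring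

lemma aux_exists {n : ℕ} (q : Fin 5 → ℝ) (hq : ∀ i, 0 ≤ q i) (hs : ∑ i, q i = 1)
    {K : Type} [Fintype K] (S : K → Finset (Fin n)) (ε m : ℝ) (hε : 0 < ε) (hε1 : ε ≤ 1)
    (hm : ∀ k i, m ≤ ε ^ 2 * ((S k).card * q i))
    (hc : (Fintype.card K * 10 : ℝ) * Real.exp (-(m / 4)) < 1) :
    ∃ f : Fin n → Fin 5, ∀ k i,
      (1 - ε) * ((S k).card * q i) ≤ (((S k).filter fun v => f v = i).card : ℝ) ∧
      (((S k).filter fun v => f v = i).card : ℝ) ≤ (1 + ε) * ((S k).card * q i) := by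
  by_contra hcon
  push Not at hcon
  let t : Bool → ℝ := fun b => if b then ε / 2 else -(ε / 2)
  have ht : ∀ b, |t b| ≤ 1 := by
    intro b; rw [abs_le]; cases b <;> simp only [t] <;> constructor <;> norm_num <;> linarith
  have ht2 : ∀ b, t b ^ 2 = ε ^ 2 / 4 := by
    intro b; cases b <;> simp only [t] <;> norm_num <;> ring
  let B : (K × Fin 5 × Bool) → (Fin n → Fin 5) → ℝ := fun x f =>
    if 2 * t x.2.2 ^ 2 * ((S x.1).card * q x.2.1) ≤
        t x.2.2 * ((((S x.1).filter fun v => f v = x.2.1).card : ℝ) - (S x.1).card * q x.2.1)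
      then (∏ v, q (f v)) else 0
  have hB0 : ∀ x f, 0 ≤ B x f := by
    intro x f
    simp only [B]
    split_ifs
    · exact Finset.prod_nonneg fun v _ => hq _
    · exact le_rfl
  have hB : ∀ x, ∑ f, B x f ≤ Real.exp (-(m / 4)) := by
    intro x
    refine (aux_tail q hq hs (S x.1) x.2.1 (t x.2.2) (ht _)).trans ?_
    apply Real.exp_le_exp.2
    rw [ht2]
    have := hm x.1 x.2.1
    linarith
  have hone : ∑ f : Fin n → Fin 5, ∏ v, q (f v) = 1 := by
    have := Finset.prod_univ_sum (fun _ : Fin n => (Finset.univ : Finset (Fin 5)))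
      (fun _ j => q j)
    rw [Fintype.piFinset_univ] at this
    rw [← this]; simp [hs]
  have hle : ∀ f : Fin n → Fin 5, ∏ v, q (f v) ≤ ∑ x, B x f := by
    intro f
    obtain ⟨k, i, h⟩ := hcon f
    by_cases h1 : (1 - ε) * ((S k).card * q i) ≤ (((S k).filter fun v => f v = i).card : ℝ)
    · have h2 := h h1
      refine le_trans ?_ (Finset.single_le_sum (fun x _ => hB0 x f)
        (Finset.mem_univ ((k, i, true) : K × Fin 5 × Bool)))
      simp only [B]
      rw [if_pos]
      rw [ht2]
      simp only [t, if_true]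
      nlinarith
    · push Not at h1
      refine le_trans ?_ (Finset.single_le_sum (fun x _ => hB0 x f)
        (Finset.mem_univ ((k, i, false) : K × Fin 5 × Bool)))
      simp only [B]
      rw [if_pos]
      rw [ht2]
      simp only [t, Bool.false_eq_true, if_false]
      nlinarith
  have : (1 : ℝ) ≤ (Fintype.card K * 10 : ℝ) * Real.exp (-(m / 4)) := by
    rw [← hone]
    calc _ ≤ ∑ f, ∑ x, B x f := Finset.sum_le_sum fun f _ => hle f
      _ = ∑ x, ∑ f, B x f := Finset.sum_comm
      _ ≤ ∑ x : K × Fin 5 × Bool, Real.exp (-(m / 4)) := Finset.sum_le_sum fun x _ => hB x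
      _ = _ := by simp [Fintype.card_prod]
  linarith

/-- The finite statement, with all the largeness conditions on n made explicit. -/
lemma aux_finite {n : ℕ} (α p : ℝ) (hα : 0 < α) (hp0 : 0 < p) (hp1 : p < 1)
    (D : Fin n → Fin n → Bool)
    (hdeg : ∀ v : Fin n, (1/2 + 2*α) * n * p ≤ (outDeg D v Finset.univ : ℝ) ∧
      (1/2 + 2*α) * n * p ≤ (inDeg D v Finset.univ : ℝ))
    (hn : 10 ≤ n) (L : ℝ) (hL : L = Real.log n) (hL10 : 10 ≤ L)
    (hLα : 1 / L * (1 + 3 * α) ≤ α)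
    (hLc : 1 / L ^ 3 ≤ 9 * α / (40 * (1 + 2 * α)))
    (hnp : L ^ 8 ≤ p * n) :
    ∃ f : Fin n → Fin 5,
      (∀ v : Fin n, ∀ i : Fin 5,
        (1/2 + α) * ((Finset.univ.filter fun v => f v = i).card : ℝ) * p
          ≤ (outDeg D v (Finset.univ.filter fun v => f v = i) : ℝ) ∧
        (1/2 + α) * ((Finset.univ.filter fun v => f v = i).card : ℝ) * p
          ≤ (inDeg D v (Finset.univ.filter fun v => f v = i) : ℝ)) ∧
      (∀ i : Fin 5, i = 1 ∨ i = 2 ∨ i = 3 →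
          α * n / (5 * (1 + 2*α)) < ((Finset.univ.filter fun v => f v = i).card : ℝ) ∧
          ((Finset.univ.filter fun v => f v = i).card : ℝ) < α * n / (4 * (1 + 2*α))) ∧
      (1 - 1 / L ≤ ((Finset.univ.filter fun v => f v = 0).card : ℝ) * L ^ 3 / n ∧
       ((Finset.univ.filter fun v => f v = 0).card : ℝ) * L ^ 3 / n ≤ 1 + 1 / L) := by
  have hL0 : 0 < L := by linarith
  have hn' : (10 : ℝ) ≤ n := by exact_mod_cast hn
  set c : ℝ := 9 * α / (40 * (1 + 2 * α)) with hc
  have hc9 : c ≤ 9 / 80 := by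
    rw [hc, div_le_div_iff₀ (by positivity) (by norm_num)]; nlinarith
  have hc0 : 0 < c := by positivity
  have hl0 : 0 < 1 / L ^ 3 := by positivity
  let q : Fin 5 → ℝ := ![1 / L ^ 3, c, c, c, 1 - 3 * c - 1 / L ^ 3]
  have hql : ∀ i, 1 / L ^ 3 ≤ q i := by
    intro i; fin_cases i <;> simp [q] <;> simp at hLc hl0 ⊢ <;> linarith
  have hq : ∀ i, 0 ≤ q i := fun i => hl0.le.trans (hql i)
  have hs : ∑ i, q i = 1 := by
    simp [q, Fin.sum_univ_five]; ring
  let S : Option (Fin n ⊕ Fin n) → Finset (Fin n) := fun k =>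
    match k with
    | none => Finset.univ
    | some (Sum.inl v) => Finset.univ.filter fun w => D v w = true
    | some (Sum.inr v) => Finset.univ.filter fun w => D w v = true
  have hnp0 : 0 < p * n := by positivity
  have hS : ∀ k, p * n / 2 ≤ ((S k).card : ℝ) := by
    intro k
    match k with
    | none => simp only [S, Finset.card_univ, Fintype.card_fin]; nlinarith
    | some (Sum.inl v) =>
      have := (hdeg v).1
      simp only [outDeg] at this
      simp only [S]; nlinarith
    | some (Sum.inr v) =>
      have := (hdeg v).2
      simp only [inDeg] at this
      simp only [S]; nlinarith
  have hε : 0 < 1 / L := by positivity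
  have hε10 : 1 / L ≤ 1 / 10 := one_div_le_one_div_of_le (by norm_num) hL10
  obtain ⟨f, hf⟩ := aux_exists q hq hs S (1 / L) (L ^ 3 / 2) hε (by linarith)
    (by
      intro k i
      have h1 : L ^ 8 / 2 * (1 / L ^ 3) ≤ (S k).card * q i :=
        mul_le_mul (by linarith [hS k]) (hql i) hl0.le (by positivity)
      calc L ^ 3 / 2 = (1 / L) ^ 2 * (L ^ 8 / 2 * (1 / L ^ 3)) := by field_simp
        _ ≤ _ := mul_le_mul_of_nonneg_left h1 (by positivity))
    (by
      have h1 : Real.exp (-(L ^ 3 / 2 / 4)) ≤ Real.exp (-(3 * L)) := by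
        apply Real.exp_le_exp.2
        have : 0 ≤ L * (L ^ 2 - 24) := mul_nonneg hL0.le (by nlinarith)
        nlinarith
      have h2 : Real.exp (-(3 * L)) = 1 / (n : ℝ) ^ 3 := by
        rw [Real.exp_neg, hL]
        have : Real.exp (3 * Real.log n) = (n : ℝ) ^ 3 := by
          have := Real.exp_nat_mul (Real.log n) 3
          rw [Real.exp_log (by linarith)] at this
          exact_mod_cast this
        rw [this, one_div]
      have h3 : (Fintype.card (Option (Fin n ⊕ Fin n)) : ℝ) = 2 * n + 1 := by
        simp; ring
      rw [h3]
      calc _ ≤ ((2 * (n : ℝ) + 1) * 10) * (1 / (n : ℝ) ^ 3) := by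
            rw [← h2]; exact mul_le_mul_of_nonneg_left h1 (by positivity)
        _ < 1 := by
            rw [mul_one_div, div_lt_one (by positivity)]
            nlinarith [mul_nonneg (sub_nonneg.2 hn') (sub_nonneg.2 hn'),
              mul_nonneg (sub_nonneg.2 hn') (sq_nonneg (n : ℝ))])
  have hV : ∀ i, (1 - 1 / L) * (n * q i) ≤ ((Finset.univ.filter fun v => f v = i).card : ℝ) ∧
      ((Finset.univ.filter fun v => f v = i).card : ℝ) ≤ (1 + 1 / L) * (n * q i) := by
    intro i
    have := hf none i
    simpa only [S, Finset.card_univ, Fintype.card_fin] using this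
  have hmain : ∀ (i : Fin 5) (d : ℝ), (1/2 + 2*α) * n * p ≤ d →
      (1/2 + α) * ((Finset.univ.filter fun v => f v = i).card : ℝ) * p
        ≤ (1 - 1 / L) * (d * q i) := by
    intro i d hd
    have h1 : (1/2 + α) * (1 + 1 / L) ≤ (1 - 1 / L) * (1/2 + 2*α) := by nlinarith
    have hnq : 0 ≤ n * q i * p := mul_nonneg (mul_nonneg (by linarith) (hq i)) hp0.le
    calc _ ≤ (1/2 + α) * ((1 + 1 / L) * (n * q i)) * p := by
          gcongr; exact (hV i).2
      _ = ((1/2 + α) * (1 + 1 / L)) * (n * q i * p) := by ring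
      _ ≤ ((1 - 1 / L) * (1/2 + 2*α)) * (n * q i * p) := mul_le_mul_of_nonneg_right h1 hnq
      _ = (1 - 1 / L) * (((1/2 + 2*α) * n * p) * q i) := by ring
      _ ≤ _ := mul_le_mul_of_nonneg_left (mul_le_mul_of_nonneg_right hd (hq i)) (by linarith)
  refine ⟨f, ?_, ?_, ?_⟩
  · intro v i
    constructor
    · refine (hmain i _ (hdeg v).1).trans ?_
      have := (hf (some (Sum.inl v)) i).1
      simp only [S] at this
      simp only [outDeg]
      rw [Finset.filter_comm]
      exact this
    · refine (hmain i _ (hdeg v).2).trans ?_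
      have := (hf (some (Sum.inr v)) i).1
      simp only [S] at this
      simp only [inDeg]
      rw [Finset.filter_comm]
      exact this
  · intro i hi
    have hqi : q i = c := by rcases hi with rfl | rfl | rfl <;> rfl
    obtain ⟨h1, h2⟩ := hV i
    rw [hqi] at h1 h2
    have hnc : 0 < n * c := by positivity
    have e1 : α * n / (5 * (1 + 2*α)) = 8 / 9 * (n * c) := by
      rw [hc]; field_simp; norm_num
    have e2 : α * n / (4 * (1 + 2*α)) = 10 / 9 * (n * c) := by
      rw [hc]; field_simp; norm_num
    rw [e1, e2]
    constructor <;> nlinarith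
  · obtain ⟨h1, h2⟩ := hV 0
    have hq0 : q 0 = 1 / L ^ 3 := rfl
    have e : (n : ℝ) * q 0 = n / L ^ 3 := by rw [hq0]; ring
    rw [e] at h1 h2
    have hnn : (0 : ℝ) < n := by linarith
    constructor
    · rw [le_div_iff₀ hnn]
      calc _ = (1 - 1 / L) * (n / L ^ 3) * L ^ 3 := by field_simp
        _ ≤ _ := by gcongr
    · rw [div_le_iff₀ hnn]
      calc _ ≤ (1 + 1 / L) * (n / L ^ 3) * L ^ 3 := by gcongr
        _ = _ := by field_simp

/-- Claim 3.3: a pseudorandom digraph admits a partition `V = V₁ ∪ ... ∪ V₅`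
with proportionally large in/out-degrees into each part, `|V₁| = (1+o(1)) n / log³ n`
and `|V₂|, |V₃|, |V₄| ∈ (αn/(5(1+2α)), αn/(4(1+2α)))`. -/
theorem stmt_14 (α : ℝ) (hα : 0 < α) (p : ℕ → ℝ) (hp : ∀ n, 0 < p n ∧ p n < 1)
    (hω : Tendsto (fun n : ℕ => p n * n / (Real.log n) ^ 8) atTop atTop)
    (D : (n : ℕ) → Fin n → Fin n → Bool)
    (hD : ∀ n, IsPseudorandom n α (p n) (D n)) :
    ∃ V : (n : ℕ) → Fin 5 → Finset (Fin n),
      (∀ᶠ n in atTop,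
        (∀ i j, i ≠ j → Disjoint (V n i) (V n j)) ∧
        (Finset.univ : Finset (Fin n)) = Finset.univ.biUnion (V n) ∧
        (∀ v : Fin n, ∀ i : Fin 5,
          (1/2 + α) * (V n i).card * p n ≤ (outDeg (D n) v (V n i) : ℝ) ∧
          (1/2 + α) * (V n i).card * p n ≤ (inDeg (D n) v (V n i) : ℝ)) ∧
        (∀ i : Fin 5, i = 1 ∨ i = 2 ∨ i = 3 →
          α * n / (5 * (1 + 2*α)) < ((V n i).card : ℝ) ∧
          ((V n i).card : ℝ) < α * n / (4 * (1 + 2*α)))) ∧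
      Tendsto (fun n : ℕ => ((V n 0).card : ℝ) * (Real.log n) ^ 3 / n)
        atTop (nhds 1) := by
  have hlog : Tendsto (fun n : ℕ => Real.log n) atTop atTop :=
    Real.tendsto_log_atTop.comp tendsto_natCast_atTop_atTop
  have hinv : Tendsto (fun n : ℕ => 1 / Real.log n) atTop (nhds 0) := by
    simp only [one_div]
    exact tendsto_inv_atTop_zero.comp hlog
  have hev : ∀ᶠ n : ℕ in atTop, ∃ f : Fin n → Fin 5,
      (∀ v : Fin n, ∀ i : Fin 5,
        (1/2 + α) * ((Finset.univ.filter fun v => f v = i).card : ℝ) * p n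
          ≤ (outDeg (D n) v (Finset.univ.filter fun v => f v = i) : ℝ) ∧
        (1/2 + α) * ((Finset.univ.filter fun v => f v = i).card : ℝ) * p n
          ≤ (inDeg (D n) v (Finset.univ.filter fun v => f v = i) : ℝ)) ∧
      (∀ i : Fin 5, i = 1 ∨ i = 2 ∨ i = 3 →
          α * n / (5 * (1 + 2*α)) < ((Finset.univ.filter fun v => f v = i).card : ℝ) ∧
          ((Finset.univ.filter fun v => f v = i).card : ℝ) < α * n / (4 * (1 + 2*α))) ∧
      (1 - 1 / Real.log n ≤
        ((Finset.univ.filter fun v => f v = 0).card : ℝ) * (Real.log n) ^ 3 / n ∧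
       ((Finset.univ.filter fun v => f v = 0).card : ℝ) * (Real.log n) ^ 3 / n
        ≤ 1 + 1 / Real.log n) := by
    have t1 : Tendsto (fun n : ℕ => 1 / Real.log n * (1 + 3 * α)) atTop (nhds 0) := by
      simpa using hinv.mul_const (1 + 3 * α)
    have t2 : Tendsto (fun n : ℕ => 1 / Real.log n ^ 3) atTop (nhds 0) := by
      have := hinv.pow 3
      simpa using this
    have hc0 : 0 < 9 * α / (40 * (1 + 2 * α)) := by positivity
    filter_upwards [eventually_ge_atTop 10, hlog.eventually_ge_atTop 10,
      t1.eventually_le_const hα, t2.eventually_le_const hc0, hω.eventually_ge_atTop 1]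
      with n h1 h2 h3 h4 h5
    refine aux_finite α (p n) hα (hp n).1 (hp n).2 (D n) (hD n).1 h1 (Real.log n) rfl h2 h3 h4 ?_
    rw [le_div_iff₀ (by positivity)] at h5
    linarith
  obtain ⟨f, hf⟩ : ∃ f : (n : ℕ) → Fin n → Fin 5, ∀ᶠ n : ℕ in atTop,
      (∀ v : Fin n, ∀ i : Fin 5,
        (1/2 + α) * ((Finset.univ.filter fun v => f n v = i).card : ℝ) * p n
          ≤ (outDeg (D n) v (Finset.univ.filter fun v => f n v = i) : ℝ) ∧
        (1/2 + α) * ((Finset.univ.filter fun v => f n v = i).card : ℝ) * p n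
          ≤ (inDeg (D n) v (Finset.univ.filter fun v => f n v = i) : ℝ)) ∧
      (∀ i : Fin 5, i = 1 ∨ i = 2 ∨ i = 3 →
          α * n / (5 * (1 + 2*α)) < ((Finset.univ.filter fun v => f n v = i).card : ℝ) ∧
          ((Finset.univ.filter fun v => f n v = i).card : ℝ) < α * n / (4 * (1 + 2*α))) ∧
      (1 - 1 / Real.log n ≤
        ((Finset.univ.filter fun v => f n v = 0).card : ℝ) * (Real.log n) ^ 3 / n ∧
       ((Finset.univ.filter fun v => f n v = 0).card : ℝ) * (Real.log n) ^ 3 / n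
        ≤ 1 + 1 / Real.log n) := by
    rw [eventually_atTop] at hev
    obtain ⟨N, hN⟩ := hev
    choose g hg using hN
    refine ⟨fun n => if h : N ≤ n then g n h else fun _ => 0, ?_⟩
    filter_upwards [eventually_ge_atTop N] with n hn
    simp only [dif_pos hn]
    exact hg n hn
  refine ⟨fun n i => Finset.univ.filter fun v => f n v = i, ?_, ?_⟩
  · filter_upwards [hf] with n hn
    refine ⟨?_, ?_, hn.1, hn.2.1⟩
    · intro i j hij
      rw [Finset.disjoint_left]
      intro v hv hv'
      simp only [Finset.mem_filter, Finset.mem_univ, true_and] at hv hv'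
      exact hij (hv.symm.trans hv')
    · ext v; simp
  · refine tendsto_of_tendsto_of_tendsto_of_le_of_le' (g := fun n : ℕ => 1 - 1 / Real.log n)
      (h := fun n : ℕ => 1 + 1 / Real.log n) ?_ ?_ ?_ ?_
    · simpa using hinv.const_sub 1
    · simpa using hinv.const_add 1
    · filter_upwards [hf] with n hn using hn.2.2.1
    · filter_upwards [hf] with n hn using hn.2.2.2
end
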